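/- Let F(x,y) = h_n·x^n + h_k·x^k·y^(n−k) + h_0·y^n be an irreducible trinomial binary form of degree n ≥ 6. Then N_F ≤ z(n)·R_F + ℓ(n)·C_F, where N_F is the number of regular solutions of |F(x,y)| = 1, R_F is the number of real roots of f(x) := F(x,1), and C_F is the number of proper critical points of f. -/

import Mathlib

open Polynomial

/-- The function `z(n)` from the paper. -/
def z (n : ℕ) : ℕ :=
  if n = 6 then 15
  else if n = 7 then 12
  else if n = 8 then 11
  else if n = 9 then 9
  else if n ≤ 11 then 8
  else if n ≤ 16 then 7
  else if n ≤ 38 then 6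
  else if n ≤ 218 then 5
  else 4

/-- The function `ℓ(n)` from the paper. -/
def ell (n : ℕ) : ℕ := if n ≤ 7 then 4 else if n = 8 then 3 else 2

/-- A real number `τ` is a proper critical point of a real polynomial `g` if it is a
critical point of `g` and there is a neighborhood `U` of `τ` with `g''(x)·g(x) > 0`
for all `x ∈ U \ {τ}`. -/
def IsProperCriticalPoint (g : Polynomial ℝ) (τ : ℝ) : Prop :=
  (Polynomial.derivative g).eval τ = 0 ∧
    ∃ U ∈ nhds τ, ∀ x ∈ U, x ≠ τ →
      0 < (Polynomial.derivative (Polynomial.derivative g)).eval x * g.eval x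

theorem taylor_coeff_eq_sum_range {R : Type*} [CommRing R] (r : R) (f : R[X]) (N j : ℕ)
    (hN : f.natDegree < N) :
    (taylor r f).coeff j
      = ∑ i ∈ Finset.range N, f.coeff i * ((i.choose j : ℕ) : R) * r ^ (i - j) := by
  rw [taylor_coeff, hasseDeriv_apply, sum_over_range' _ _ N hN, eval_finsetSum]
  · refine Finset.sum_congr rfl fun i _ => ?_
    rw [eval_monomial]
    ring
  · intro i
    simp

theorem X_sub_C_pow_dvd_iff_taylor_coeff {R : Type*} [CommRing R] (r : R) (f : R[X]) (m : ℕ) :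
    (X - C r) ^ m ∣ f ↔ ∀ j < m, (taylor r f).coeff j = 0 := by
  rw [← X_pow_dvd_iff, ← map_dvd_iff (taylorEquiv r)]
  have h1 : (taylorEquiv r) ((X - C r) ^ m) = X ^ m := by
    rw [map_pow]
    congr 1
    simp [taylorEquiv]
  rw [h1]
  rfl

/-- Reduction of powers of a root of a trinomial to small powers with controlled integer
coefficients. -/
theorem exists_reduced_power (a b c : ℤ) (n k : ℕ) (hk0 : 0 < k) (hkn : k < n) (H α : ℝ)
    (hH : 1 ≤ H) (ha : |(a : ℝ)| ≤ H) (hb : |(b : ℝ)| ≤ H) (hc : |(c : ℝ)| ≤ H)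
    (hα : a * α ^ n + b * α ^ k + c = 0) (i : ℕ) :
    ∃ R : ℕ → ℤ, (a : ℝ) ^ i * α ^ i = ∑ l ∈ Finset.range n, (R l : ℝ) * α ^ l ∧
      ∀ l, |(R l : ℝ)| ≤ (2 * H) ^ i := by
  induction i with
  | zero =>
    refine ⟨fun l => if l = 0 then 1 else 0, ?_, ?_⟩
    · have : 0 < n := by omega
      simp [this]
    · intro l
      by_cases h : l = 0 <;> simp [h]
  | succ i ih =>
    obtain ⟨R, hR, hRb⟩ := ih
    obtain ⟨n, rfl⟩ : ∃ n', n = n' + 1 := ⟨n - 1, by omega⟩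
    refine ⟨fun l => (if l = 0 then 0 else a * R (l - 1)) - (if l = k then R n * b else 0)
      - (if l = 0 then R n * c else 0), ?_, ?_⟩
    · have e1 : (a : ℝ) ^ (i + 1) * α ^ (i + 1) = a * α * (a ^ i * α ^ i) := by ring
      rw [e1, hR]
      push_cast
      simp only [sub_mul, Finset.sum_sub_distrib, ite_mul, zero_mul]
      rw [Finset.sum_ite_eq', Finset.sum_ite_eq', if_pos (Finset.mem_range.2 hkn),
        if_pos (Finset.mem_range.2 (Nat.succ_pos n))]
      have e0 : (∑ x ∈ Finset.range (n + 1), if x = 0 then 0 else (a : ℝ) * R (x - 1) * α ^ x)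
          = ∑ x ∈ Finset.range n, (a : ℝ) * R x * α ^ (x + 1) := by
        rw [Finset.sum_range_succ']
        simp
      rw [e0, Finset.sum_range_succ, mul_add, Finset.mul_sum]
      have e2 : ∀ l ∈ Finset.range n, (a : ℝ) * α * (R l * α ^ l) = a * R l * α ^ (l + 1) :=
        fun l _ => by ring
      rw [Finset.sum_congr rfl e2]
      have e3 : (a : ℝ) * α * (R n * α ^ n) = - (R n * b * α ^ k) - R n * c := by
        have : (a : ℝ) * α ^ (n + 1) = - b * α ^ k - c := by linarith
        calc (a : ℝ) * α * (R n * α ^ n) = R n * (a * α ^ (n + 1)) := by ring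
          _ = _ := by rw [this]; ring
      rw [e3]
      ring
    · intro l
      have hP : (0 : ℝ) ≤ (2 * H) ^ i := by positivity
      have key : ∀ (d : ℤ) (j : ℕ), |(d : ℝ)| ≤ H → |((R j * d : ℤ) : ℝ)| ≤ (2 * H) ^ i * H := by
        intro d j hd
        push_cast
        rw [abs_mul]
        exact mul_le_mul (hRb j) hd (abs_nonneg _) hP
      have e4 : (2 * H) ^ (i + 1) = (2 * H) ^ i * H + (2 * H) ^ i * H := by ring
      have hPH : 0 ≤ (2 * H) ^ i * H := by positivity
      rw [e4]
      by_cases h0 : l = 0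
      · have hk : l ≠ k := by omega
        have := key c n hc
        simp only [h0, if_true]
        rw [if_neg (by omega)]
        push_cast at this ⊢
        simp only [zero_sub, abs_neg]
        linarith
      · by_cases hlk : l = k
        · have h1 := key b n hb
          have h2 := key a (l - 1) ha
          simp only [hlk, if_true] at h2 ⊢
          rw [if_neg (by omega), if_neg (by omega)]
          push_cast at h1 h2 ⊢
          rw [sub_zero]
          refine (abs_sub _ _).trans ?_
          rw [mul_comm (a : ℝ)]
          linarith
        · have h2 := key a (l - 1) ha
          simp only [h0, if_false, hlk]
          push_cast at h2 ⊢
          rw [sub_zero, sub_zero, mul_comm (a : ℝ)]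
          linarith

attribute [local instance] Matrix.seminormedAddCommGroup in
/-- Siegel's lemma with a bound with exponent `e`. -/
theorem exists_int_vec_of_entry_bound {ι κ : Type*} [Fintype ι] [Fintype κ]
    (A : Matrix ι κ ℤ) (B : ℝ) (e : ℕ) (hB : 1 ≤ B) (hA : ∀ i j, |(A i j : ℝ)| ≤ B)
    (hm : 0 < Fintype.card ι) (hn : Fintype.card ι < Fintype.card κ)
    (he : Fintype.card ι ≤ e * (Fintype.card κ - Fintype.card ι)) :
    ∃ t : κ → ℤ, t ≠ 0 ∧ A.mulVec t = 0 ∧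
      ∀ j, |(t j : ℝ)| ≤ (Fintype.card κ * B) ^ e := by
  obtain ⟨t, ht0, ht, htn⟩ := Int.Matrix.exists_ne_zero_int_vec_norm_le A hn hm
  refine ⟨t, ht0, ht, fun j => ?_⟩
  have h1 : ‖t j‖ ≤ ‖t‖ := norm_le_pi_norm t j
  rw [Int.norm_eq_abs] at h1
  have hmax : max 1 ‖A‖ ≤ B := by
    refine max_le hB ?_
    rw [Matrix.norm_le_iff (by linarith)]
    intro i j
    rw [Int.norm_eq_abs]
    exact hA i j
  have hκ : (1 : ℝ) ≤ Fintype.card κ := by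
    exact_mod_cast (by omega : 1 ≤ Fintype.card κ)
  have hbase : (1 : ℝ) ≤ Fintype.card κ * max 1 ‖A‖ :=
    one_le_mul_of_one_le_of_one_le hκ (le_max_left _ _)
  have hexp : ((Fintype.card ι : ℝ) / (Fintype.card κ - Fintype.card ι)) ≤ e := by
    have : (Fintype.card ι : ℝ) < Fintype.card κ := by exact_mod_cast hn
    rw [div_le_iff₀ (by linarith)]
    have h2 : ((Fintype.card ι : ℕ) : ℝ) ≤ ((e * (Fintype.card κ - Fintype.card ι) : ℕ) : ℝ) := by
      exact_mod_cast he
    rw [Nat.cast_mul, Nat.cast_sub hn.le] at h2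
    exact h2
  calc |(t j : ℝ)| ≤ ‖t‖ := h1
    _ ≤ _ := htn
    _ ≤ (Fintype.card κ * max 1 ‖A‖) ^ (e : ℝ) := Real.rpow_le_rpow_of_exponent_le hbase hexp
    _ = (Fintype.card κ * max 1 ‖A‖) ^ e := Real.rpow_natCast _ _
    _ ≤ _ := by gcongr

theorem exists_auxiliary_polynomials (a b c : ℤ) (n k : ℕ) (hk0 : 0 < k) (hkn : k < n) (H α : ℝ)
    (hH : 1 ≤ H) (ha0 : a ≠ 0)
    (ha : |(a : ℝ)| ≤ H) (hb : |(b : ℝ)| ≤ H) (hc : |(c : ℝ)| ≤ H)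
    (hα : a * α ^ n + b * α ^ k + c = 0) (N m : ℕ) (hm : 0 < m) (h2N : n * m < 2 * N)
    (h6 : n * m ≤ 6 * (2 * N - n * m)) :
    ∃ P Q : ℤ[X], (P ≠ 0 ∨ Q ≠ 0) ∧ P.natDegree < N ∧ Q.natDegree < N ∧
      (∀ i, |(P.coeff i : ℝ)| ≤ (8 * H) ^ (6 * N)) ∧
      (∀ i, |(Q.coeff i : ℝ)| ≤ (8 * H) ^ (6 * N)) ∧
      ∀ j < m, (taylor α (P.map (Int.castRingHom ℝ))).coeff j
        = α * (taylor α (Q.map (Int.castRingHom ℝ))).coeff j := by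
  choose R hR hRb using fun i =>
    exists_reduced_power a b c n k hk0 hkn H α hH ha hb hc hα i
  have hN : 0 < N := by omega
  let S : ℕ → ℕ → ℤ := fun i l => a ^ (N - i) * R i l
  have hS : ∀ i ≤ N, (a : ℝ) ^ N * α ^ i = ∑ l ∈ Finset.range n, (S i l : ℝ) * α ^ l := by
    intro i hi
    have : (a : ℝ) ^ N * α ^ i = a ^ (N - i) * (a ^ i * α ^ i) := by
      rw [← mul_assoc, ← pow_add, Nat.sub_add_cancel hi]
    rw [this, hR, Finset.mul_sum]
    refine Finset.sum_congr rfl fun l _ => ?_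
    simp only [S]
    push_cast
    ring
  have hSb : ∀ i ≤ N, ∀ l, |(S i l : ℝ)| ≤ (2 * H) ^ N := by
    intro i hi l
    simp only [S]
    push_cast
    rw [abs_mul, abs_pow]
    calc |(a : ℝ)| ^ (N - i) * |(R i l : ℝ)| ≤ (2 * H) ^ (N - i) * (2 * H) ^ i := by
          refine mul_le_mul (pow_le_pow_left₀ (abs_nonneg _) (by linarith) _) (hRb i l)
            (abs_nonneg _) (by positivity)
      _ = (2 * H) ^ N := by rw [← pow_add, Nat.sub_add_cancel hi]
  let A : Matrix (Fin m × Fin n) (Fin N ⊕ Fin N) ℤ := fun jl => Sum.elim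
    (fun i => ((i : ℕ).choose jl.1 : ℤ) * S (i - jl.1) jl.2)
    (fun i => -(((i : ℕ).choose jl.1 : ℤ) * S (i - jl.1 + 1) jl.2))
  have hentry : ∀ (i j e l : ℕ), i < N → e ≤ N →
      |(((i.choose j : ℤ) * S e l : ℤ) : ℝ)| ≤ (4 * H) ^ N := by
    intro i j e l hi he
    push_cast
    rw [abs_mul, Nat.abs_cast]
    have h1 : ((i.choose j : ℕ) : ℝ) ≤ 2 ^ N := by
      have : i.choose j ≤ 2 ^ N :=
        (Nat.choose_le_two_pow i j).trans (Nat.pow_le_pow_right (by norm_num) hi.le)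
      exact_mod_cast this
    calc ((i.choose j : ℕ) : ℝ) * |(S e l : ℝ)| ≤ 2 ^ N * (2 * H) ^ N :=
          mul_le_mul h1 (hSb e he l) (abs_nonneg _) (by positivity)
      _ = (4 * H) ^ N := by rw [← mul_pow]; ring
  obtain ⟨t, ht0, ht, htb⟩ := exists_int_vec_of_entry_bound A ((4 * H) ^ N) 6
    (one_le_pow₀ (by linarith)) (by
      rintro ⟨j, l⟩ (i | i)
      · exact hentry i j _ l i.2 (by have := i.2; omega)
      · have := hentry i j (i - j + 1) l i.2 (by have := i.2; omega)
        simp only [A, Sum.elim_inr]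
        rw [Int.cast_neg, abs_neg]
        exact this)
    (by
      have : 0 < n := by omega
      simp only [Fintype.card_prod, Fintype.card_fin]
      positivity)
    (by
      simp only [Fintype.card_prod, Fintype.card_fin, Fintype.card_sum]
      nlinarith)
    (by
      simp only [Fintype.card_prod, Fintype.card_fin, Fintype.card_sum]
      rw [mul_comm m n, ← two_mul]
      exact h6)
  have hbound : ∀ x, |(t x : ℝ)| ≤ (8 * H) ^ (6 * N) := by
    intro x
    refine (htb x).trans ?_
    rw [mul_comm 6 N, pow_mul]
    refine pow_le_pow_left₀ (by positivity) ?_ 6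
    have : ((Fintype.card (Fin N ⊕ Fin N) : ℕ) : ℝ) ≤ 2 ^ N := by
      have h1 : N + N ≤ 2 ^ N := by
        have := Nat.lt_two_pow_self (n := N - 1)
        have h2 : 2 ^ N = 2 * 2 ^ (N - 1) := by
          rw [← pow_succ']
          congr 1
          omega
        omega
      simp only [Fintype.card_fin, Fintype.card_sum]
      exact_mod_cast h1
    calc _ ≤ (2 : ℝ) ^ N * (4 * H) ^ N := by gcongr
      _ = (8 * H) ^ N := by rw [← mul_pow]; ring
  let P : ℤ[X] := ∑ i : Fin N, monomial (i : ℕ) (t (Sum.inl i))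
  let Q : ℤ[X] := ∑ i : Fin N, monomial (i : ℕ) (t (Sum.inr i))
  have hco : ∀ (u : Fin N → ℤ) (i : ℕ), (∑ i : Fin N, monomial (i : ℕ) (u i)).coeff i
      = if h : i < N then u ⟨i, h⟩ else 0 := by
    intro u i
    rw [finsetSum_coeff]
    simp only [coeff_monomial]
    split_ifs with h
    · rw [Finset.sum_eq_single ⟨i, h⟩]
      · simp
      · intro j _ hj
        rw [if_neg]
        intro h'
        exact hj (Fin.ext h')
      · simp
    · refine Finset.sum_eq_zero fun j _ => if_neg ?_
      have := j.2
      omega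
  have hdeg : ∀ (u : Fin N → ℤ), (∑ i : Fin N, monomial (i : ℕ) (u i)).natDegree < N := by
    intro u
    rw [Nat.lt_iff_le_pred hN]
    refine natDegree_sum_le_of_forall_le _ _ fun i _ => ?_
    refine (natDegree_monomial_le _).trans ?_
    have := i.2
    omega
  have hbd : ∀ (u : Fin N → ℤ), (∀ i, |(u i : ℝ)| ≤ (8 * H) ^ (6 * N)) →
      ∀ i, |(((∑ i : Fin N, monomial (i : ℕ) (u i)).coeff i : ℤ) : ℝ)| ≤ (8 * H) ^ (6 * N) := by
    intro u hu i
    rw [hco]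
    split_ifs
    · exact hu _
    · simp only [Int.cast_zero, abs_zero]
      positivity
  refine ⟨P, Q, ?_, hdeg _, hdeg _, hbd _ fun i => hbound _, hbd _ fun i => hbound _, ?_⟩
  · by_contra hcon
    push Not at hcon
    apply ht0
    funext x
    rcases x with i | i
    · have := congrArg (fun p => p.coeff (i : ℕ)) hcon.1
      simp only [P, hco, coeff_zero] at this
      simpa using this
    · have := congrArg (fun p => p.coeff (i : ℕ)) hcon.2
      simp only [Q, hco, coeff_zero] at this
      simpa using this
  · intro j hj
    have haN : (a : ℝ) ^ N ≠ 0 := pow_ne_zero _ (by exact_mod_cast ha0)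
    have hT : ∀ (u : Fin N → ℤ),
        (taylor α ((∑ i : Fin N, monomial (i : ℕ) (u i)).map (Int.castRingHom ℝ))).coeff j
          = ∑ i : Fin N, (u i : ℝ) * ((i : ℕ).choose j : ℕ) * α ^ ((i : ℕ) - j) := by
      intro u
      rw [taylor_coeff_eq_sum_range α _ N j (lt_of_le_of_lt (natDegree_map_le) (hdeg u)),
        Finset.sum_range]
      refine Finset.sum_congr rfl fun i _ => ?_
      rw [coeff_map, hco]
      simp
    simp only [P, Q, hT]
    have hrow : ∀ l : Fin n, ∑ i : Fin N, (((i : ℕ).choose j : ℤ) * S (i - j) l) * t (Sum.inl i)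
        = ∑ i : Fin N, (((i : ℕ).choose j : ℤ) * S (i - j + 1) l) * t (Sum.inr i) := by
      intro l
      have := congrFun ht (⟨j, hj⟩, l)
      simp only [Matrix.mulVec, dotProduct, Fintype.sum_sum_type, A, Sum.elim_inl, Sum.elim_inr,
        Pi.zero_apply, neg_mul, Finset.sum_neg_distrib] at this
      linarith
    have hrowR : ∀ l : Fin n,
        ∑ i : Fin N, (((i : ℕ).choose j : ℝ) * S (i - j) l) * t (Sum.inl i)
          = ∑ i : Fin N, (((i : ℕ).choose j : ℝ) * S (i - j + 1) l) * t (Sum.inr i) := by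
      intro l
      exact_mod_cast hrow l
    have expand : ∀ (u : Fin N → ℤ) (e : ℕ → ℕ), (∀ i < N, e i ≤ N) →
        (a : ℝ) ^ N * ∑ i : Fin N, (u i : ℝ) * ((i : ℕ).choose j : ℕ) * α ^ (e i)
          = ∑ l : Fin n, (∑ i : Fin N, (((i : ℕ).choose j : ℝ) * S (e i) l) * u i)
              * α ^ (l : ℕ) := by
      intro u e he
      simp only [Finset.mul_sum, Finset.sum_mul]
      rw [Finset.sum_comm]
      refine Finset.sum_congr rfl fun i _ => ?_
      have h1 : (a : ℝ) ^ N * ((u i : ℝ) * ((i : ℕ).choose j : ℕ) * α ^ (e i))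
          = (u i : ℝ) * ((i : ℕ).choose j : ℕ) * (a ^ N * α ^ (e i)) := by ring
      rw [h1, hS _ (he i i.2), Finset.mul_sum, Finset.sum_range]
      refine Finset.sum_congr rfl fun l _ => ?_
      ring
    apply mul_left_cancel₀ haN
    rw [expand (fun i => t (Sum.inl i)) (fun i => i - j) (fun i hi => by omega),
      Finset.mul_sum]
    have h2 : ∀ i ∈ (Finset.univ : Finset (Fin N)),
        α * ((t (Sum.inr i) : ℝ) * ((i : ℕ).choose j : ℕ) * α ^ ((i : ℕ) - j))
          = (t (Sum.inr i) : ℝ) * ((i : ℕ).choose j : ℕ) * α ^ ((i : ℕ) - j + 1) := by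
      intro i _
      ring
    rw [Finset.sum_congr rfl h2,
      expand (fun i => t (Sum.inr i)) (fun i => i - j + 1) (fun i hi => by omega)]
    refine Finset.sum_congr rfl fun l _ => ?_
    rw [hrowR l]

theorem pow_dvd_of_X_sub_C_pow_dvd_map (f : ℚ[X]) (hf : Irreducible f) (α : ℝ)
    (hα : (f.map (algebraMap ℚ ℝ)).eval α = 0) (m : ℕ) (g : ℚ[X]) (hg0 : g ≠ 0)
    (hg : (X - C α) ^ m ∣ g.map (algebraMap ℚ ℝ)) : f ^ m ∣ g := by
  induction m generalizing g with
  | zero => simp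
  | succ m ih =>
    have hroot : (g.map (algebraMap ℚ ℝ)).eval α = 0 := by
      obtain ⟨u, hu⟩ := hg
      rw [hu]
      simp
    have hfg : f ∣ g := by
      by_contra hnd
      have hcop : IsCoprime f g := (EuclideanDomain.dvd_or_coprime f g hf).resolve_left hnd
      obtain ⟨u, v, huv⟩ := hcop
      have := congrArg (fun p => (p.map (algebraMap ℚ ℝ)).eval α) huv
      simp [hα, hroot] at this
    obtain ⟨h, rfl⟩ := hfg
    have hh0 : h ≠ 0 := right_ne_zero_of_mul hg0
    have hfs : (f.map (algebraMap ℚ ℝ)).Separable := hf.separable.map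
    have hmul : f.map (algebraMap ℚ ℝ) * h.map (algebraMap ℚ ℝ) ≠ 0 := by
      rw [← Polynomial.map_mul]
      exact (Polynomial.map_ne_zero_iff (algebraMap ℚ ℝ).injective).2 hg0
    have h1 := rootMultiplicity_le_one_of_separable hfs α
    rw [Polynomial.map_mul, ← le_rootMultiplicity_iff hmul, rootMultiplicity_mul hmul] at hg
    have h2 : (X - C α) ^ m ∣ h.map (algebraMap ℚ ℝ) := by
      rw [← le_rootMultiplicity_iff (right_ne_zero_of_mul hmul)]
      omega
    rw [pow_succ']
    exact mul_dvd_mul_left f (ih h hh0 h2)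

theorem wronskian_ne_zero_of_high_order (f : ℚ[X]) (hf : Irreducible f) (α : ℝ)
    (hα : (f.map (algebraMap ℚ ℝ)).eval α = 0) (hirr : ∀ r : ℚ, (r : ℝ) ≠ α)
    (N m : ℕ) (hN : N ≤ m * f.natDegree) (P Q : ℤ[X]) (h0 : P ≠ 0 ∨ Q ≠ 0)
    (hP : P.natDegree < N) (hQ : Q.natDegree < N)
    (hPQ : ∀ j < m, (taylor α (P.map (Int.castRingHom ℝ))).coeff j
        = α * (taylor α (Q.map (Int.castRingHom ℝ))).coeff j) :
    wronskian P Q ≠ 0 := by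
  classical
  intro hW
  have hinj : Function.Injective (Int.castRingHom ℚ) := Int.cast_injective
  set p := P.map (Int.castRingHom ℚ) with hp
  set q := Q.map (Int.castRingHom ℚ) with hq
  have hpq0 : ¬ (p = 0 ∧ q = 0) := by
    rintro ⟨h1, h2⟩
    rcases h0 with h | h
    · exact h ((Polynomial.map_eq_zero_iff hinj).1 h1)
    · exact h ((Polynomial.map_eq_zero_iff hinj).1 h2)
  have hWq : wronskian p q = 0 := by
    have := congrArg (Polynomial.map (Int.castRingHom ℚ)) hW
    simpa [wronskian, Polynomial.map_sub, Polynomial.map_mul, ← derivative_map, hp, hq] using this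
  set g := EuclideanDomain.gcd p q with hg
  have hg0 : g ≠ 0 := by
    intro h
    exact hpq0 (EuclideanDomain.gcd_eq_zero_iff.1 h)
  have hgp : g ∣ p := EuclideanDomain.gcd_dvd_left p q
  have hgq : g ∣ q := EuclideanDomain.gcd_dvd_right p q
  clear_value g
  obtain ⟨p1, hp1⟩ := id hgp
  obtain ⟨q1, hq1⟩ := id hgq
  have hcop : IsCoprime p1 q1 := by
    have := EuclideanDomain.gcd_eq_gcd_ab p q
    refine ⟨EuclideanDomain.gcdA p q, EuclideanDomain.gcdB p q, ?_⟩
    apply mul_left_cancel₀ hg0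
    rw [mul_one]
    conv_rhs => rw [hg, this, hp1, hq1]
    rw [← hp1, ← hq1]
    conv_lhs => rw [mul_add]
    rw [mul_comm _ p1, mul_comm _ q1, ← mul_assoc, ← mul_assoc, ← hp1, ← hq1]
  have hw1 : wronskian p1 q1 = 0 := by
    have : wronskian p q = g ^ 2 * wronskian p1 q1 := by
      conv_lhs => rw [hp1, hq1]
      simp only [wronskian, derivative_mul]
      ring
    rw [this] at hWq
    exact (mul_eq_zero.1 hWq).resolve_left (pow_ne_zero _ hg0)
  obtain ⟨hd1, hd2⟩ := hcop.wronskian_eq_zero_iff.1 hw1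
  obtain ⟨s, hs⟩ : ∃ s, p1 = C s := ⟨_, eq_C_of_derivative_eq_zero hd1⟩
  obtain ⟨r, hr⟩ : ∃ r, q1 = C r := ⟨_, eq_C_of_derivative_eq_zero hd2⟩
  have hcast : ∀ R : ℤ[X], R.map (Int.castRingHom ℝ)
      = (R.map (Int.castRingHom ℚ)).map (algebraMap ℚ ℝ) := by
    intro R
    rw [Polynomial.map_map]
    congr 1
  have hsr : (s : ℝ) - α * r ≠ 0 := by
    intro h
    by_cases hr0 : r = 0
    · have hs0 : s = 0 := by
        rw [hr0] at h
        simpa using h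
      apply hpq0
      rw [hp1, hq1, hs, hr, hs0, hr0]
      simp
    · apply hirr (s / r)
      have : (r : ℝ) ≠ 0 := by exact_mod_cast hr0
      push_cast
      field_simp
      linarith
  have hdvd : (X - C α) ^ m ∣ g.map (algebraMap ℚ ℝ) := by
    rw [X_sub_C_pow_dvd_iff_taylor_coeff]
    intro j hj
    have := hPQ j hj
    rw [hcast, hcast, ← hp, ← hq, hp1, hq1, hs, hr] at this
    simp only [Polynomial.map_mul, Polynomial.map_C, taylor_mul, taylor_C, coeff_mul_C,
      eq_ratCast] at this
    have h3 : ((taylor α) (map (algebraMap ℚ ℝ) g)).coeff j * ((s : ℝ) - α * r) = 0 := by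
      linarith
    exact (mul_eq_zero.1 h3).resolve_right hsr
  have hfm := pow_dvd_of_X_sub_C_pow_dvd_map f hf α hα m g hg0 hdvd
  have hdegp : p.natDegree < N := lt_of_le_of_lt natDegree_map_le hP
  have hdegq : q.natDegree < N := lt_of_le_of_lt natDegree_map_le hQ
  have hle := natDegree_le_of_dvd hfm hg0
  rw [natDegree_pow] at hle
  by_cases hp0 : p = 0
  · have hq0 : q ≠ 0 := fun h => hpq0 ⟨hp0, h⟩
    have : g.natDegree ≤ q.natDegree := natDegree_le_of_dvd hgq hq0
    omega
  · have := natDegree_le_of_dvd hgp hp0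
    omega

theorem abs_coeff_mul_derivative_le (P Q : ℤ[X]) (N : ℕ) (M : ℝ) (hM : 0 ≤ M)
    (hQ : Q.natDegree < N)
    (hPb : ∀ i, |(P.coeff i : ℝ)| ≤ M) (hQb : ∀ i, |(Q.coeff i : ℝ)| ≤ M) (i : ℕ) :
    |((P * derivative Q).coeff i : ℝ)| ≤ (i + 1) * N * M ^ 2 := by
  rw [coeff_mul]
  push_cast
  refine (Finset.abs_sum_le_sum_abs _ _).trans ?_
  have : ∀ x ∈ Finset.HasAntidiagonal.antidiagonal i,
      |(P.coeff x.1 : ℝ) * ((derivative Q).coeff x.2 : ℝ)| ≤ N * M ^ 2 := by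
    intro x _
    rw [coeff_derivative, abs_mul]
    push_cast
    rw [abs_mul]
    by_cases hx : x.2 + 1 < N
    · have h1 : |((x.2 : ℝ) + 1)| ≤ N := by
        rw [abs_of_nonneg (by positivity)]
        exact_mod_cast hx.le
      calc |(P.coeff x.1 : ℝ)| * (|(Q.coeff (x.2 + 1) : ℝ)| * |((x.2 : ℝ) + 1)|) ≤ M * (M * N) := by
            gcongr
            · exact hPb _
            · exact hQb _
        _ = N * M ^ 2 := by ring
    · rw [coeff_eq_zero_of_natDegree_lt (by omega : Q.natDegree < x.2 + 1)]
      simp only [Int.cast_zero, abs_zero, zero_mul, mul_zero]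
      positivity
  refine (Finset.sum_le_sum this).trans ?_
  rw [Finset.sum_const, Finset.Nat.card_antidiagonal, nsmul_eq_mul]
  push_cast
  linarith

/-- A rational root of high multiplicity of a nonzero integer Wronskian has small denominator. -/
theorem pow_le_of_pow_dvd_wronskian (P Q : ℤ[X]) (N : ℕ) (M : ℝ) (hM : 0 ≤ M)
    (hP : P.natDegree < N) (hQ : Q.natDegree < N)
    (hPb : ∀ i, |(P.coeff i : ℝ)| ≤ M) (hQb : ∀ i, |(Q.coeff i : ℝ)| ≤ M)
    (hW : wronskian P Q ≠ 0) (p q : ℤ) (hq : 0 < q) (hpq : IsCoprime p q) (t : ℕ)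
    (hdvd : (X - C ((p : ℚ) / q)) ^ t ∣ (wronskian P Q).map (Int.castRingHom ℚ)) :
    (q : ℝ) ^ t ≤ 4 * N ^ 2 * M ^ 2 := by
  have hprim : (C q * X - C p : ℤ[X]).IsPrimitive := by
    rw [isPrimitive_iff_isUnit_of_C_dvd]
    intro r hr
    rw [C_dvd_iff_dvd_coeff] at hr
    have h0 := hr 0
    have h1 := hr 1
    simp only [coeff_sub, coeff_C_mul, coeff_X_zero, mul_zero, coeff_C_zero, zero_sub, dvd_neg,
      coeff_X_one, mul_one, coeff_C_succ, sub_zero] at h0 h1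
    exact hpq.isUnit_of_dvd' h0 h1
  have hprimt : ((C q * X - C p : ℤ[X]) ^ t).IsPrimitive := (by
    clear hdvd
    induction t with
    | zero => simp [isPrimitive_one]
    | succ t ih => 
      rw [pow_succ]
      exact ih.mul hprim)
  have hqQ : (q : ℚ) ≠ 0 := by exact_mod_cast hq.ne'
  have hd : (C q * X - C p : ℤ[X]) ^ t ∣ wronskian P Q := by
    rw [IsPrimitive.Int.dvd_iff_map_cast_dvd_map_cast _ _ hprimt]
    have : ((C q * X - C p : ℤ[X]) ^ t).map (Int.castRingHom ℚ)
        = C ((q : ℚ) ^ t) * (X - C ((p : ℚ) / q)) ^ t := by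
      rw [Polynomial.map_pow, C_pow, ← mul_pow]
      congr 1
      rw [Polynomial.map_sub, Polynomial.map_mul, Polynomial.map_C, Polynomial.map_X,
        Polynomial.map_C, mul_sub, ← C_mul, eq_intCast, eq_intCast]
      rw [mul_div_cancel₀ _ hqQ]
    rw [this]
    exact ((isUnit_C.2 (isUnit_iff_ne_zero.2 (pow_ne_zero _ hqQ))).mul_left_dvd).2 hdvd
  have hlead : q ^ t ∣ (wronskian P Q).leadingCoeff := by
    obtain ⟨u, hu⟩ := hd
    rw [hu, leadingCoeff_mul, leadingCoeff_pow]
    have : (C q * X - C p : ℤ[X]).leadingCoeff = q := by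
      have := leadingCoeff_linear (b := -p) hq.ne'
      rw [C_neg] at this
      rw [sub_eq_add_neg, this]
    rw [this]
    exact dvd_mul_right _ _
  have hle : q ^ t ≤ |(wronskian P Q).leadingCoeff| :=
    Int.le_of_dvd (abs_pos.2 (leadingCoeff_ne_zero.2 hW)) ((dvd_abs _ _).2 hlead)
  have hleR : (q : ℝ) ^ t ≤ |((wronskian P Q).leadingCoeff : ℝ)| := by exact_mod_cast hle
  refine hleR.trans ?_
  set i := (wronskian P Q).natDegree with hi
  have hi2 : i + 1 ≤ 2 * N := by
    have := natDegree_wronskian_lt_add hW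
    omega
  have e : (wronskian P Q).leadingCoeff
      = (P * derivative Q).coeff i - (Q * derivative P).coeff i := by
    rw [leadingCoeff, ← hi, wronskian, coeff_sub, mul_comm (derivative P)]
  rw [e]
  push_cast
  refine (abs_sub _ _).trans ?_
  have h1 := abs_coeff_mul_derivative_le P Q N M hM hQ hPb hQb i
  have h2 := abs_coeff_mul_derivative_le Q P N M hM hP hQb hPb i
  have h3 : ((i : ℝ) + 1) ≤ 2 * N := by exact_mod_cast hi2
  have h4 : ((i : ℝ) + 1) * N * M ^ 2 ≤ 2 * N * N * M ^ 2 := by gcongr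
  linarith

theorem abs_taylor_coeff_le (f : ℝ[X]) (N : ℕ) (M x ρ : ℝ) (hM : 0 ≤ M) (hf : f.natDegree < N)
    (hb : ∀ i, |f.coeff i| ≤ M) (hρ : 1 ≤ ρ) (hx : |x| ≤ ρ) (j : ℕ) :
    |(taylor x f).coeff j| ≤ N * (2 * ρ) ^ N * M := by
  rw [taylor_coeff_eq_sum_range x f N j hf]
  refine (Finset.abs_sum_le_sum_abs _ _).trans ?_
  have : ∀ i ∈ Finset.range N, |f.coeff i * ((i.choose j : ℕ) : ℝ) * x ^ (i - j)|
      ≤ (2 * ρ) ^ N * M := by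
    intro i hi
    rw [Finset.mem_range] at hi
    rw [abs_mul, abs_mul, Nat.abs_cast, abs_pow]
    have h1 : ((i.choose j : ℕ) : ℝ) ≤ 2 ^ N := by
      have : i.choose j ≤ 2 ^ N :=
        (Nat.choose_le_two_pow i j).trans (Nat.pow_le_pow_right (by norm_num) hi.le)
      exact_mod_cast this
    have h2 : |x| ^ (i - j) ≤ ρ ^ N :=
      (pow_le_pow_left₀ (abs_nonneg _) hx _).trans (pow_le_pow_right₀ hρ (by omega))
    calc _ ≤ M * 2 ^ N * ρ ^ N := by
          gcongr
          exact hb i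
      _ = _ := by rw [mul_pow]; ring
  refine (Finset.sum_le_sum this).trans ?_
  rw [Finset.sum_const, Finset.card_range, nsmul_eq_mul]
  linarith

theorem abs_taylor_coeff_le_of_high_order (f : ℝ[X]) (N m j : ℕ) (M α β ε : ℝ)
    (hM : 0 ≤ M) (hf : f.natDegree < N) (hb : ∀ i, |(taylor α f).coeff i| ≤ M)
    (hm : ∀ i < m, (taylor α f).coeff i = 0) (hε : |β - α| ≤ ε) (hε1 : ε ≤ 1) :
    |(taylor β f).coeff j| ≤ N * 2 ^ N * M * ε ^ (m - j) := by
  have hε0 : 0 ≤ ε := (abs_nonneg _).trans hε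
  have e : taylor β f = taylor (β - α) (taylor α f) := by
    rw [taylor_taylor, sub_add_cancel]
  rw [e, taylor_coeff_eq_sum_range (β - α) (taylor α f) N j (by rwa [natDegree_taylor])]
  refine (Finset.abs_sum_le_sum_abs _ _).trans ?_
  have : ∀ i ∈ Finset.range N,
      |(taylor α f).coeff i * ((i.choose j : ℕ) : ℝ) * (β - α) ^ (i - j)|
      ≤ 2 ^ N * M * ε ^ (m - j) := by
    intro i hi
    rw [Finset.mem_range] at hi
    by_cases him : i < m
    · rw [hm i him]
      simp only [zero_mul, abs_zero]
      positivity
    · rw [abs_mul, abs_mul, Nat.abs_cast, abs_pow]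
      have h1 : ((i.choose j : ℕ) : ℝ) ≤ 2 ^ N := by
        have : i.choose j ≤ 2 ^ N :=
          (Nat.choose_le_two_pow i j).trans (Nat.pow_le_pow_right (by norm_num) hi.le)
        exact_mod_cast this
      have h2 : |β - α| ^ (i - j) ≤ ε ^ (m - j) :=
        (pow_le_pow_left₀ (abs_nonneg _) hε _).trans
          (pow_le_pow_of_le_one hε0 hε1 (by omega))
      calc _ ≤ M * 2 ^ N * ε ^ (m - j) := by
            gcongr
            exact hb i
        _ = _ := by ring
  refine (Finset.sum_le_sum this).trans ?_
  rw [Finset.sum_const, Finset.card_range, nsmul_eq_mul]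
  linarith

theorem natCast_le_two_pow (N : ℕ) : (N : ℝ) ≤ 2 ^ N := by
  exact_mod_cast Nat.lt_two_pow_self.le

theorem abs_taylor_coeff_combination_le (P Q : ℤ[X]) (H α : ℝ) (hH : 1 ≤ H) (hα0 : 0 < α)
    (hα1 : α ≤ 1) (N m t j : ℕ) (hN1 : 1 ≤ N) (hjt : j ≤ t)
    (hPd : P.natDegree < N) (hQd : Q.natDegree < N)
    (hPb : ∀ i, |(P.coeff i : ℝ)| ≤ (8 * H) ^ (6 * N))
    (hQb : ∀ i, |(Q.coeff i : ℝ)| ≤ (8 * H) ^ (6 * N))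
    (hPQ : ∀ j < m, (taylor α (P.map (Int.castRingHom ℝ))).coeff j
        = α * (taylor α (Q.map (Int.castRingHom ℝ))).coeff j)
    (p₂ q₂ : ℤ) (hq₂ : 0 < q₂) (β ε₁ ε₂ : ℝ)
    (h₁ : |β - α| ≤ ε₁) (hε₁ : ε₁ ≤ 1) (h₂ : |(p₂ : ℝ) / q₂ - α| ≤ ε₂) :
    |(taylor β ((C q₂ * P - C p₂ * Q).map (Int.castRingHom ℝ))).coeff j|
      ≤ q₂ * ((8 * H) ^ (8 * N) * (ε₁ ^ (m - t) + ε₂)) := by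
  have hε₁0 : 0 ≤ ε₁ := (abs_nonneg _).trans h₁
  have hq₂R : (q₂ : ℝ) ≠ 0 := by exact_mod_cast hq₂.ne'
  have hM : (0 : ℝ) ≤ (8 * H) ^ (6 * N) := by positivity
  have hPR : ((P.map (Int.castRingHom ℝ))).natDegree < N := lt_of_le_of_lt natDegree_map_le hPd
  have hQR : ((Q.map (Int.castRingHom ℝ))).natDegree < N := lt_of_le_of_lt natDegree_map_le hQd
  set G : ℝ[X] := P.map (Int.castRingHom ℝ) - C α * Q.map (Int.castRingHom ℝ) with hG
  have hGd : G.natDegree < N := by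
    refine lt_of_le_of_lt (natDegree_sub_le _ _) (max_lt hPR ?_)
    exact lt_of_le_of_lt (natDegree_C_mul_le _ _) hQR
  have hGb : ∀ i, |G.coeff i| ≤ 2 * (8 * H) ^ (6 * N) := by
    intro i
    rw [hG, coeff_sub, coeff_C_mul, coeff_map, coeff_map]
    refine (abs_sub _ _).trans ?_
    have h1 := hPb i
    have h2 := hQb i
    rw [abs_mul, abs_of_pos hα0]
    simp only [eq_intCast]
    have h3 : α * |(Q.coeff i : ℝ)| ≤ 1 * |(Q.coeff i : ℝ)| :=
      mul_le_mul_of_nonneg_right hα1 (abs_nonneg _)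
    linarith
  have hGtz : ∀ i < m, (taylor α G).coeff i = 0 := by
    intro i hi
    rw [hG, map_sub, taylor_mul, taylor_C, coeff_sub, coeff_C_mul, hPQ i hi, sub_self]
  have hGt := fun i => abs_taylor_coeff_le G N (2 * (8 * H) ^ (6 * N)) α 1 (by positivity) hGd hGb
    le_rfl (by rw [abs_of_pos hα0]; exact hα1) i
  have hGβ := abs_taylor_coeff_le_of_high_order G N m j _ α β ε₁ (by positivity) hGd hGt hGtz h₁ hε₁
  have hβ2 : |β| ≤ 2 := by
    have := abs_sub_abs_le_abs_sub β α
    rw [abs_of_pos hα0] at this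
    linarith
  have hQβ := abs_taylor_coeff_le (Q.map (Int.castRingHom ℝ)) N ((8 * H) ^ (6 * N)) β 2 hM hQR
    (by intro i; rw [coeff_map]; exact hQb i) (by norm_num) hβ2 j
  have hsplit : (taylor β ((C q₂ * P - C p₂ * Q).map (Int.castRingHom ℝ))).coeff j
      = q₂ * ((taylor β G).coeff j
        + (α - (p₂ : ℝ) / q₂) * (taylor β (Q.map (Int.castRingHom ℝ))).coeff j) := by
    simp only [hG, Polynomial.map_sub, Polynomial.map_mul, Polynomial.map_C, map_sub, taylor_mul,
      taylor_C, coeff_sub, coeff_C_mul]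
    simp only [eq_intCast]
    field_simp
    ring
  have h2pow := natCast_le_two_pow N
  have hNpos : (1 : ℝ) ≤ N := by exact_mod_cast hN1
  have hB2 : (8 * H) ^ (8 * N) = (8 * H) ^ (2 * N) * (8 * H) ^ (6 * N) := by
    rw [← pow_add]; congr 1; ring
  have h64 : (64 : ℝ) ^ N ≤ (8 * H) ^ (2 * N) := by
    rw [pow_mul]
    refine pow_le_pow_left₀ (by norm_num) ?_ N
    nlinarith
  have hg1 : |(taylor β G).coeff j| ≤ (8 * H) ^ (8 * N) * ε₁ ^ (m - t) := by
    refine hGβ.trans ?_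
    have e1 : ε₁ ^ (m - j) ≤ ε₁ ^ (m - t) := pow_le_pow_of_le_one hε₁0 hε₁ (by omega)
    have e2 : (N : ℝ) * 2 ^ N * (N * (2 * 1) ^ N * (2 * (8 * H) ^ (6 * N))) ≤ (8 * H) ^ (8 * N) := by
      rw [hB2]
      have e3 : (N : ℝ) * 2 ^ N * (N * (2 * 1) ^ N * 2) ≤ 64 ^ N := by
        have e5 : (64 : ℝ) ^ N = 2 ^ N * 2 ^ N * (2 ^ N * 2 ^ N * (2 ^ N * 2 ^ N)) := by
          simp only [← mul_pow]; norm_num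
        have e6 : (2 : ℝ) ≤ 2 ^ N * 2 ^ N := by
          have : (2 : ℝ) ^ 1 ≤ 2 ^ N := pow_le_pow_right₀ (by norm_num) hN1
          nlinarith
        rw [e5, mul_one]
        calc (N : ℝ) * 2 ^ N * (N * 2 ^ N * 2) = N * N * (2 ^ N * 2 ^ N * 2) := by ring
          _ ≤ 2 ^ N * 2 ^ N * (2 ^ N * 2 ^ N * (2 ^ N * 2 ^ N)) := by gcongr
      calc _ = (N : ℝ) * 2 ^ N * (N * (2 * 1) ^ N * 2) * (8 * H) ^ (6 * N) := by ring
        _ ≤ _ := mul_le_mul_of_nonneg_right (e3.trans h64) hM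
    exact mul_le_mul e2 e1 (by positivity) (by positivity)
  have hg2 : |(taylor β (Q.map (Int.castRingHom ℝ))).coeff j| ≤ (8 * H) ^ (8 * N) := by
    refine hQβ.trans ?_
    rw [hB2]
    refine mul_le_mul_of_nonneg_right (le_trans ?_ h64) hM
    calc (N : ℝ) * (2 * 2) ^ N ≤ 2 ^ N * (2 * 2) ^ N := by gcongr
      _ = 8 ^ N := by rw [← mul_pow]; norm_num
      _ ≤ 64 ^ N := by gcongr; norm_num
  rw [hsplit, abs_mul, abs_of_pos (by exact_mod_cast hq₂ : (0 : ℝ) < q₂)]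
  refine mul_le_mul_of_nonneg_left ?_ (by exact_mod_cast hq₂.le)
  refine (abs_add_le _ _).trans ?_
  rw [abs_mul, abs_sub_comm, mul_add]
  refine add_le_add hg1 ?_
  rw [mul_comm]
  exact mul_le_mul hg2 h₂ (abs_nonneg _) (by positivity)

/-- The fundamental inequality of the Thue–Siegel method for two rational approximations to a
root of an irreducible trinomial. -/
theorem thue_siegel_inequality (a b c : ℤ) (n k : ℕ) (hk0 : 0 < k) (hkn : k < n) (H α : ℝ)
    (hH : 1 ≤ H) (ha0 : a ≠ 0)
    (ha : |(a : ℝ)| ≤ H) (hb : |(b : ℝ)| ≤ H) (hc : |(c : ℝ)| ≤ H)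
    (hirr : Irreducible (C (a : ℚ) * X ^ n + C (b : ℚ) * X ^ k + C (c : ℚ)))
    (hα : a * α ^ n + b * α ^ k + c = 0) (hα0 : 0 < α) (hα1 : α ≤ 1)
    (N m t : ℕ) (hm : 0 < m) (h2N : n * m < 2 * N)
    (h6 : n * m ≤ 6 * (2 * N - n * m)) (hNm : N ≤ m * n)
    (p₁ q₁ p₂ q₂ : ℤ) (hq₁ : 0 < q₁) (hq₂ : 0 < q₂) (hpq : IsCoprime p₁ q₁) (ε₁ ε₂ : ℝ)
    (h₁ : |(p₁ : ℝ) / q₁ - α| ≤ ε₁) (hε₁ : ε₁ ≤ 1) (h₂ : |(p₂ : ℝ) / q₂ - α| ≤ ε₂)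
    (hqt : 4 * N ^ 2 * (8 * H) ^ (12 * N) < (q₁ : ℝ) ^ t) :
    1 ≤ (q₁ : ℝ) ^ (N - 1) * q₂ * (8 * H) ^ (8 * N) * (ε₁ ^ (m - t) + ε₂) := by
  have hε₁0 : 0 ≤ ε₁ := (abs_nonneg _).trans h₁
  set f : ℚ[X] := C (a : ℚ) * X ^ n + C (b : ℚ) * X ^ k + C (c : ℚ) with hf
  have haq : (a : ℚ) ≠ 0 := by exact_mod_cast ha0
  clear_value f
  have hdeg : f.natDegree = n := by
    rw [hf]
    have h1 : (C (b : ℚ) * X ^ k).natDegree < n := lt_of_le_of_lt (natDegree_C_mul_X_pow_le _ _) hkn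
    have h2 : (C (c : ℚ)).natDegree < n := by simp; omega
    rw [add_assoc, natDegree_add_eq_left_of_natDegree_lt, natDegree_C_mul_X_pow _ _ haq]
    rw [natDegree_C_mul_X_pow _ _ haq]
    exact lt_of_le_of_lt (natDegree_add_le _ _) (max_lt h1 h2)
  have hfα : (f.map (algebraMap ℚ ℝ)).eval α = 0 := by
    simp [hf, hα]
  have hαirr : ∀ r : ℚ, (r : ℝ) ≠ α := by
    intro r hr
    have h1 : f.eval r = 0 := by
      have h2 : ((f.eval r : ℚ) : ℝ) = 0 := by
        rw [← hfα, ← hr]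
        simp [hf]
      exact_mod_cast h2
    have := degree_eq_one_of_irreducible_of_root hirr h1
    have h3 : f.natDegree = 1 := natDegree_eq_of_degree_eq_some this
    omega
  obtain ⟨P, Q, hPQ0, hPd, hQd, hPb, hQb, hPQ⟩ := exists_auxiliary_polynomials a b c n k hk0 hkn H α
    hH ha0 ha hb hc hα N m hm h2N h6
  have hW := wronskian_ne_zero_of_high_order f hirr α hfα hαirr N m (by rwa [hdeg]) P Q hPQ0
    hPd hQd hPQ
  have hB1 : 1 ≤ 8 * H := by linarith
  have hq₂Q : (q₂ : ℚ) ≠ 0 := by exact_mod_cast hq₂.ne'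
  have hq₂R : (q₂ : ℝ) ≠ 0 := by exact_mod_cast hq₂.ne'
  have hq₁R : (q₁ : ℝ) ≠ 0 := by exact_mod_cast hq₁.ne'
  have hN1 : 1 ≤ N := by omega
  obtain ⟨R, hR⟩ : ∃ R : ℤ[X], R = C q₂ * P - C p₂ * Q := ⟨_, rfl⟩
  -- some low order coefficient of the expansion of `R` at `p₁ / q₁` is nonzero
  obtain ⟨j, hjt, hj⟩ : ∃ j ≤ t,
      (taylor ((p₁ : ℚ) / q₁) (R.map (Int.castRingHom ℚ))).coeff j ≠ 0 := by
    by_contra hcon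
    push Not at hcon
    have hd : (X - C ((p₁ : ℚ) / q₁)) ^ (t + 1) ∣ R.map (Int.castRingHom ℚ) := by
      rw [X_sub_C_pow_dvd_iff_taylor_coeff]
      intro j hj
      exact hcon j (by omega)
    have hd1 : (X - C ((p₁ : ℚ) / q₁)) ^ t ∣ R.map (Int.castRingHom ℚ) :=
      (pow_dvd_pow _ (Nat.le_succ t)).trans hd
    have hd2 : (X - C ((p₁ : ℚ) / q₁)) ^ t ∣ derivative (R.map (Int.castRingHom ℚ)) :=
      Nat.add_sub_cancel t 1 ▸ pow_sub_one_dvd_derivative_of_pow_dvd hd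
    have hRW : (X - C ((p₁ : ℚ) / q₁)) ^ t ∣ (wronskian P Q).map (Int.castRingHom ℚ) := by
      have : C (q₂ : ℚ) * (wronskian P Q).map (Int.castRingHom ℚ)
          = R.map (Int.castRingHom ℚ) * derivative (Q.map (Int.castRingHom ℚ))
            - derivative (R.map (Int.castRingHom ℚ)) * Q.map (Int.castRingHom ℚ) := by
        simp only [hR, wronskian, Polynomial.map_sub, Polynomial.map_mul, Polynomial.map_C,
          derivative_sub, derivative_mul, derivative_C, ← derivative_map]
        simp only [eq_intCast]
        ring
      have h3 : (X - C ((p₁ : ℚ) / q₁)) ^ t ∣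
          C (q₂ : ℚ) * (wronskian P Q).map (Int.castRingHom ℚ) := by
        rw [this]
        exact dvd_sub (hd1.mul_right _) (hd2.mul_right _)
      exact ((isUnit_C.2 (isUnit_iff_ne_zero.2 hq₂Q)).dvd_mul_left).1 h3
    have := pow_le_of_pow_dvd_wronskian P Q N ((8 * H) ^ (6 * N)) (by positivity) hPd hQd hPb hQb
      hW p₁ q₁ hq₁ hpq t hRW
    rw [← pow_mul, show 6 * N * 2 = 12 * N by ring] at this
    exact absurd this (not_le.2 hqt)
  set β : ℝ := (p₁ : ℝ) / q₁ with hβ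
  have hRd : R.natDegree < N := by
    rw [hR]
    refine lt_of_le_of_lt (natDegree_sub_le _ _) (max_lt ?_ ?_)
    · exact lt_of_le_of_lt (natDegree_C_mul_le _ _) hPd
    · exact lt_of_le_of_lt (natDegree_C_mul_le _ _) hQd
  have hlow : 1 ≤ (q₁ : ℝ) ^ (N - 1) * |(taylor β (R.map (Int.castRingHom ℝ))).coeff j| := by
    have hjR : (taylor β (R.map (Int.castRingHom ℝ))).coeff j ≠ 0 := by
      have : (taylor β (R.map (Int.castRingHom ℝ))).coeff j
          = ((taylor ((p₁ : ℚ) / q₁) (R.map (Int.castRingHom ℚ))).coeff j : ℚ) := by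
        rw [taylor_coeff_eq_sum_range _ _ N j (lt_of_le_of_lt natDegree_map_le hRd),
          taylor_coeff_eq_sum_range _ _ N j (lt_of_le_of_lt natDegree_map_le hRd)]
        push_cast
        refine Finset.sum_congr rfl fun i _ => ?_
        simp [hβ]
      rw [this]
      exact_mod_cast hj
    have hh : (taylor β (R.map (Int.castRingHom ℝ))).coeff j
        = eval ((p₁ : ℝ) / q₁) ((hasseDeriv j R).map (algebraMap ℤ ℝ)) := by
      rw [taylor_coeff]
      congr 1
      ext i
      simp [hasseDeriv_coeff]
    rw [hh] at hjR ⊢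
    have h1 := one_le_pow_mul_abs_eval_div hq₁ hjR
    refine h1.trans (mul_le_mul_of_nonneg_right ?_ (abs_nonneg _))
    refine pow_le_pow_right₀ (by exact_mod_cast hq₁) ?_
    have := natDegree_hasseDeriv_le R j
    omega
  calc (1 : ℝ) ≤ _ := hlow
    _ ≤ (q₁ : ℝ) ^ (N - 1) * (q₂ * ((8 * H) ^ (8 * N) * (ε₁ ^ (m - t) + ε₂))) := by
        refine mul_le_mul_of_nonneg_left ?_ ?_
        · rw [hR]
          exact abs_taylor_coeff_combination_le P Q H α hH hα0 hα1 N m t j hN1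
            hjt hPd hQd hPb hQb hPQ p₂ q₂ hq₂ β ε₁ ε₂ h₁ hε₁ h₂
        have : (0 : ℝ) < q₁ := by exact_mod_cast hq₁
        positivity
    _ = _ := by ring

theorem exponent_inequality_main (n m N t r : ℝ) (hn : 6 ≤ n) (hm : n - 1 ≤ m)
    (hN : N ≤ (7 * (n * m) + 11) / 12) (ht : t ≤ 13 * r + 1)
    (hr : r ≤ (7 * m + 2) / 3000 ∨ 39 ≤ n ∧ r ≤ (7 * m + 2) / 480) :
    N - 1 + m + 8 * r + (m - t) * (1 / 40 - n) + 1 / 100 < 0 := by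
  have h1 : (m - t) * (1 / 40 - n) ≤ (m - (13 * r + 1)) * (1 / 40 - n) :=
    mul_le_mul_of_nonpos_right (by linarith) (by linarith)
  rcases hr with hr | ⟨hn39, hr⟩
  · have h2 : r * n ≤ (7 * m + 2) / 3000 * n := by gcongr
    nlinarith [mul_nonneg (sub_nonneg.2 hn) (by linarith : 0 ≤ m - 5)]
  · have h2 : r * n ≤ (7 * m + 2) / 480 * n := by gcongr
    nlinarith [mul_nonneg (sub_nonneg.2 hn39) (by linarith : 0 ≤ m - 38)]

theorem exponent_inequality_second (n m N r : ℝ) (hn : 6 ≤ n) (hm : n - 1 ≤ m)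
    (hN : N ≤ (7 * (n * m) + 11) / 12)
    (hr : r ≤ (7 * m + 2) / 3000 ∨ 39 ≤ n ∧ r ≤ (7 * m + 2) / 480) :
    N - 1 + 8 * r + 1 / 40 + 1 / 100 - (n - 1) * (m - 1) < 0 := by
  rcases hr with hr | ⟨hn39, hr⟩
  · nlinarith [mul_nonneg (sub_nonneg.2 hn) (by linarith : 0 ≤ m - 5)]
  · nlinarith [mul_nonneg (sub_nonneg.2 hn39) (by linarith : 0 ≤ m - 38)]

set_option maxHeartbeats 1000000 in
/-- A root of an irreducible trinomial does not have two very good rational approximations of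
widely different heights. -/
theorem not_two_close_approximations (a b c : ℤ) (n k : ℕ) (hk0 : 0 < k) (hkn : k < n)
    (hn6 : 6 ≤ n) (H α : ℝ) (hH : 1 ≤ H) (ha0 : a ≠ 0)
    (ha : |(a : ℝ)| ≤ H) (hb : |(b : ℝ)| ≤ H) (hc : |(c : ℝ)| ≤ H)
    (hirr : Irreducible (C (a : ℚ) * X ^ n + C (b : ℚ) * X ^ k + C (c : ℚ)))
    (hα : a * α ^ n + b * α ^ k + c = 0) (hα0 : 0 < α) (hα1 : α ≤ 1)
    (K : ℕ) (hK : K = 250 ∨ K = 40 ∧ 39 ≤ n)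
    (p₁ q₁ p₂ q₂ : ℤ) (hq₁ : 0 < q₁) (hq₂ : 0 < q₂) (hpq : IsCoprime p₁ q₁) (κ : ℝ) (hκ : 1 ≤ κ)
    (h₁ : |(p₁ : ℝ) / q₁ - α| ≤ κ / q₁ ^ n) (h₂ : |(p₂ : ℝ) / q₂ - α| ≤ κ / q₂ ^ n)
    (hκq : κ ^ 40 ≤ q₁) (hHq : (8 * H) ^ (K * n) ≤ q₁) (hqq : (q₁ : ℝ) ^ (n - 2) ≤ q₂) : False := by
  have hK40 : 40 ≤ K := by omega
  have hB8 : 8 ≤ 8 * H := by linarith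
  have hB1 : 1 ≤ 8 * H := by linarith
  have hKn : 240 ≤ K * n := Nat.mul_le_mul hK40 hn6
  have hq₁R : (0 : ℝ) < q₁ := by exact_mod_cast hq₁
  have hq₂R : (0 : ℝ) < q₂ := by exact_mod_cast hq₂
  have hq₁8 : (8 : ℝ) ≤ q₁ := by
    refine le_trans ?_ hHq
    calc (8 : ℝ) ≤ (8 * H) ^ 1 := by rwa [pow_one]
      _ ≤ _ := pow_le_pow_right₀ hB1 (by omega)
  obtain ⟨s, hs1, hs2⟩ := exists_nat_pow_near (x := (q₂ : ℝ)) (y := (q₁ : ℝ))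
    (by exact_mod_cast hq₂) (by linarith)
  have hsn : n - 2 ≤ s := by
    have h3 : (q₁ : ℝ) ^ (n - 2) < q₁ ^ (s + 1) := lt_of_le_of_lt hqq hs2
    have := (pow_lt_pow_iff_right₀ (by linarith : (1 : ℝ) < q₁)).1 h3
    omega
  obtain ⟨m, hm⟩ : ∃ m, m = s + 1 := ⟨_, rfl⟩
  rw [← hm] at hs2
  have hmn : n ≤ m + 1 := by omega
  obtain ⟨N, hN⟩ : ∃ N, N = (7 * (n * m) + 11) / 12 := ⟨_, rfl⟩
  obtain ⟨t, ht⟩ : ∃ t, t = 13 * N / (K * n) + 1 := ⟨_, rfl⟩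
  have hnm : 30 ≤ n * m := Nat.mul_le_mul hn6 (by omega : 5 ≤ m)
  have hN1 : 12 * N ≤ 7 * (n * m) + 11 := by omega
  have hN2 : 7 * (n * m) ≤ 12 * N := by omega
  have ht1 : K * n * (t - 1) ≤ 13 * N := by
    rw [ht, Nat.add_sub_cancel]
    exact Nat.mul_div_le _ _
  have ht2 : 13 * N < K * n * t := by
    rw [ht]
    exact Nat.lt_mul_div_succ _ (by omega)
  have hN3 : 2 ≤ N := by omega
  have hqt : 4 * N ^ 2 * (8 * H) ^ (12 * N) < (q₁ : ℝ) ^ t := by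
    have e1 : (4 : ℝ) * N ^ 2 ≤ 8 ^ N := by
      have h4 : (4 : ℝ) ≤ 2 ^ N := by
        calc (4 : ℝ) = 2 ^ 2 := by norm_num
          _ ≤ _ := pow_le_pow_right₀ (by norm_num) hN3
      have h5 := natCast_le_two_pow N
      have h8 : (8 : ℝ) ^ N = 2 ^ N * (2 ^ N) ^ 2 := by
        rw [← pow_mul, mul_comm N 2, pow_mul, ← mul_pow]
        norm_num
      rw [h8]
      gcongr
    calc 4 * N ^ 2 * (8 * H) ^ (12 * N) ≤ (8 * H) ^ N * (8 * H) ^ (12 * N) := by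
          refine mul_le_mul_of_nonneg_right (e1.trans ?_) (by positivity)
          exact pow_le_pow_left₀ (by norm_num) hB8 N
      _ = (8 * H) ^ (13 * N) := by
          rw [← pow_add, show N + 12 * N = 13 * N by ring]
      _ < (8 * H) ^ (K * n * t) := pow_lt_pow_right₀ (by linarith) ht2
      _ = ((8 * H) ^ (K * n)) ^ t := pow_mul _ _ _
      _ ≤ _ := pow_le_pow_left₀ (by positivity) hHq t
  have hε₁ : κ / (q₁ : ℝ) ^ n ≤ 1 := by
    rw [div_le_one (by positivity)]
    calc κ ≤ κ ^ 40 := le_self_pow₀ hκ (by norm_num)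
      _ ≤ q₁ := hκq
      _ ≤ _ := le_self_pow₀ (by linarith) (by omega)
  have main := thue_siegel_inequality a b c n k hk0 hkn H α hH ha0 ha hb hc hirr hα hα0 hα1 N m t
    (by omega) (by omega) (by omega) (by rw [mul_comm m n]; omega) p₁ q₁ p₂ q₂ hq₁ hq₂ hpq _ _ h₁
    hε₁ h₂ hqt
  have hL : 0 < Real.log q₁ := Real.log_pos (by linarith)
  have hκL : 40 * Real.log κ ≤ Real.log q₁ := by
    have := Real.log_le_log (by positivity) hκq
    rwa [Real.log_pow] at this
  have hκ0 : 0 ≤ Real.log κ := Real.log_nonneg hκ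
  have hBL : (K * n : ℝ) * Real.log (8 * H) ≤ Real.log q₁ := by
    have := Real.log_le_log (by positivity) hHq
    rw [Real.log_pow] at this
    exact_mod_cast this
  have hlog2 : 0 < Real.log 2 := Real.log_pos (by norm_num)
  have hlogB : 3 * Real.log 2 ≤ Real.log (8 * H) := by
    have := Real.log_le_log (by norm_num) hB8
    have h8 : Real.log 8 = 3 * Real.log 2 := by
      rw [show (8 : ℝ) = 2 ^ 3 by norm_num, Real.log_pow]
      norm_num
    linarith
  have hKnR : (240 : ℝ) ≤ K * n := by exact_mod_cast hKn
  have hlog2L : Real.log 2 ≤ Real.log q₁ * (1 / 100) - Real.log 2 := by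
    linarith [mul_le_mul_of_nonneg_right hKnR (by linarith : 0 ≤ Real.log (8 * H))]
  set L := Real.log q₁ with hLdef
  set y := Real.log q₂ with hy
  have hy1 : (s : ℝ) * L ≤ y := by
    have := Real.log_le_log (by positivity) hs1
    rwa [Real.log_pow] at this
  have hy2 : y ≤ m * L := by
    have := Real.log_le_log hq₂R hs2.le
    rwa [Real.log_pow] at this
  set r : ℝ := N / (K * n) with hr
  have hKn0 : (0 : ℝ) < K * n := by linarith
  have hrB : 8 * N * Real.log (8 * H) ≤ 8 * r * L := by
    have : (N : ℝ) = r * (K * n) := by rw [hr]; field_simp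
    rw [this]
    have hr0 : 0 ≤ r := by positivity
    linarith [mul_le_mul_of_nonneg_left hBL hr0]
  have hn6R : (6 : ℝ) ≤ n := by exact_mod_cast hn6
  have hmnR : (n : ℝ) - 1 ≤ m := by
    have : (n : ℝ) ≤ m + 1 := by exact_mod_cast hmn
    linarith
  have hNR : (N : ℝ) ≤ (7 * (n * m) + 11) / 12 := by
    have : (12 : ℝ) * N ≤ 7 * (n * m) + 11 := by exact_mod_cast hN1
    linarith
  have htR : (t : ℝ) ≤ 13 * r + 1 := by
    have h3 : ((K * n * (t - 1) : ℕ) : ℝ) ≤ 13 * N := by exact_mod_cast ht1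
    rw [Nat.cast_mul, Nat.cast_sub (by rw [ht]; exact Nat.le_add_left _ _)] at h3
    push_cast at h3
    have : 13 * r = 13 * N / (K * n) := by rw [hr]; ring
    rw [this, ← sub_le_iff_le_add, le_div_iff₀ hKn0]
    linarith
  have hrK : r ≤ (7 * m + 2) / 3000 ∨ 39 ≤ (n : ℝ) ∧ r ≤ (7 * m + 2) / 480 := by
    rcases hK with hK | ⟨hK, hn39⟩
    · left
      rw [hr, hK, div_le_iff₀ (by positivity)]
      push_cast
      linarith
    · right
      refine ⟨by exact_mod_cast hn39, ?_⟩
      rw [hr, hK, div_le_iff₀ (by positivity)]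
      push_cast
      linarith
  have E1 := exponent_inequality_main n m N t r hn6R hmnR hNR htR hrK
  have E2 := exponent_inequality_second n m N r hn6R hmnR hNR hrK
  have htm : t ≤ m := by
    by_contra hcon
    have : (m : ℝ) - t ≤ 0 := by
      have : (m : ℝ) ≤ t := by exact_mod_cast (by omega : m ≤ t)
      linarith
    have hr0 : 0 ≤ r := by positivity
    have hN0 : (2 : ℝ) ≤ N := by exact_mod_cast hN3
    have hm0 : (0 : ℝ) ≤ m := by positivity
    linarith [mul_nonneg_of_nonpos_of_nonpos this (by linarith : (1 : ℝ) / 40 - n ≤ 0)]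
  have hκ0' : 0 < κ := by linarith
  have hB0 : 0 < 8 * H := by linarith
  have hNc : ((N - 1 : ℕ) : ℝ) = N - 1 := by
    rw [Nat.cast_sub (by omega)]; simp
  have hmc : ((m - t : ℕ) : ℝ) = m - t := Nat.cast_sub htm
  have hmt0 : (0 : ℝ) ≤ (m : ℝ) - t := by rw [← hmc]; positivity
  have hsc : (s : ℝ) = m - 1 := by rw [hm]; push_cast; ring
  have f1 : (q₁ : ℝ) ^ (N - 1) * q₂ * (8 * H) ^ (8 * N) * (κ / q₁ ^ n) ^ (m - t) < 1 / 2 := by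
    rw [← Real.log_lt_log_iff (by positivity) (by norm_num), Real.log_mul (by positivity)
      (by positivity), Real.log_mul (by positivity) (by positivity), Real.log_mul (by positivity)
      (by positivity), Real.log_pow, Real.log_pow, Real.log_pow, Real.log_div (by positivity)
      (by positivity), Real.log_pow, hNc, hmc, ← hLdef, ← hy, one_div, Real.log_inv]
    push_cast
    linarith [mul_le_mul_of_nonneg_left hκL hmt0, mul_lt_mul_of_pos_right E1 hL]
  have f2 : (q₁ : ℝ) ^ (N - 1) * q₂ * (8 * H) ^ (8 * N) * (κ / q₂ ^ n) < 1 / 2 := by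
    rw [← Real.log_lt_log_iff (by positivity) (by norm_num), Real.log_mul (by positivity)
      (by positivity), Real.log_mul (by positivity) (by positivity), Real.log_mul (by positivity)
      (by positivity), Real.log_pow, Real.log_pow, Real.log_div (by positivity)
      (by positivity), Real.log_pow, hNc, ← hLdef, ← hy, one_div, Real.log_inv]
    push_cast
    rw [hsc] at hy1
    linarith [mul_le_mul_of_nonneg_left hy1 (by linarith : (0 : ℝ) ≤ (n : ℝ) - 1),
      mul_lt_mul_of_pos_right E2 hL]
  rw [mul_add] at main
  linarith

theorem abs_div_sub_le_of_abs_log_sub_le (p q : ℕ) (hp : 0 < p) (hq : 0 < q) (n : ℕ) (α κ : ℝ)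
    (hα0 : 0 < α) (hα1 : α ≤ 1) (hκ : 0 < κ)
    (hlog : |Real.log ((p : ℝ) / q) - Real.log α| ≤ κ / (max p q : ℕ) ^ n)
    (hsmall : κ / (max p q : ℕ) ^ n ≤ 1 / 2) :
    |(p : ℝ) / q - α| ≤ 2 * κ / q ^ n ∧ ((max p q : ℕ) : ℝ) ≤ 2 * q := by
  have hpR : (0 : ℝ) < p := by exact_mod_cast hp
  have hqR : (0 : ℝ) < q := by exact_mod_cast hq
  have hX : (q : ℝ) ≤ (max p q : ℕ) := by exact_mod_cast le_max_right p q
  set δ := κ / ((max p q : ℕ) : ℝ) ^ n with hδ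
  have hδ0 : 0 < δ := by
    have : (0 : ℝ) < (max p q : ℕ) := by linarith
    positivity
  obtain ⟨w, hw⟩ : ∃ w, w = Real.log ((p : ℝ) / q) - Real.log α := ⟨_, rfl⟩
  rw [← hw] at hlog
  have hratio : (p : ℝ) / q = α * Real.exp w := by
    rw [hw, Real.exp_sub, Real.exp_log (by positivity), Real.exp_log hα0]
    field_simp
  have hexp : |Real.exp w - 1| ≤ 2 * δ := by
    have := Real.abs_exp_sub_one_le (x := w) (by linarith)
    linarith
  have hdiff : |(p : ℝ) / q - α| ≤ 2 * δ := by
    rw [hratio, show α * Real.exp w - α = α * (Real.exp w - 1) by ring, abs_mul, abs_of_pos hα0]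
    calc α * |Real.exp w - 1| ≤ 1 * |Real.exp w - 1| := by gcongr
      _ ≤ 2 * δ := by rw [one_mul]; exact hexp
  refine ⟨hdiff.trans ?_, ?_⟩
  · rw [hδ, mul_div_assoc]
    gcongr
  · have h1 : (p : ℝ) / q ≤ 2 := by
      have := (abs_le.1 hdiff).2
      linarith
    rw [div_le_iff₀ hqR] at h1
    rw [Nat.cast_max]
    exact max_le h1 (by linarith)

theorem not_two_close_log_approximations_of_le_one (a b c : ℤ) (n k : ℕ) (hk0 : 0 < k)
    (hkn : k < n) (hn6 : 6 ≤ n) (H α : ℝ) (hH : 1 ≤ H) (ha0 : a ≠ 0)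
    (ha : |(a : ℝ)| ≤ H) (hb : |(b : ℝ)| ≤ H) (hc : |(c : ℝ)| ≤ H)
    (hirr : Irreducible (C (a : ℚ) * X ^ n + C (b : ℚ) * X ^ k + C (c : ℚ)))
    (hα : a * α ^ n + b * α ^ k + c = 0) (hα0 : 0 < α) (hα1 : α ≤ 1)
    (K : ℕ) (hK : K = 250 ∨ K = 40 ∧ 39 ≤ n)
    (p₁ q₁ p₂ q₂ : ℕ) (hp₁ : 0 < p₁) (hq₁ : 0 < q₁) (hp₂ : 0 < p₂) (hq₂ : 0 < q₂)
    (hpq : Nat.Coprime p₁ q₁) (κ : ℝ) (hκ : 1 ≤ κ)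
    (h₁ : |Real.log ((p₁ : ℝ) / q₁) - Real.log α| ≤ κ / (max p₁ q₁ : ℕ) ^ n)
    (h₂ : |Real.log ((p₂ : ℝ) / q₂) - Real.log α| ≤ κ / (max p₂ q₂ : ℕ) ^ n)
    (hκq : 2 * (2 * κ) ^ 40 ≤ (max p₁ q₁ : ℕ)) (hHq : 2 * (8 * H) ^ (K * n) ≤ (max p₁ q₁ : ℕ))
    (hqq : 2 * ((max p₁ q₁ : ℕ) : ℝ) ^ (n - 2) ≤ (max p₂ q₂ : ℕ)) : False := by
  obtain ⟨X₁, hX₁⟩ : ∃ x : ℝ, x = (max p₁ q₁ : ℕ) := ⟨_, rfl⟩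
  obtain ⟨X₂, hX₂⟩ : ∃ x : ℝ, x = (max p₂ q₂ : ℕ) := ⟨_, rfl⟩
  have h2κ : 2 * κ ≤ X₁ := by
    rw [← hX₁] at hκq
    have : 2 * κ ≤ (2 * κ) ^ 40 := le_self_pow₀ (by linarith) (by norm_num)
    linarith
  have h12 : X₁ ≤ X₂ := by
    rw [← hX₁, ← hX₂] at hqq
    have : X₁ ≤ X₁ ^ (n - 2) := le_self_pow₀ (by linarith) (by omega)
    linarith
  have hsm : ∀ x : ℝ, X₁ ≤ x → κ / x ^ n ≤ 1 / 2 := by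
    intro x hx
    have hx2 : 2 * κ ≤ x := by linarith
    have : x ≤ x ^ n := le_self_pow₀ (by linarith) (by omega)
    rw [div_le_iff₀ (by linarith)]
    linarith
  obtain ⟨d₁, e₁⟩ := abs_div_sub_le_of_abs_log_sub_le p₁ q₁ hp₁ hq₁ n α κ hα0 hα1 (by linarith) h₁
    (by rw [← hX₁]; exact hsm _ le_rfl)
  obtain ⟨d₂, e₂⟩ := abs_div_sub_le_of_abs_log_sub_le p₂ q₂ hp₂ hq₂ n α κ hα0 hα1 (by linarith) h₂
    (by rw [← hX₂]; exact hsm _ h12)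
  have hqX : (q₁ : ℝ) ≤ (max p₁ q₁ : ℕ) := by exact_mod_cast le_max_right p₁ q₁
  refine not_two_close_approximations a b c n k hk0 hkn hn6 H α hH ha0 ha hb hc hirr hα hα0 hα1 K hK
    p₁ q₁ p₂ q₂ (by exact_mod_cast hq₁) (by exact_mod_cast hq₂)
    (Nat.isCoprime_iff_coprime.2 hpq) (2 * κ) (by linarith) ?_ ?_ ?_ ?_ ?_
  · push_cast; exact d₁
  · push_cast; exact d₂
  · push_cast; linarith
  · push_cast; linarith
  · push_cast
    have : (q₁ : ℝ) ^ (n - 2) ≤ ((max p₁ q₁ : ℕ) : ℝ) ^ (n - 2) := by gcongr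
    linarith

theorem not_two_close_log_approximations (a b c : ℤ) (n k : ℕ) (hk0 : 0 < k)
    (hkn : k < n) (hn6 : 6 ≤ n) (H α : ℝ) (hH : 1 ≤ H) (ha0 : a ≠ 0) (hc0 : c ≠ 0)
    (ha : |(a : ℝ)| ≤ H) (hb : |(b : ℝ)| ≤ H) (hc : |(c : ℝ)| ≤ H)
    (hirr : Irreducible (C (a : ℚ) * X ^ n + C (b : ℚ) * X ^ k + C (c : ℚ)))
    (hirr' : Irreducible (C (c : ℚ) * X ^ n + C (b : ℚ) * X ^ (n - k) + C (a : ℚ)))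
    (hα : a * α ^ n + b * α ^ k + c = 0) (hα0 : 0 < α)
    (K : ℕ) (hK : K = 250 ∨ K = 40 ∧ 39 ≤ n)
    (p₁ q₁ p₂ q₂ : ℕ) (hp₁ : 0 < p₁) (hq₁ : 0 < q₁) (hp₂ : 0 < p₂) (hq₂ : 0 < q₂)
    (hpq : Nat.Coprime p₁ q₁) (κ : ℝ) (hκ : 1 ≤ κ)
    (h₁ : |Real.log ((p₁ : ℝ) / q₁) - Real.log α| ≤ κ / (max p₁ q₁ : ℕ) ^ n)
    (h₂ : |Real.log ((p₂ : ℝ) / q₂) - Real.log α| ≤ κ / (max p₂ q₂ : ℕ) ^ n)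
    (hκq : 2 * (2 * κ) ^ 40 ≤ (max p₁ q₁ : ℕ)) (hHq : 2 * (8 * H) ^ (K * n) ≤ (max p₁ q₁ : ℕ))
    (hqq : 2 * ((max p₁ q₁ : ℕ) : ℝ) ^ (n - 2) ≤ (max p₂ q₂ : ℕ)) : False := by
  rcases le_total α 1 with h | h
  · exact not_two_close_log_approximations_of_le_one a b c n k hk0 hkn hn6 H α hH ha0 ha hb hc hirr
      hα hα0 h K hK p₁ q₁ p₂ q₂ hp₁ hq₁ hp₂ hq₂ hpq κ hκ h₁ h₂ hκq hHq hqq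
  · have hinv : ∀ p q : ℕ, 0 < p → 0 < q →
        |Real.log ((q : ℝ) / p) - Real.log α⁻¹| = |Real.log ((p : ℝ) / q) - Real.log α| := by
      intro p q hp hq
      rw [← inv_div, Real.log_inv, Real.log_inv, abs_sub_comm]
      congr 1
      ring
    have hα' : (c : ℝ) * α⁻¹ ^ n + b * α⁻¹ ^ (n - k) + a = 0 := by
      have e : (c : ℝ) * α⁻¹ ^ n + b * α⁻¹ ^ (n - k) + a
          = α⁻¹ ^ n * (a * α ^ n + b * α ^ k + c) := by
        have h1 : α ^ n = α ^ k * α ^ (n - k) := by rw [← pow_add]; congr 1; omega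
        rw [inv_pow, inv_pow, h1]
        field_simp
        ring
      rw [e, hα, mul_zero]
    rw [max_comm p₁ q₁] at hκq hHq hqq h₁
    rw [max_comm p₂ q₂] at hqq h₂
    exact not_two_close_log_approximations_of_le_one c b a n (n - k) (by omega) (by omega) hn6 H
      α⁻¹ hH hc0 hc hb ha hirr' hα' (inv_pos.2 hα0) (inv_le_one_of_one_le₀ h) K hK q₁ p₁ q₂ p₂ hq₁
      hp₁ hq₂ hp₂ hpq.symm κ hκ (by rw [hinv _ _ hp₁ hq₁]; exact h₁)
      (by rw [hinv _ _ hp₂ hq₂]; exact h₂) hκq hHq hqq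

/-- The trinomial `a x^(k+r) + b x^k + c` divided by `x^k`, in the variable `u = log x`. -/
noncomputable def expTrinomial (a b c : ℝ) (k r : ℕ) (u : ℝ) : ℝ :=
  a * Real.exp (r * u) + b + c * Real.exp (-(k * u))

/-- A pair of distinct positive integers at which the trinomial form takes a value `±1`. -/
def IsPosSolution (a b c : ℤ) (k r : ℕ) (s : ℕ × ℕ) : Prop :=
  0 < s.1 ∧ 0 < s.2 ∧ s.1 ≠ s.2 ∧
    |a * (s.1 : ℤ) ^ (k + r) + b * (s.1 : ℤ) ^ k * (s.2 : ℤ) ^ r + c * (s.2 : ℤ) ^ (k + r)| = 1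

/-- The logarithm of the ratio of a pair. -/
noncomputable def logRatio (s : ℕ × ℕ) : ℝ := Real.log ((s.1 : ℝ) / s.2)

/-- The middle monomial `p^k q^r` of the form. -/
def midMonomial (k r : ℕ) (s : ℕ × ℕ) : ℕ := s.1 ^ k * s.2 ^ r

/-- The height of a pair. -/
def pairHeight (s : ℕ × ℕ) : ℕ := max s.1 s.2

theorem IsPosSolution.coprime {a b c : ℤ} {k r : ℕ} {s : ℕ × ℕ} (hk : 0 < k) (hr : 0 < r)
    (h : IsPosSolution a b c k r s) : Nat.Coprime s.1 s.2 := by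
  obtain ⟨h1, h2, -, h4⟩ := h
  set g := Nat.gcd s.1 s.2 with hg
  have hd1 : (g : ℤ) ∣ s.1 := Int.natCast_dvd_natCast.2 (Nat.gcd_dvd_left _ _)
  have hd2 : (g : ℤ) ∣ s.2 := Int.natCast_dvd_natCast.2 (Nat.gcd_dvd_right _ _)
  have hd : (g : ℤ) ∣ a * (s.1 : ℤ) ^ (k + r) + b * (s.1 : ℤ) ^ k * (s.2 : ℤ) ^ r
      + c * (s.2 : ℤ) ^ (k + r) := by
    refine dvd_add (dvd_add ?_ ?_) ?_
    · exact (dvd_pow hd1 (by omega)).mul_left _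
    · exact (dvd_pow hd2 (by omega)).mul_left _
    · exact (dvd_pow hd2 (by omega)).mul_left _
  have : (g : ℤ) ∣ 1 := by rw [← h4]; exact (dvd_abs _ _).2 hd
  have h1' : g ∣ 1 := by exact_mod_cast this
  exact Nat.dvd_one.1 h1'

theorem IsPosSolution.cross_ne {a b c : ℤ} {k r : ℕ} {s t : ℕ × ℕ} (hk : 0 < k) (hr : 0 < r)
    (hs : IsPosSolution a b c k r s) (ht : IsPosSolution a b c k r t) (hst : s ≠ t) :
    s.1 * t.2 ≠ t.1 * s.2 := by
  intro he
  have c1 := hs.coprime hk hr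
  have c2 := ht.coprime hk hr
  have d1 : s.1 ∣ t.1 := c1.dvd_of_dvd_mul_right (he ▸ Dvd.intro _ rfl)
  have d2 : t.1 ∣ s.1 := c2.dvd_of_dvd_mul_right (he ▸ Dvd.intro _ rfl)
  have e1 : s.1 = t.1 := Nat.dvd_antisymm d1 d2
  have e2 : s.2 = t.2 := by
    rw [e1] at he
    exact (Nat.eq_of_mul_eq_mul_left ht.1 he).symm
  exact hst (Prod.ext e1 e2)

theorem IsPosSolution.two_le_height {a b c : ℤ} {k r : ℕ} {s : ℕ × ℕ}
    (h : IsPosSolution a b c k r s) : 2 ≤ pairHeight s := by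
  obtain ⟨h1, h2, h3, -⟩ := h
  unfold pairHeight
  omega

theorem exp_mul_logRatio {s : ℕ × ℕ} (h1 : 0 < s.1) (h2 : 0 < s.2) (m : ℕ) :
    Real.exp (m * logRatio s) = ((s.1 : ℝ) / s.2) ^ m := by
  rw [Real.exp_nat_mul, logRatio, Real.exp_log (by positivity)]

theorem mul_exp_logRatio {s : ℕ × ℕ} (h1 : 0 < s.1) (h2 : 0 < s.2) (k r : ℕ) :
    Real.exp (r * logRatio s) * midMonomial k r s = (s.1 : ℝ) ^ (k + r) := by
  rw [exp_mul_logRatio h1 h2, midMonomial]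
  have : (s.2 : ℝ) ≠ 0 := by positivity
  push_cast
  rw [div_pow, pow_add]
  field_simp

theorem mul_exp_neg_logRatio {s : ℕ × ℕ} (h1 : 0 < s.1) (h2 : 0 < s.2) (k r : ℕ) :
    Real.exp (-(k * logRatio s)) * midMonomial k r s = (s.2 : ℝ) ^ (k + r) := by
  rw [Real.exp_neg, exp_mul_logRatio h1 h2, midMonomial]
  have : (s.2 : ℝ) ≠ 0 := by positivity
  have : (s.1 : ℝ) ≠ 0 := by positivity
  push_cast
  rw [div_pow, pow_add]
  field_simp

theorem IsPosSolution.midMonomial_pos {a b c : ℤ} {k r : ℕ} {s : ℕ × ℕ}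
    (h : IsPosSolution a b c k r s) : 0 < midMonomial k r s := by
  have h1 := h.1
  have h2 := h.2.1
  unfold midMonomial
  positivity

theorem expTrinomial_logRatio_mul (a b c : ℝ) (k r : ℕ) {s : ℕ × ℕ} (h1 : 0 < s.1)
    (h2 : 0 < s.2) : expTrinomial a b c k r (logRatio s) * midMonomial k r s
      = a * (s.1 : ℝ) ^ (k + r) + b * (s.1 : ℝ) ^ k * (s.2 : ℝ) ^ r
        + c * (s.2 : ℝ) ^ (k + r) := by
  rw [expTrinomial, add_mul, add_mul, mul_assoc, mul_assoc, mul_exp_logRatio h1 h2,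
    mul_exp_neg_logRatio h1 h2, midMonomial]
  push_cast
  ring

theorem IsPosSolution.abs_expTrinomial_mul {a b c : ℤ} {k r : ℕ} {s : ℕ × ℕ}
    (h : IsPosSolution a b c k r s) :
    |expTrinomial a b c k r (logRatio s)| * midMonomial k r s = 1 := by
  have h0 : ((midMonomial k r s : ℕ) : ℝ) = |((midMonomial k r s : ℕ) : ℝ)| := by simp
  rw [h0, ← abs_mul, expTrinomial_logRatio_mul _ _ _ _ _ h.1 h.2.1]
  have := h.2.2.2
  exact_mod_cast this

theorem expTrinomial_add_sub (a b c : ℝ) (k r : ℕ) (u v : ℝ) :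
    expTrinomial a b c k r (u + v) - expTrinomial a b c k r u
      = a * Real.exp (r * u) * (Real.exp (r * v) - 1)
        + c * Real.exp (-(k * u)) * (Real.exp (-(k * v)) - 1) := by
  unfold expTrinomial
  rw [mul_add, mul_add, Real.exp_add, neg_add, Real.exp_add]
  ring

/-- The difference of the values of the form at two pairs, the second one rescaled. -/
theorem IsPosSolution.abs_diff_le {a b c : ℤ} {k r : ℕ} {s : ℕ × ℕ}
    (h : IsPosSolution a b c k r s) {u η : ℝ}
    (hu : |expTrinomial a b c k r u| * midMonomial k r s ≤ η) :
    |a * (s.1 : ℝ) ^ (k + r) * (Real.exp (r * (u - logRatio s)) - 1)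
      + c * (s.2 : ℝ) ^ (k + r) * (Real.exp (-(k * (u - logRatio s))) - 1)| ≤ η + 1 := by
  have e := expTrinomial_add_sub a b c k r (logRatio s) (u - logRatio s)
  rw [add_sub_cancel] at e
  have e1 : a * (s.1 : ℝ) ^ (k + r) * (Real.exp (r * (u - logRatio s)) - 1)
      + c * (s.2 : ℝ) ^ (k + r) * (Real.exp (-(k * (u - logRatio s))) - 1)
      = (expTrinomial a b c k r u - expTrinomial a b c k r (logRatio s)) * midMonomial k r s := by
    rw [e, ← mul_exp_logRatio h.1 h.2.1, ← mul_exp_neg_logRatio h.1 h.2.1]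
    ring
  have h0 : |((midMonomial k r s : ℕ) : ℝ)| = ((midMonomial k r s : ℕ) : ℝ) := by simp
  have h1 := h.abs_expTrinomial_mul
  rw [e1, abs_mul, h0]
  calc _ ≤ (|expTrinomial a b c k r u| + |expTrinomial a b c k r (logRatio s)|)
        * midMonomial k r s := by gcongr; exact abs_sub _ _
    _ ≤ _ := by linarith

theorem IsPosSolution.abs_expTrinomial_mul_le {a b c : ℤ} {k r : ℕ} {s t : ℕ × ℕ}
    (ht : IsPosSolution a b c k r t)
    (hst : midMonomial k r s ≤ midMonomial k r t) :
    |expTrinomial a b c k r (logRatio t)| * midMonomial k r s ≤ 1 := by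
  rw [← ht.abs_expTrinomial_mul]
  gcongr

theorem one_le_mul_one_sub_exp_log_sub {m m' : ℕ} (hm : 0 < m) (hm' : 0 < m') (h : m ≠ m') :
    1 ≤ (max m m' : ℕ) * (1 - Real.exp (-|Real.log m' - Real.log m|)) := by
  wlog hlt : m < m' generalizing m m'
  · rw [max_comm, abs_sub_comm]
    exact this hm' hm h.symm (by omega)
  have h1 : Real.log m ≤ Real.log m' := Real.log_le_log (by positivity) (by exact_mod_cast hlt.le)
  rw [abs_of_nonneg (by linarith), neg_sub, Real.exp_sub, Real.exp_log (by positivity),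
    Real.exp_log (by positivity), max_eq_right hlt.le, mul_sub, mul_div_cancel₀ _ (by positivity)]
  have : (m : ℝ) + 1 ≤ m' := by exact_mod_cast hlt
  linarith

theorem one_le_succ_mul_abs_log_sub {m m' : ℕ} (hm : 0 < m) (hm' : 0 < m') (h : m ≠ m') :
    1 ≤ ((m : ℝ) + 1) * |Real.log m' - Real.log m| := by
  have hx := one_le_mul_one_sub_exp_log_sub hm hm' h
  have hy := Real.add_one_le_exp (-|Real.log m' - Real.log m|)
  rcases lt_or_gt_of_ne h with hlt | hlt
  · have h1 : Real.log ((m : ℝ) + 1) ≤ Real.log m' :=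
      Real.log_le_log (by positivity) (by exact_mod_cast hlt)
    have h2 : Real.log (m / (m + 1) : ℝ) ≤ m / (m + 1) - 1 :=
      Real.log_le_sub_one_of_pos (by positivity)
    rw [Real.log_div (by positivity) (by positivity)] at h2
    have h3 : (m + 1 : ℝ) * (m / (m + 1) - 1) = -1 := by field_simp; ring
    have h4 := le_abs_self (Real.log m' - Real.log m)
    have h5 : (0 : ℝ) < m + 1 := by positivity
    nlinarith
  · rw [max_eq_left hlt.le] at hx
    have : (0 : ℝ) ≤ m := by positivity
    nlinarith [abs_nonneg (Real.log m' - Real.log m)]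

section Pair

variable {a b c : ℤ} {k r : ℕ} {s t : ℕ × ℕ}

theorem logRatio_sub (h1 : 0 < s.1) (h2 : 0 < s.2) (h3 : 0 < t.1) (h4 : 0 < t.2) :
    logRatio t - logRatio s
      = Real.log ((t.1 * s.2 : ℕ) : ℝ) - Real.log ((s.1 * t.2 : ℕ) : ℝ) := by
  unfold logRatio
  push_cast
  rw [Real.log_div, Real.log_div, Real.log_mul, Real.log_mul]
  · ring
  all_goals positivity

theorem IsPosSolution.one_le_height_mul (hk : 0 < k) (hr : 0 < r)
    (hs : IsPosSolution a b c k r s) (ht : IsPosSolution a b c k r t) (hst : s ≠ t) :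
    1 ≤ ((pairHeight s : ℝ) * pairHeight t) * (1 - Real.exp (-|logRatio t - logRatio s|)) := by
  have h1 := hs.1
  have h2 := hs.2.1
  have h3 := ht.1
  have h4 := ht.2.1
  rw [logRatio_sub h1 h2 h3 h4]
  refine (one_le_mul_one_sub_exp_log_sub (by positivity) (by positivity)
    (hs.cross_ne hk hr ht hst)).trans ?_
  have h5 : Real.exp (-|Real.log ((t.1 * s.2 : ℕ) : ℝ) - Real.log ((s.1 * t.2 : ℕ) : ℝ)|) ≤ 1 := by
    rw [Real.exp_le_one_iff]
    simp
  have h6 : max (s.1 * t.2) (t.1 * s.2) ≤ pairHeight s * pairHeight t := by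
    unfold pairHeight
    refine max_le (Nat.mul_le_mul (le_max_left _ _) (le_max_right _ _)) ?_
    rw [mul_comm]
    exact Nat.mul_le_mul (le_max_right _ _) (le_max_left _ _)
  exact mul_le_mul_of_nonneg_right (by exact_mod_cast h6) (by linarith)

theorem IsPosSolution.one_le_height_mul_abs (hk : 0 < k) (hr : 0 < r)
    (hs : IsPosSolution a b c k r s) (ht : IsPosSolution a b c k r t) (hst : s ≠ t) :
    1 ≤ ((pairHeight s : ℝ) * pairHeight t) * |logRatio t - logRatio s| := by
  refine (hs.one_le_height_mul hk hr ht hst).trans ?_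
  gcongr
  have := Real.add_one_le_exp (-|logRatio t - logRatio s|)
  linarith

theorem IsPosSolution.one_le_cross_mul_abs (hk : 0 < k) (hr : 0 < r)
    (hs : IsPosSolution a b c k r s) (ht : IsPosSolution a b c k r t) (hst : s ≠ t) :
    1 ≤ ((s.1 : ℝ) * t.2 + 1) * |logRatio t - logRatio s| ∧
      1 ≤ ((t.1 : ℝ) * s.2 + 1) * |logRatio t - logRatio s| := by
  have h1 := hs.1
  have h2 := hs.2.1
  have h3 := ht.1
  have h4 := ht.2.1
  have h := hs.cross_ne hk hr ht hst
  rw [logRatio_sub h1 h2 h3 h4]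
  constructor
  · have := one_le_succ_mul_abs_log_sub (m := s.1 * t.2) (m' := t.1 * s.2) (by positivity)
      (by positivity) h
    push_cast at this ⊢
    exact this
  · have := one_le_succ_mul_abs_log_sub (m := t.1 * s.2) (m' := s.1 * t.2) (by positivity)
      (by positivity) h.symm
    rw [abs_sub_comm]
    push_cast at this ⊢
    exact this

end Pair

theorem abs_mul_le_of_opposite_signs {A C R K v η : ℝ} (hA : 0 ≤ A) (hC : 0 ≤ C) (hR : 1 ≤ R)
    (hK : 1 ≤ K)
    (h : |A * (Real.exp (R * v) - 1) - C * (Real.exp (-(K * v)) - 1)| ≤ η) :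
    A * (1 - Real.exp (-|v|)) ≤ η ∧ C * (1 - Real.exp (-|v|)) ≤ η := by
  have key : ∀ L w : ℝ, 1 ≤ L → 0 ≤ w → 1 - Real.exp (-w) ≤ Real.exp (L * w) - 1 ∧
      1 - Real.exp (-w) ≤ 1 - Real.exp (-(L * w)) := by
    intro L w hL hw
    have hLw : w ≤ L * w := by nlinarith
    constructor
    · have := Real.add_one_le_exp (-w)
      have := Real.add_one_le_exp (L * w)
      linarith
    · have : Real.exp (-(L * w)) ≤ Real.exp (-w) := Real.exp_le_exp.2 (by linarith)
      linarith
  have he : ∀ w : ℝ, 0 ≤ w → 0 ≤ 1 - Real.exp (-w) := by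
    intro w hw
    have : Real.exp (-w) ≤ 1 := Real.exp_le_one_iff.2 (by linarith)
    linarith
  rcases le_total 0 v with hv | hv
  · rw [abs_of_nonneg hv]
    have h1 := (key R v hR hv).1
    have h2 := (key K v hK hv).2
    have h0 := he v hv
    have h3 := (le_abs_self _).trans h
    have h4 := mul_le_mul_of_nonneg_left h1 hA
    have h5 := mul_le_mul_of_nonneg_left h2 hC
    have h6 := mul_nonneg hA h0
    have h7 := mul_nonneg hC h0
    constructor <;> linarith
  · rw [abs_of_nonpos hv, neg_neg]
    have h1 := (key R (-v) hR (by linarith)).2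
    have h2 := (key K (-v) hK (by linarith)).1
    have h0 := he (-v) (by linarith)
    rw [mul_neg, neg_neg, neg_neg] at h1
    rw [mul_neg, neg_neg] at h2
    rw [neg_neg] at h0
    have h3 := (neg_abs_le _).trans' (neg_le_neg h)
    have h4 := mul_le_mul_of_nonneg_left h1 hA
    have h5 := mul_le_mul_of_nonneg_left h2 hC
    have h6 := mul_nonneg hA h0
    have h7 := mul_nonneg hC h0
    constructor <;> linarith

section OppositeSigns

variable {a b c : ℤ} {k r : ℕ} {s t : ℕ × ℕ}

theorem IsPosSolution.mul_one_sub_exp_le_of_opposite_signs (hk : 0 < k) (hr : 0 < r) (ha : 0 < a)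
    (hc : c < 0) (hs : IsPosSolution a b c k r s) {u η : ℝ}
    (hu : |expTrinomial a b c k r u| * midMonomial k r s ≤ η) :
    a * (s.1 : ℝ) ^ (k + r) * (1 - Real.exp (-|u - logRatio s|)) ≤ η + 1 ∧
      -c * (s.2 : ℝ) ^ (k + r) * (1 - Real.exp (-|u - logRatio s|)) ≤ η + 1 := by
  have h := hs.abs_diff_le hu
  have ha' : (0 : ℝ) < a := by exact_mod_cast ha
  have hc' : (0 : ℝ) < -c := by rw [neg_pos]; exact_mod_cast hc
  refine abs_mul_le_of_opposite_signs (by positivity) (by positivity)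
    (by exact_mod_cast hr) (by exact_mod_cast hk) (R := r) (K := k) ?_
  rw [show ∀ x y z w : ℝ, x - -z * y * w = x + z * y * w by intros; ring]
  exact h

theorem pow_height_le_of_le {m M : ℝ} (ha : 1 ≤ a) (hc : 1 ≤ -c) {s : ℕ × ℕ} (hm : 0 ≤ m)
    (h1 : a * (s.1 : ℝ) ^ (k + r) * m ≤ M) (h2 : -c * (s.2 : ℝ) ^ (k + r) * m ≤ M) :
    (pairHeight s : ℝ) ^ (k + r) * m ≤ M := by
  have ha' : (1 : ℝ) ≤ a := by exact_mod_cast ha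
  have hc' : (1 : ℝ) ≤ -c := by exact_mod_cast hc
  unfold pairHeight
  rcases le_total s.1 s.2 with h | h
  · rw [max_eq_right h]
    have : 0 ≤ (s.2 : ℝ) ^ (k + r) * m := by positivity
    nlinarith
  · rw [max_eq_left h]
    have : 0 ≤ (s.1 : ℝ) ^ (k + r) * m := by positivity
    nlinarith

/-- The gap principle when the outer coefficients have opposite signs. -/
theorem IsPosSolution.gap_of_opposite_signs (hk : 0 < k) (hr : 0 < r) (ha : 0 < a)
    (hc : c < 0) (hs : IsPosSolution a b c k r s) (ht : IsPosSolution a b c k r t) (hst : s ≠ t)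
    (hm : midMonomial k r s ≤ midMonomial k r t) :
    (pairHeight s : ℝ) ^ (k + r) ≤ 2 * (pairHeight s * pairHeight t) ∧
      |(a : ℝ)| ≤ 2 * (pairHeight s * pairHeight t) ∧
      |(b : ℝ)| ≤ 2 * (pairHeight s * pairHeight t) ∧
      |(c : ℝ)| ≤ 2 * (pairHeight s * pairHeight t) := by
  have h1 := hs.one_le_height_mul hk hr ht hst
  obtain ⟨h2, h3⟩ := hs.mul_one_sub_exp_le_of_opposite_signs hk hr ha hc
    (ht.abs_expTrinomial_mul_le hm)
  set M : ℝ := pairHeight s * pairHeight t with hM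
  set e : ℝ := 1 - Real.exp (-|logRatio t - logRatio s|) with he
  have ha' : (1 : ℝ) ≤ a := by exact_mod_cast ha
  have hc' : (1 : ℝ) ≤ -c := by
    have : (1 : ℤ) ≤ -c := by omega
    exact_mod_cast this
  have hM0 : 0 ≤ M := by positivity
  have he0 : 0 ≤ e := by
    have : Real.exp (-|logRatio t - logRatio s|) ≤ 1 := Real.exp_le_one_iff.2 (by simp)
    linarith
  have red : ∀ Y : ℝ, 0 ≤ Y → Y * e ≤ 1 + 1 → Y ≤ 2 * M := by
    intro Y hY h
    calc Y ≤ Y * (M * e) := le_mul_of_one_le_right hY h1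
      _ = M * (Y * e) := by ring
      _ ≤ M * (1 + 1) := by gcongr
      _ = 2 * M := by ring
  have hA := red _ (by positivity) h2
  have hC := red _ (by positivity) h3
  have hs1 : (1 : ℝ) ≤ s.1 := by exact_mod_cast hs.1
  have hs2 : (1 : ℝ) ≤ s.2 := by exact_mod_cast hs.2.1
  have hp1 : (1 : ℝ) ≤ (s.1 : ℝ) ^ (k + r) := one_le_pow₀ hs1
  have hp2 : (1 : ℝ) ≤ (s.2 : ℝ) ^ (k + r) := one_le_pow₀ hs2
  refine ⟨?_, ?_, ?_, ?_⟩
  · exact red _ (by positivity) (pow_height_le_of_le (by exact_mod_cast ha) (by omega) he0 h2 h3)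
  · rw [abs_of_pos (by linarith)]
    nlinarith
  · have h5 : |(b : ℝ)| * 1 ≤ |(b : ℝ) * (s.1 : ℝ) ^ k * (s.2 : ℝ) ^ r| := by
      rw [mul_assoc, abs_mul]
      gcongr
      rw [abs_of_nonneg (by positivity)]
      exact one_le_mul_of_one_le_of_one_le (one_le_pow₀ hs1) (one_le_pow₀ hs2)
    have h6 : |(a : ℝ) * (s.1 : ℝ) ^ (k + r) + b * (s.1 : ℝ) ^ k * (s.2 : ℝ) ^ r
        + c * (s.2 : ℝ) ^ (k + r)| = 1 := by exact_mod_cast hs.2.2.2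
    have h7 : (1 : ℝ) ≤ a * (s.1 : ℝ) ^ (k + r) := one_le_mul_of_one_le_of_one_le ha' hp1
    have h8 : (1 : ℝ) ≤ -c * (s.2 : ℝ) ^ (k + r) := one_le_mul_of_one_le_of_one_le hc' hp2
    have h9 := abs_le.1 h6.le
    rw [mul_one] at h5
    refine h5.trans (abs_le.2 ⟨?_, ?_⟩) <;> linarith
  · rw [abs_of_neg (by linarith)]
    nlinarith

theorem IsPosSolution.log_close_of_opposite_signs (hk : 0 < k) (hr : 0 < r) (ha : 0 < a)
    (hc : c < 0) (hs : IsPosSolution a b c k r s) {u : ℝ} (hu : expTrinomial a b c k r u = 0) :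
    |logRatio s - u| ≤ 2 / (pairHeight s : ℝ) ^ (k + r) := by
  obtain ⟨h2, h3⟩ := hs.mul_one_sub_exp_le_of_opposite_signs hk hr ha hc (u := u) (η := 0)
    (by simp [hu])
  set v := |u - logRatio s| with hv
  have hv0 : 0 ≤ v := abs_nonneg _
  have he0 : 0 ≤ 1 - Real.exp (-v) := by
    have : Real.exp (-v) ≤ 1 := Real.exp_le_one_iff.2 (by linarith)
    linarith
  have h := pow_height_le_of_le (by exact_mod_cast ha) (by omega) he0 h2 h3
  set N := (pairHeight s : ℝ) ^ (k + r) with hN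
  have h2N : (2 : ℝ) ≤ N := by
    have h1 : (2 : ℝ) ≤ pairHeight s := by exact_mod_cast hs.two_le_height
    calc (2 : ℝ) ≤ pairHeight s := h1
      _ ≤ N := le_self_pow₀ (by linarith) (by omega)
  have h4 : Real.exp (-v) * (1 + v) ≤ 1 := by
    have h5 := Real.add_one_le_exp v
    have h6 : Real.exp (-v) * Real.exp v = 1 := by rw [← Real.exp_add]; simp
    have h7 := Real.exp_pos (-v)
    nlinarith
  rw [abs_sub_comm, le_div_iff₀ (by linarith)]
  rw [← hv]
  have h8 : N * v ≤ 1 + v := by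
    have := mul_le_mul_of_nonneg_right h (by linarith : 0 ≤ 1 + v)
    nlinarith
  nlinarith

end OppositeSigns

theorem mul_sq_le_of_same_signs {A C R K v η : ℝ} (hA : 0 ≤ A) (hC : 0 ≤ C) (hR : 0 ≤ R)
    (hη : 0 ≤ η) (h1 : K * C ≤ R * A)
    (h2 : K * (C * Real.exp (-(K * v))) ≤ R * (A * Real.exp (R * v)))
    (h : |A * (Real.exp (R * v) - 1) + C * (Real.exp (-(K * v)) - 1)| ≤ η) :
    A * (R * |v|) ^ 2 ≤ η * (2 + 2 * (R * |v|) + (R * |v|) ^ 2) := by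
  rcases le_total 0 v with hv | hv
  · rw [abs_of_nonneg hv]
    have h3 := (le_abs_self _).trans h
    have h4 := Real.quadratic_le_exp_of_nonneg (mul_nonneg hR hv)
    have h5 := Real.add_one_le_exp (-(K * v))
    have h6 : A * (R * v) + A * (R * v) ^ 2 / 2 ≤ A * (Real.exp (R * v) - 1) := by
      have := mul_le_mul_of_nonneg_left h4 hA
      nlinarith
    have h7 : -(C * (K * v)) ≤ C * (Real.exp (-(K * v)) - 1) := by
      have := mul_le_mul_of_nonneg_left h5 hC
      nlinarith
    have h8 := mul_le_mul_of_nonneg_right h1 hv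
    have h9 : 0 ≤ η * (R * v) := mul_nonneg hη (mul_nonneg hR hv)
    have h10 : 0 ≤ η * (R * v) ^ 2 := mul_nonneg hη (sq_nonneg _)
    nlinarith
  · rw [abs_of_nonpos hv]
    obtain ⟨w, rfl⟩ : ∃ w, v = -w := ⟨-v, by ring⟩
    rw [neg_neg]
    have hw : 0 ≤ w := by linarith
    rw [mul_neg, mul_neg, neg_neg] at h
    rw [mul_neg, mul_neg, neg_neg] at h2
    have h3 := neg_le_of_abs_le h
    set t := R * w with ht
    have ht0 : 0 ≤ t := mul_nonneg hR hw
    have h4 := Real.quadratic_le_exp_of_nonneg ht0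
    have h5 : C * (Real.exp (K * w) - 1) ≤ A * Real.exp (-t) * t := by
      have h6 := Real.add_one_le_exp (-(K * w))
      have h7 : Real.exp (K * w) * Real.exp (-(K * w)) = 1 := by rw [← Real.exp_add]; simp
      have h8 : Real.exp (K * w) - 1 ≤ Real.exp (K * w) * (K * w) := by
        have := Real.exp_pos (K * w)
        nlinarith
      have h9 := mul_le_mul_of_nonneg_left h8 hC
      have h10 := mul_le_mul_of_nonneg_right h2 hw
      nlinarith
    have h6 : Real.exp (-t) * Real.exp t = 1 := by rw [← Real.exp_add]; simp
    have h7 : A ≤ η + A * Real.exp (-t) * (1 + t) := by linarith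
    have h8 : 0 < Real.exp (-t) := Real.exp_pos _
    have h9 : Real.exp (-t) * (1 + t + t ^ 2 / 2) ≤ 1 := by
      calc _ ≤ Real.exp (-t) * Real.exp t := by gcongr
        _ = 1 := h6
    have h10 : A * (1 + t + t ^ 2 / 2) ≤ η * (1 + t + t ^ 2 / 2) + A * (1 + t) := by
      have h11 := mul_le_mul_of_nonneg_right h7 (by positivity : 0 ≤ 1 + t + t ^ 2 / 2)
      have h12 : A * (1 + t) * (Real.exp (-t) * (1 + t + t ^ 2 / 2)) ≤ A * (1 + t) * 1 :=
        mul_le_mul_of_nonneg_left h9 (by positivity)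
      linarith
    nlinarith

theorem le_mul_sq_of_mul_sq_le {v Y L N : ℝ} (hY : 0 ≤ Y) (hN : 1 ≤ N * v)
    (h : Y * v ^ 2 ≤ L) : Y ≤ L * N ^ 2 := by
  have h1 : 1 ≤ (N * v) ^ 2 := one_le_pow₀ hN
  calc Y ≤ Y * (N * v) ^ 2 := le_mul_of_one_le_right hY h1
    _ = N ^ 2 * (Y * v ^ 2) := by ring
    _ ≤ N ^ 2 * L := by gcongr
    _ = L * N ^ 2 := by ring

theorem le_mul_sq_of_mul_pow_le {Y x y N L : ℝ} {m : ℕ} (hY : 0 ≤ Y) (hx : 1 ≤ x) (hm : 2 ≤ m)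
    (hy : 0 ≤ y) (hyN : y ≤ N) (hL : 0 ≤ L) (h : Y * x ^ m ≤ L * (x * y) ^ 2) :
    Y ≤ L * N ^ 2 := by
  have h1 : x ^ 2 ≤ x ^ m := pow_le_pow_right₀ hx hm
  have h2 : Y * x ^ 2 ≤ (L * N ^ 2) * x ^ 2 := by
    calc Y * x ^ 2 ≤ Y * x ^ m := by gcongr
      _ ≤ L * (x * y) ^ 2 := h
      _ = (L * y ^ 2) * x ^ 2 := by ring
      _ ≤ _ := by gcongr
  exact le_of_mul_le_mul_right h2 (by positivity)

/-- Bounding the middle coefficient from a bound for the middle term. -/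
theorem abs_mid_coeff_le {b L : ℝ} {k r : ℕ} (hn : 3 ≤ k + r) {x₁ x₂ y₁ y₂ N : ℝ} (hx₁ : 1 ≤ x₁)
    (hx₂ : 1 ≤ x₂) (hy₁ : 0 ≤ y₁) (hy₂ : 0 ≤ y₂) (hyN₁ : y₁ ≤ N) (hyN₂ : y₂ ≤ N) (hL : 0 ≤ L)
    (h₁ : |b| * (x₁ ^ k * x₂ ^ r) ≤ L * (x₁ * y₂) ^ 2)
    (h₂ : |b| * (x₁ ^ k * x₂ ^ r) ≤ L * (y₁ * x₂) ^ 2) : |b| ≤ L * N ^ 2 := by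
  rcases le_or_gt 2 k with h2k | h2k
  · refine le_mul_sq_of_mul_pow_le (abs_nonneg _) hx₁ h2k hy₂ hyN₂ hL (le_trans ?_ h₁)
    gcongr
    exact le_mul_of_one_le_right (by positivity) (one_le_pow₀ hx₂)
  · refine le_mul_sq_of_mul_pow_le (m := r) (abs_nonneg _) hx₂ (by omega) hy₁ hyN₁ hL
      (le_trans ?_ (h₂.trans_eq (by ring)))
    gcongr
    exact le_mul_of_one_le_left (by positivity) (one_le_pow₀ hx₁)

theorem mul_sq_le_ten_of_quadratic {A w : ℝ} (hw : 0 ≤ w) (hA : 10 ≤ A)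
    (h : A * w ^ 2 ≤ (1 + 1) * (2 + 2 * w + w ^ 2)) :
    A * w ^ 2 ≤ 10 ∧ (64 ≤ A → A * w ^ 2 ≤ 6) := by
  have hw1 : w ≤ 1 := by
    by_contra hcon
    push Not at hcon
    nlinarith
  refine ⟨by nlinarith, fun h64 => ?_⟩
  have hw3 : w ≤ 1 / 3 := by
    by_contra hcon
    push Not at hcon
    nlinarith
  nlinarith

section SameSigns

variable {a b c : ℤ} {k r : ℕ} {s t : ℕ × ℕ}

/-- The pair lies to the right of the minimum of `a e^(ru) + c e^(-ku)`. -/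
def IsRightPair (a c : ℤ) (k r : ℕ) (s : ℕ × ℕ) : Prop :=
  k * (c * (s.2 : ℤ) ^ (k + r)) ≤ r * (a * (s.1 : ℤ) ^ (k + r))

theorem isRightPair_iff (h1 : 0 < s.1) (h2 : 0 < s.2) : IsRightPair a c k r s ↔
    k * (c * Real.exp (-(k * logRatio s))) ≤ r * (a * Real.exp (r * logRatio s)) := by
  have hP : (0 : ℝ) < midMonomial k r s := by
    unfold midMonomial
    positivity
  rw [← mul_le_mul_iff_left₀ hP, mul_assoc, mul_assoc, mul_assoc, mul_assoc,
    mul_exp_logRatio h1 h2, mul_exp_neg_logRatio h1 h2]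
  unfold IsRightPair
  exact_mod_cast Iff.rfl

theorem IsPosSolution.mul_sq_le (ha : 0 < a)
    (hc : 0 < c) (hs : IsPosSolution a b c k r s) {u η : ℝ} (hη : 0 ≤ η)
    (hsr : IsRightPair a c k r s)
    (hur : k * (c * Real.exp (-(k * u))) ≤ r * (a * Real.exp (r * u)))
    (hu : |expTrinomial a b c k r u| * midMonomial k r s ≤ η) :
    a * (s.1 : ℝ) ^ (k + r) * (r * |u - logRatio s|) ^ 2
      ≤ (η + 1) * (2 + 2 * (r * |u - logRatio s|) + (r * |u - logRatio s|) ^ 2) := by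
  have h := hs.abs_diff_le hu
  have ha' : (0 : ℝ) < a := by exact_mod_cast ha
  have hc' : (0 : ℝ) < c := by exact_mod_cast hc
  have h1 := hs.1
  have h2 := hs.2.1
  refine mul_sq_le_of_same_signs (C := c * (s.2 : ℝ) ^ (k + r)) (K := k) (by positivity)
    (by positivity) (by positivity) (by linarith) ?_ ?_ h
  · unfold IsRightPair at hsr
    exact_mod_cast hsr
  · have hP : (0 : ℝ) < midMonomial k r s := by exact_mod_cast hs.midMonomial_pos
    have h3 := mul_le_mul_of_nonneg_right hur hP.le
    rw [← mul_exp_logRatio h1 h2, ← mul_exp_neg_logRatio h1 h2]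
    have e1 : Real.exp (r * u) = Real.exp (r * logRatio s) * Real.exp (r * (u - logRatio s)) := by
      rw [← Real.exp_add]; congr 1; ring
    have e2 : Real.exp (-(k * u)) = Real.exp (-(k * logRatio s))
        * Real.exp (-(k * (u - logRatio s))) := by
      rw [← Real.exp_add]; congr 1; ring
    rw [e1, e2] at h3
    linarith

theorem IsPosSolution.lead_lower_bound (hk : 0 < k) (hr : 0 < r) (hn : 6 ≤ k + r) (ha : 0 < a)
    (hc : 0 < c) (hs : IsPosSolution a b c k r s) (hsr : IsRightPair a c k r s) :
    (10 : ℝ) ≤ a * (s.1 : ℝ) ^ (k + r) ∧ (s.2 < s.1 → (64 : ℝ) ≤ a * (s.1 : ℝ) ^ (k + r)) := by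
  have ha' : (1 : ℝ) ≤ a := by exact_mod_cast ha
  have hc' : (1 : ℝ) ≤ c := by exact_mod_cast hc
  have key : 2 ≤ s.1 → (64 : ℝ) ≤ a * (s.1 : ℝ) ^ (k + r) := by
    intro h
    have h1 : (2 : ℝ) ≤ s.1 := by exact_mod_cast h
    calc (64 : ℝ) = 1 * 2 ^ 6 := by norm_num
      _ ≤ a * (s.1 : ℝ) ^ 6 := by gcongr
      _ ≤ a * (s.1 : ℝ) ^ (k + r) := by gcongr; linarith
  refine ⟨?_, fun h => key (by have := hs.2.1; omega)⟩
  rcases le_or_gt 2 s.1 with h | h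
  · linarith [key h]
  · have hs2 : 2 ≤ s.2 := by
      have := hs.1
      have := hs.2.1
      have := hs.2.2.1
      omega
    have h1 : (2 : ℝ) ≤ s.2 := by exact_mod_cast hs2
    have h2 : (k * (c * (s.2 : ℝ) ^ (k + r))) ≤ r * (a * (s.1 : ℝ) ^ (k + r)) := by
      unfold IsRightPair at hsr
      exact_mod_cast hsr
    have h3 : (1 : ℝ) ≤ k := by exact_mod_cast hk
    have h5 : ∀ m : ℕ, 5 ≤ m → 10 * m ≤ 2 ^ (m + 1) := by
      intro m hm
      induction m, hm using Nat.le_induction with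
      | base => norm_num
      | succ m hm ih => rw [pow_succ]; omega
    have h6 : (10 : ℝ) * r ≤ 2 ^ (k + r) := by
      have : 10 * (k + r - 1) ≤ 2 ^ (k + r - 1 + 1) := h5 _ (by omega)
      rw [Nat.sub_add_cancel (by omega)] at this
      have h7 : 10 * r ≤ 2 ^ (k + r) := by omega
      exact_mod_cast h7
    have h7 : (2 : ℝ) ^ (k + r) ≤ k * (c * (s.2 : ℝ) ^ (k + r)) := by
      calc (2 : ℝ) ^ (k + r) = 1 * (1 * 2 ^ (k + r)) := by ring
        _ ≤ _ := by gcongr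
    have h8 : (0 : ℝ) < r := by exact_mod_cast hr
    have h9 : (r : ℝ) * 10 ≤ r * (a * (s.1 : ℝ) ^ (k + r)) := by linarith
    exact le_of_mul_le_mul_left h9 h8

/-- The gap principle on one side of the minimum when the outer coefficients have equal signs. -/
theorem IsPosSolution.gap_of_same_signs (hk : 0 < k) (hr : 0 < r) (hn : 6 ≤ k + r) (ha : 0 < a)
    (hc : 0 < c) (hs : IsPosSolution a b c k r s) (ht : IsPosSolution a b c k r t) (hst : s ≠ t)
    (hsr : IsRightPair a c k r s) (htr : IsRightPair a c k r t)
    (hm : midMonomial k r s ≤ midMonomial k r t) :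
    (pairHeight s : ℝ) ^ (k + r) ≤ 6 * (pairHeight s * pairHeight t) ^ 2 ∧
      |(a : ℝ)| ≤ 81 * (pairHeight t) ^ 2 ∧
      |(b : ℝ)| ≤ 81 * (pairHeight t) ^ 2 ∧
      |(c : ℝ)| ≤ 81 * (pairHeight t) ^ 2 := by
  have ha' : (1 : ℝ) ≤ a := by exact_mod_cast ha
  have hc' : (1 : ℝ) ≤ c := by exact_mod_cast hc
  have hmain := hs.mul_sq_le ha hc zero_le_one hsr ((isRightPair_iff ht.1 ht.2.1).1 htr)
    (ht.abs_expTrinomial_mul_le hm)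
  obtain ⟨hA10, hA64⟩ := hs.lead_lower_bound hk hr hn ha hc hsr
  have hM := hs.one_le_height_mul_abs hk hr ht hst
  obtain ⟨hM1, hM2⟩ := hs.one_le_cross_mul_abs hk hr ht hst
  set v := |logRatio t - logRatio s| with hv
  have hv0 : 0 ≤ v := abs_nonneg _
  have hr1 : (1 : ℝ) ≤ r := by exact_mod_cast hr
  have hk1 : (1 : ℝ) ≤ k := by exact_mod_cast hk
  set A : ℝ := a * (s.1 : ℝ) ^ (k + r) with hA
  set Γ : ℝ := c * (s.2 : ℝ) ^ (k + r) with hΓ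
  set M : ℝ := pairHeight s * pairHeight t with hMdef
  have hM0 : 0 ≤ M := by positivity
  have hright : k * Γ ≤ r * A := by
    unfold IsRightPair at hsr
    rw [hΓ, hA]
    exact_mod_cast hsr
  have hrk : (5 : ℝ) ≤ r * k := by
    have : 5 ≤ r * k := by
      obtain ⟨r', rfl⟩ := Nat.exists_eq_succ_of_ne_zero hr.ne'
      obtain ⟨k', rfl⟩ := Nat.exists_eq_succ_of_ne_zero hk.ne'
      simp only [Nat.succ_eq_add_one] at *
      nlinarith
    exact_mod_cast this
  have hΓ0 : 0 ≤ Γ := by positivity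
  have hΓA : 5 * Γ ≤ r ^ 2 * A := by
    calc 5 * Γ ≤ r * k * Γ := by gcongr
      _ = r * (k * Γ) := by ring
      _ ≤ r * (r * A) := by gcongr
      _ = r ^ 2 * A := by ring
  set w := r * v with hw
  have hw0 : 0 ≤ w := by positivity
  obtain ⟨hAw, hAw6⟩ := mul_sq_le_ten_of_quadratic hw0 hA10 hmain
  have hAv : r ^ 2 * A * v ^ 2 ≤ 10 := by
    have : r ^ 2 * A * v ^ 2 = A * w ^ 2 := by rw [hw]; ring
    linarith
  have hA0 : 0 ≤ A := by linarith
  have hs1 : (1 : ℝ) ≤ s.1 := by exact_mod_cast hs.1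
  have hs2 : (1 : ℝ) ≤ s.2 := by exact_mod_cast hs.2.1
  have ht1 : (1 : ℝ) ≤ t.1 := by exact_mod_cast ht.1
  have ht2 : (1 : ℝ) ≤ t.2 := by exact_mod_cast ht.2.1
  have hcross : ∀ N : ℝ, 1 ≤ N → 1 ≤ (N + 1) * v → r ^ 2 * A ≤ 40 * N ^ 2 := by
    intro N hN h
    have := le_mul_sq_of_mul_sq_le (N := N + 1) (by positivity) h hAv
    nlinarith
  have hb1 := hcross _ (one_le_mul_of_one_le_of_one_le hs1 ht2) hM1
  have hb2 := hcross _ (one_le_mul_of_one_le_of_one_le ht1 hs2) hM2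
  have hAr : A ≤ r ^ 2 * A := le_mul_of_one_le_left hA0 (one_le_pow₀ hr1)
  have hX1 : (s.1 : ℝ) ≤ pairHeight s := by
    exact_mod_cast le_max_left _ _
  have hX2 : (s.2 : ℝ) ≤ pairHeight s := by
    exact_mod_cast le_max_right _ _
  have hX1' : (t.1 : ℝ) ≤ pairHeight t := by
    exact_mod_cast le_max_left _ _
  have hX2' : (t.2 : ℝ) ≤ pairHeight t := by
    exact_mod_cast le_max_right _ _
  refine ⟨?_, ?_, ?_, ?_⟩
  · rcases lt_or_gt_of_ne hs.2.2.1 with hlt | hlt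
    · have h1 : pairHeight s = s.2 := max_eq_right hlt.le
      have h2 := le_mul_sq_of_mul_sq_le (by positivity) hM hAv
      have h3 : (s.2 : ℝ) ^ (k + r) ≤ Γ := le_mul_of_one_le_left (by positivity) hc'
      rw [h1]
      linarith [sq_nonneg M]
    · have h1 : pairHeight s = s.1 := max_eq_left hlt.le
      have h4 := hA64 hlt
      have hAv6 : A * v ^ 2 ≤ 6 := by
        have : v ^ 2 ≤ w ^ 2 := by
          rw [hw]
          gcongr
          exact le_mul_of_one_le_left hv0 hr1
        exact (mul_le_mul_of_nonneg_left this hA0).trans (hAw6 h4)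
      have h2 := le_mul_sq_of_mul_sq_le (by positivity) hM hAv6
      have h3 : (s.1 : ℝ) ^ (k + r) ≤ A := le_mul_of_one_le_left (by positivity) ha'
      rw [h1]
      linarith
  · rw [abs_of_pos (by linarith)]
    have := le_mul_sq_of_mul_pow_le (Y := a) (L := 40) (m := k + r) (by linarith) hs1 (by omega)
      (by linarith) hX2' (by norm_num) (by linarith)
    linarith [sq_nonneg (pairHeight t : ℝ)]
  · have h6 : |(a : ℝ) * (s.1 : ℝ) ^ (k + r) + b * (s.1 : ℝ) ^ k * (s.2 : ℝ) ^ r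
        + c * (s.2 : ℝ) ^ (k + r)| = 1 := by exact_mod_cast hs.2.2.2
    have h7 : |(b : ℝ)| * ((s.1 : ℝ) ^ k * (s.2 : ℝ) ^ r) ≤ A + Γ + 1 := by
      have h8 := abs_le.1 h6.le
      have h9 : |(b : ℝ)| * ((s.1 : ℝ) ^ k * (s.2 : ℝ) ^ r)
          = |(b : ℝ) * (s.1 : ℝ) ^ k * (s.2 : ℝ) ^ r| := by
        rw [mul_assoc, abs_mul, abs_of_nonneg (a := (s.1 : ℝ) ^ k * (s.2 : ℝ) ^ r) (by positivity)]
      rw [h9]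
      refine abs_le.2 ⟨?_, ?_⟩ <;> linarith
    have h11 : 1 ≤ ((s.1 : ℝ) * t.2) ^ 2 := one_le_pow₀ (one_le_mul_of_one_le_of_one_le hs1 ht2)
    have h12 : 1 ≤ ((t.1 : ℝ) * s.2) ^ 2 := one_le_pow₀ (one_le_mul_of_one_le_of_one_le ht1 hs2)
    exact abs_mid_coeff_le (k := k) (r := r) (by omega) hs1 hs2 (by linarith) (by linarith) hX1' hX2' (by norm_num)
      (by linarith) (by linarith)
  · rw [abs_of_pos (by linarith)]
    have := le_mul_sq_of_mul_pow_le (Y := c) (L := 40) (m := k + r) (by linarith) hs2 (by omega)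
      (by linarith) hX1' (by norm_num) (by rw [mul_comm (s.2 : ℝ) t.1]; linarith)
    linarith [sq_nonneg (pairHeight t : ℝ)]

end SameSigns

/-- A quantitative form of the weighted arithmetic-geometric mean inequality. -/
theorem one_sub_sq_mul_le_mul_pow {A Γ β w : ℝ} {k r : ℕ} (hk : 0 < k) (hr : 0 < r)
    (hβ : 0 ≤ β) (hw0 : 0 ≤ w) (hw1 : w ≤ 1) (hA : ((k + r : ℕ) : ℝ) * A = k * β * (1 + w / k))
    (hΓ : ((k + r : ℕ) : ℝ) * Γ = r * β * (1 - w / r)) :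
    (k : ℝ) ^ k * (r : ℝ) ^ r * β ^ (k + r) * (1 - w ^ 2)
      ≤ ((k + r : ℕ) : ℝ) ^ (k + r) * (A ^ k * Γ ^ r) := by
  have hk1 : (1 : ℝ) ≤ k := by exact_mod_cast hk
  have hr1 : (1 : ℝ) ≤ r := by exact_mod_cast hr
  have e : ((k + r : ℕ) : ℝ) ^ (k + r) * (A ^ k * Γ ^ r)
      = (k : ℝ) ^ k * (r : ℝ) ^ r * β ^ (k + r) * ((1 + w / k) ^ k * (1 - w / r) ^ r) := by
    rw [pow_add ((k + r : ℕ) : ℝ), mul_mul_mul_comm, ← mul_pow, ← mul_pow, hA, hΓ]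
    rw [mul_pow, mul_pow, mul_pow, mul_pow, pow_add β]
    ring
  have hwr : w / r ≤ 1 := by
    rw [div_le_one (by positivity)]
    linarith
  have h1 : 1 + w ≤ (1 + w / k) ^ k := by
    have := one_add_mul_le_pow (a := w / k) (by have : 0 ≤ w / k := by positivity
                                                linarith) k
    rwa [mul_div_cancel₀ _ (by positivity)] at this
  have h2 : 1 - w ≤ (1 - w / r) ^ r := by
    have := one_add_mul_le_pow (a := -(w / r)) (by linarith) r
    rwa [mul_neg, mul_div_cancel₀ _ (by positivity), ← sub_eq_add_neg, ← sub_eq_add_neg] at this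
  rw [e]
  gcongr
  calc 1 - w ^ 2 = (1 + w) * (1 - w) := by ring
    _ ≤ _ := by
      gcongr

theorem sq_le_mul_slope_sq {A Γ b ρ E G : ℝ} {k r : ℕ} (hk : 0 < k) (hr : 0 < r)
    (hn : 6 ≤ k + r) (hb : 0 < b) (hE : E = (k : ℝ) ^ k * (r : ℝ) ^ r * b ^ (k + r))
    (hG : ((k + r : ℕ) : ℝ) ^ (k + r) * (A ^ k * Γ ^ r) = G) (hEG : G + 1 ≤ E) (hE1 : 1 ≤ E)
    (hd : k * Γ ≤ r * A) (hβ : |A + Γ - b| ≤ ρ)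
    (hρ : ρ * (2 * (k + r : ℕ) * E) ≤ b) : b ^ 2 ≤ 4 * E * (r * A - k * Γ) ^ 2 := by
  set d := r * A - k * Γ with hdd
  set β := A + Γ with hββ
  have hk1 : (1 : ℝ) ≤ k := by exact_mod_cast hk
  have hr1 : (1 : ℝ) ≤ r := by exact_mod_cast hr
  have hn' : (6 : ℝ) ≤ (k + r : ℕ) := by exact_mod_cast hn
  have hd0 : 0 ≤ d := by linarith
  have hρ0 : 0 ≤ ρ := (abs_nonneg _).trans hβ
  have hρ12 : 12 * ρ ≤ b := by
    have h1 : (12 : ℝ) ≤ 2 * (k + r : ℕ) * E := by nlinarith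
    nlinarith
  have hβb : b - ρ ≤ β := by
    have := (abs_le.1 hβ).1
    linarith
  have hβ0 : 0 < β := by linarith
  have hβ2 : b ^ 2 ≤ 2 * β ^ 2 := by nlinarith
  rcases le_or_gt β d with h | h
  · have h1 : β ^ 2 ≤ d ^ 2 := by gcongr
    have h2 : d ^ 2 ≤ E * d ^ 2 := le_mul_of_one_le_left (sq_nonneg _) hE1
    nlinarith [sq_nonneg d]
  · set w := d / β with hw
    have hwd : w * β = d := div_mul_cancel₀ _ hβ0.ne'
    have h1 := one_sub_sq_mul_le_mul_pow (A := A) (Γ := Γ) (β := β) (w := w) hk hr hβ0.le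
      (by positivity) (by rw [hw, div_le_one hβ0]; exact h.le)
      (by push_cast; field_simp; rw [mul_add, mul_comm β w, hwd, hββ, hdd]; ring)
      (by push_cast; field_simp; rw [mul_sub, mul_comm β w, hwd, hββ, hdd]; ring)
    rw [hG] at h1
    have h2 : b ^ (k + r) * (1 - 1 / (2 * E)) ≤ β ^ (k + r) := by
      have h3 := one_add_mul_le_pow (a := -(ρ / b)) (by
        have : ρ / b ≤ 1 := by rw [div_le_one hb]; linarith
        linarith) (k + r)
      have h4 : (b * (1 + -(ρ / b))) ^ (k + r) ≤ β ^ (k + r) := by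
        have e : b * (1 + -(ρ / b)) = b - ρ := by field_simp; ring
        rw [e]
        gcongr
        linarith
      rw [mul_pow] at h4
      refine le_trans ?_ h4
      gcongr
      refine le_trans ?_ h3
      have h5 : ((k + r : ℕ) : ℝ) * (ρ / b) ≤ 1 / (2 * E) := by
        rw [le_div_iff₀ (by positivity)]
        calc ((k + r : ℕ) : ℝ) * (ρ / b) * (2 * E) = ρ * (2 * (k + r : ℕ) * E) / b := by ring
          _ ≤ 1 := by rw [div_le_one hb]; exact hρ
      linarith
    have hw2 : w ^ 2 ≤ 1 := by
      have : w ≤ 1 := by rw [hw, div_le_one hβ0]; exact h.le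
      have : 0 ≤ w := by positivity
      nlinarith
    have h6 : (E - 1 / 2) * (1 - w ^ 2) ≤ G := by
      refine le_trans ?_ h1
      have h7 : E - 1 / 2 ≤ (k : ℝ) ^ k * (r : ℝ) ^ r * β ^ (k + r) := by
        calc E - 1 / 2 = E * (1 - 1 / (2 * E)) := by field_simp
          _ = (k : ℝ) ^ k * (r : ℝ) ^ r * (b ^ (k + r) * (1 - 1 / (2 * E))) := by
            nth_rewrite 1 [hE]
            ring
          _ ≤ _ := by gcongr
      exact mul_le_mul_of_nonneg_right h7 (by linarith)
    have h8 : 1 ≤ 2 * E * w ^ 2 := by nlinarith [sq_nonneg w]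
    have h9 : β ^ 2 ≤ 2 * E * d ^ 2 := by
      calc β ^ 2 ≤ (2 * E * w ^ 2) * β ^ 2 := le_mul_of_one_le_left (sq_nonneg _) h8
        _ = 2 * E * d ^ 2 := by rw [← hwd]; ring
    linarith

theorem slope_mul_le_expTrinomial_sub {a b c : ℝ} (ha : 0 ≤ a) (hc : 0 ≤ c) (k r : ℕ) (u v : ℝ) :
    (r * (a * Real.exp (r * u)) - k * (c * Real.exp (-(k * u)))) * v
      ≤ expTrinomial a b c k r (u + v) - expTrinomial a b c k r u := by
  rw [expTrinomial_add_sub]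
  have h1 := mul_le_mul_of_nonneg_left (Real.add_one_le_exp (r * v))
    (by positivity : 0 ≤ a * Real.exp (r * u))
  have h2 := mul_le_mul_of_nonneg_left (Real.add_one_le_exp (-(k * v)))
    (by positivity : 0 ≤ c * Real.exp (-(k * u)))
  linarith

/-- On the right of the minimum, near-zeros of a trinomial with positive discriminant are close. -/
theorem mul_abs_sub_le_of_right {a c b ρ E G : ℝ} {k r : ℕ} (hk : 0 < k) (hr : 0 < r)
    (hn : 6 ≤ k + r) (ha : 0 < a) (hc : 0 < c) (hb : 0 < b)
    (hE : E = (k : ℝ) ^ k * (r : ℝ) ^ r * b ^ (k + r))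
    (hG : ((k + r : ℕ) : ℝ) ^ (k + r) * (a ^ k * c ^ r) = G) (hEG : G + 1 ≤ E)
    (hρ : ρ * (2 * (k + r : ℕ) * E) ≤ b) {u w : ℝ}
    (hu : k * (c * Real.exp (-(k * u))) ≤ r * (a * Real.exp (r * u)))
    (hw : k * (c * Real.exp (-(k * w))) ≤ r * (a * Real.exp (r * w)))
    (hφu : |expTrinomial a (-b) c k r u| ≤ ρ) (hφw : |expTrinomial a (-b) c k r w| ≤ ρ) :
    b * |u - w| ≤ 2 * √E * |expTrinomial a (-b) c k r u - expTrinomial a (-b) c k r w| := by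
  wlog hle : w ≤ u generalizing u w
  · rw [abs_sub_comm, abs_sub_comm (expTrinomial _ _ _ _ _ u)]
    exact this hw hu hφw hφu (by linarith)
  have hG0 : 0 ≤ G := by rw [← hG]; positivity
  have hAG : ((k + r : ℕ) : ℝ) ^ (k + r) * ((a * Real.exp (r * w)) ^ k
      * (c * Real.exp (-(k * w))) ^ r) = G := by
    rw [← hG, mul_pow, mul_pow, ← Real.exp_nat_mul, ← Real.exp_nat_mul]
    have : Real.exp (k * (r * w)) * Real.exp (r * -(k * w)) = 1 := by
      rw [← Real.exp_add, Real.exp_eq_one_iff]; ring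
    linear_combination (((k + r : ℕ) : ℝ) ^ (k + r) * (a ^ k * c ^ r)) * this
  have h1 := sq_le_mul_slope_sq hk hr hn hb hE hAG hEG (by linarith) hw (ρ := ρ) (by
    unfold expTrinomial at hφw
    rwa [show a * Real.exp (r * w) + c * Real.exp (-(k * w)) - b
      = a * Real.exp (r * w) + -b + c * Real.exp (-(k * w)) by ring]) hρ
  have h2 := slope_mul_le_expTrinomial_sub (b := -b) ha.le hc.le k r w (u - w)
  rw [add_sub_cancel] at h2
  set d := r * (a * Real.exp (r * w)) - k * (c * Real.exp (-(k * w))) with hd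
  have hE0 : 0 ≤ E := by linarith
  have h3 : b ≤ 2 * √E * d := by
    refine le_of_sq_le_sq ?_ (by
      have : 0 ≤ d := by linarith
      positivity)
    rw [mul_pow, mul_pow, Real.sq_sqrt hE0]
    linarith
  rw [abs_of_nonneg (by linarith : 0 ≤ u - w)]
  calc b * (u - w) ≤ 2 * √E * d * (u - w) := by
        gcongr
    _ = 2 * √E * (d * (u - w)) := by ring
    _ ≤ _ := by
      gcongr
      exact h2.trans (le_abs_self _)

section SameSigns

variable {a b c : ℤ} {k r : ℕ} {s t : ℕ × ℕ}

theorem IsPosSolution.height_pow_le_mul_midMonomial (ha : 0 < a) (hc : 0 < c)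
    (hs : IsPosSolution a b c k r s) :
    (pairHeight s : ℝ) ^ (k + r) ≤ -b * midMonomial k r s := by
  obtain ⟨h1, h2, -, h4⟩ := hs
  have h5 : a * (s.1 : ℤ) ^ (k + r) + b * (s.1 : ℤ) ^ k * (s.2 : ℤ) ^ r
      + c * (s.2 : ℤ) ^ (k + r) ≤ 1 := h4 ▸ le_abs_self _
  have h6 : (1 : ℤ) ≤ (s.1 : ℤ) ^ (k + r) := one_le_pow₀ (by exact_mod_cast h1)
  have h7 : (1 : ℤ) ≤ (s.2 : ℤ) ^ (k + r) := one_le_pow₀ (by exact_mod_cast h2)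
  have h8 : (s.1 : ℤ) ^ (k + r) ≤ a * (s.1 : ℤ) ^ (k + r) := le_mul_of_one_le_left (by omega) ha
  have h9 : (s.2 : ℤ) ^ (k + r) ≤ c * (s.2 : ℤ) ^ (k + r) := le_mul_of_one_le_left (by omega) hc
  have h10 : (pairHeight s : ℤ) ^ (k + r) ≤ -b * midMonomial k r s := by
    unfold pairHeight midMonomial
    push_cast
    rcases le_total s.1 s.2 with h | h
    · rw [max_eq_right (by exact_mod_cast h)]
      linarith
    · rw [max_eq_left (by exact_mod_cast h)]
      linarith
  exact_mod_cast h10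

/-- The bound for the constant in the approximation of a root by solutions. -/
noncomputable def gapConst (n : ℕ) (b : ℝ) : ℝ := 4 * √((n * b) ^ n)

theorem IsPosSolution.height_pow_mul_abs_le (hk : 0 < k) (hr : 0 < r) (hn : 6 ≤ k + r)
    (ha : 0 < a) (hc : 0 < c) (hb : b < 0)
    (hdisc : ((k + r : ℕ) : ℤ) ^ (k + r) * (a ^ k * c ^ r)
      < (k : ℤ) ^ k * (r : ℤ) ^ r * (-b) ^ (k + r))
    (hs : IsPosSolution a b c k r s) (hsr : IsRightPair a c k r s)
    (hX : 2 * (k + r : ℕ) * (-b : ℝ) ≤ pairHeight s) {u : ℝ}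
    (hu : k * (c * Real.exp (-(k * u))) ≤ r * (a * Real.exp (r * u)))
    (hφu : |expTrinomial a b c k r u| * midMonomial k r s ≤ 1) :
    (pairHeight s : ℝ) ^ (k + r) * |u - logRatio s| ≤ gapConst (k + r) (-b) := by
  set n := k + r with hndef
  obtain ⟨B, rfl⟩ : ∃ B, b = -B := ⟨-b, by ring⟩
  rw [Int.cast_neg, neg_neg] at hX ⊢
  rw [Int.cast_neg] at hφu
  have hB : (1 : ℝ) ≤ B := by
    have : 1 ≤ B := by omega
    exact_mod_cast this
  rw [neg_neg] at hdisc
  set E : ℝ := (k : ℝ) ^ k * (r : ℝ) ^ r * (B : ℝ) ^ n with hE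
  have hEn : E ≤ (n * (B : ℝ)) ^ n := by
    rw [hE, mul_pow]
    have h1 : (k : ℝ) ≤ n := by exact_mod_cast (by omega : k ≤ n)
    have h2 : (r : ℝ) ≤ n := by exact_mod_cast (by omega : r ≤ n)
    gcongr
    rw [hndef, pow_add]
    gcongr
  have hXn := hs.height_pow_le_mul_midMonomial ha hc
  rw [Int.cast_neg, neg_neg] at hXn
  have hP : (0 : ℝ) < midMonomial k r s := by exact_mod_cast hs.midMonomial_pos
  have hρ : 1 / (midMonomial k r s : ℝ) * (2 * (n : ℝ) * E) ≤ B := by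
    rw [div_mul_eq_mul_div, one_mul, div_le_iff₀ hP]
    refine le_trans ?_ hXn
    calc 2 * (n : ℝ) * E ≤ 2 ^ n * (n * (B : ℝ)) ^ n := by
          have h2n : 2 * n ≤ 2 ^ n := by
            have : ∀ m : ℕ, 6 ≤ m → 2 * m ≤ 2 ^ m := by
              intro m hm
              induction m, hm using Nat.le_induction with
              | base => norm_num
              | succ m hm ih => rw [pow_succ]; omega
            exact this n hn
          have : (2 : ℝ) * n ≤ 2 ^ n := by exact_mod_cast h2n
          gcongr
      _ = (2 * n * (B : ℝ)) ^ n := by rw [← mul_pow, mul_assoc]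
      _ ≤ _ := by gcongr
  have h1 := hs.abs_expTrinomial_mul
  rw [Int.cast_neg] at h1
  have h2 := mul_abs_sub_le_of_right (a := a) (c := c) (b := B)
    (ρ := 1 / (midMonomial k r s : ℝ)) (E := E)
    hk hr hn (by exact_mod_cast ha) (by exact_mod_cast hc) (by linarith) hE rfl
    (by rw [hE]; exact_mod_cast hdisc) hρ hu ((isRightPair_iff hs.1 hs.2.1).1 hsr)
    (by rwa [le_div_iff₀ hP]) (by rw [le_div_iff₀ hP]; exact h1.le)
  calc (pairHeight s : ℝ) ^ n * |u - logRatio s|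
      ≤ B * midMonomial k r s * |u - logRatio s| := by gcongr
    _ = midMonomial k r s * (B * |u - logRatio s|) := by ring
    _ ≤ midMonomial k r s * (2 * √E * |expTrinomial a (-B) c k r u
        - expTrinomial a (-B) c k r (logRatio s)|) := by gcongr
    _ ≤ midMonomial k r s * (2 * √E * (|expTrinomial a (-B) c k r u|
        + |expTrinomial a (-B) c k r (logRatio s)|)) := by gcongr; exact abs_sub _ _
    _ = 2 * √E * (|expTrinomial a (-B) c k r u| * midMonomial k r s
        + |expTrinomial a (-B) c k r (logRatio s)| * midMonomial k r s) := by ring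
    _ ≤ 2 * √E * (1 + 1) := by gcongr; exact h1.le
    _ = 4 * √E := by ring
    _ ≤ _ := by
      unfold gapConst
      gcongr

end SameSigns

/-- Heights on a logarithmic scale: `l`, `g`, `L`, `h` stand for the logarithms of `2`, of the
degree, of the middle coefficient and of the height of the form, and `y` for that of the constant
in the gap principle. -/
structure LogGrowth (n Z : ℕ) (l g L h y : ℝ) (x : ℕ → ℝ) : Prop where
  l_pos : 0 < l
  L_nonneg : 0 ≤ L
  L_le : L ≤ h
  h_le : h ≤ 4 * (8 / 5 * l) + 2 * x 1
  mono : ∀ i < Z, x i ≤ x (i + 1)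
  le_zero : l ≤ x 0
  weak : ∀ i < Z, n * x i ≤ (1 + 8 / 5) * l + 2 * x i + 2 * x (i + 1)
  y_eq : y = 2 * l + n / 2 * (g + L)
  strong : ∀ i < Z, l + g + L ≤ x i → (n - 1) * x i ≤ y + x (i + 1)

theorem LogGrowth.strong_of_le {n Z : ℕ} {l g L h y : ℝ} {x : ℕ → ℝ}
    (H : LogGrowth n Z l g L h y x) {j : ℕ} (hj : l + g + L ≤ x j) :
    ∀ i, j ≤ i → i < Z → (n - 1) * x i ≤ y + x (i + 1) ∧ l + g + L ≤ x i := by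
  intro i hji
  have : i ≤ Z → l + g + L ≤ x i := by
    induction i, hji using Nat.le_induction with
    | base => exact fun _ => hj
    | succ i hi ih => exact fun h => (ih (by omega)).trans (H.mono i (by omega))
  exact fun h => ⟨H.strong i h (this h.le), this h.le⟩

/-- The growth is fast enough for two solutions to violate the approximation theorem. -/
def LogGrowthConclusion (n Z K : ℕ) (l g L h y : ℝ) (x : ℕ → ℝ) : Prop :=
  l + g + L ≤ x (Z - 1) ∧ l + 40 * (l + y) ≤ x (Z - 1) ∧ l + K * n * (3 * l + h) ≤ x (Z - 1) ∧
    l + (n - 2) * x (Z - 1) ≤ x Z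

theorem LogGrowth.conclusion_six {l g L h y : ℝ} {x : ℕ → ℝ} (H : LogGrowth 6 15 l g L h y x)
    (hg : g ≤ 6 * l) (h3 : 2 * l ≤ x 3) :
    LogGrowthConclusion 6 15 250 l g L h y x := by
  obtain ⟨a1, a2, a3, a4, mono, a5, weak, a6, -⟩ := id H
  have m0 := mono 0
  have w0 := weak 0
  have w1 := weak 1
  have w2 := weak 2
  have w3 := weak 3
  have w4 := weak 4
  have w5 := weak 5
  have w6 := weak 6
  have w7 := weak 7
  have w8 := weak 8
  norm_num at m0 w0 w1 w2 w3 w4 w5 w6 w7 w8 a6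
  have r := H.strong_of_le (j := 9) (by linarith)
  have r9 := r 9
  have r10 := r 10
  have r11 := r 11
  have r12 := r 12
  have r13 := r 13
  have r14 := r 14
  norm_num at r9 r10 r11 r12 r13 r14
  unfold LogGrowthConclusion
  norm_num
  refine ⟨?_, ?_, ?_, ?_⟩ <;> linarith

theorem LogGrowth.conclusion_seven {l g L h y : ℝ} {x : ℕ → ℝ} (H : LogGrowth 7 12 l g L h y x)
    (hg : g ≤ 6 * l) (h3 : 14 / 5 * l ≤ x 2) :
    LogGrowthConclusion 7 12 250 l g L h y x := by
  obtain ⟨a1, a2, a3, a4, mono, a5, weak, a6, -⟩ := id H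
  have w0 := weak 0
  have w1 := weak 1
  have w2 := weak 2
  have w3 := weak 3
  have w4 := weak 4
  have w5 := weak 5
  norm_num at w0 w1 w2 w3 w4 w5 a6
  have r := H.strong_of_le (j := 6) (by linarith)
  have r6 := r 6
  have r7 := r 7
  have r8 := r 8
  have r9 := r 9
  have r10 := r 10
  have r11 := r 11
  norm_num at r6 r7 r8 r9 r10 r11
  unfold LogGrowthConclusion
  norm_num
  refine ⟨?_, ?_, ?_, ?_⟩ <;> linarith

theorem LogGrowth.conclusion_eight {l g L h y : ℝ} {x : ℕ → ℝ} (H : LogGrowth 8 11 l g L h y x)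
    (hg : g ≤ 6 * l) : LogGrowthConclusion 8 11 250 l g L h y x := by
  obtain ⟨a1, a2, a3, a4, mono, a5, weak, a6, -⟩ := id H
  have w0 := weak 0
  have w1 := weak 1
  have w2 := weak 2
  have w3 := weak 3
  have w4 := weak 4
  have w5 := weak 5
  norm_num at w0 w1 w2 w3 w4 w5 a6
  have r := H.strong_of_le (j := 6) (by linarith)
  have r6 := r 6
  have r7 := r 7
  have r8 := r 8
  have r9 := r 9
  have r10 := r 10
  norm_num at r6 r7 r8 r9 r10
  unfold LogGrowthConclusion
  norm_num
  refine ⟨?_, ?_, ?_, ?_⟩ <;> linarith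

theorem LogGrowth.conclusion_nine {l g L h y : ℝ} {x : ℕ → ℝ} (H : LogGrowth 9 9 l g L h y x)
    (hg : g ≤ 6 * l) : LogGrowthConclusion 9 9 250 l g L h y x := by
  obtain ⟨a1, a2, a3, a4, mono, a5, weak, a6, -⟩ := id H
  have w0 := weak 0
  have w1 := weak 1
  have w2 := weak 2
  have w3 := weak 3
  norm_num at w0 w1 w2 w3 a6
  have r := H.strong_of_le (j := 4) (by linarith)
  have r4 := r 4
  have r5 := r 5
  have r6 := r 6
  have r7 := r 7
  have r8 := r 8
  norm_num at r4 r5 r6 r7 r8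
  unfold LogGrowthConclusion
  norm_num
  refine ⟨?_, ?_, ?_, ?_⟩ <;> linarith

theorem LogGrowth.conclusion_of_le_eleven {n : ℕ} {l g L h y : ℝ} {x : ℕ → ℝ}
    (H : LogGrowth n 8 l g L h y x) (hn : 10 ≤ n) (hn' : n ≤ 11)
    (hg : g ≤ 6 * l) : LogGrowthConclusion n 8 250 l g L h y x := by
  obtain ⟨a1, a2, a3, a4, mono, a5, weak, a6, -⟩ := id H
  have w0 := weak 0
  have w1 := weak 1
  have w2 := weak 2
  have w3 := weak 3
  interval_cases n <;>
  · norm_num at w0 w1 w2 w3 a6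
    have r := H.strong_of_le (j := 4) (by linarith)
    have r4 := r 4
    have r5 := r 5
    have r6 := r 6
    have r7 := r 7
    norm_num at r4 r5 r6 r7
    unfold LogGrowthConclusion
    norm_num
    refine ⟨?_, ?_, ?_, ?_⟩ <;> linarith

theorem LogGrowth.conclusion_of_le_sixteen {n : ℕ} {l g L h y : ℝ} {x : ℕ → ℝ}
    (H : LogGrowth n 7 l g L h y x) (hn : 12 ≤ n) (hn' : n ≤ 16)
    (hg : g ≤ 6 * l) : LogGrowthConclusion n 7 250 l g L h y x := by
  obtain ⟨a1, a2, a3, a4, mono, a5, weak, a6, -⟩ := id H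
  have w0 := weak 0
  have w1 := weak 1
  have w2 := weak 2
  interval_cases n <;>
  · norm_num at w0 w1 w2 a6
    have r := H.strong_of_le (j := 3) (by linarith)
    have r3 := r 3
    have r4 := r 4
    have r5 := r 5
    have r6 := r 6
    norm_num at r3 r4 r5 r6
    unfold LogGrowthConclusion
    norm_num
    refine ⟨?_, ?_, ?_, ?_⟩ <;> linarith

set_option maxHeartbeats 1600000 in
theorem LogGrowth.conclusion_of_le_thirty_eight {n : ℕ} {l g L h y : ℝ} {x : ℕ → ℝ}
    (H : LogGrowth n 6 l g L h y x) (hn : 17 ≤ n) (hn' : n ≤ 38)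
    (hg : g ≤ 6 * l) : LogGrowthConclusion n 6 250 l g L h y x := by
  obtain ⟨a1, a2, a3, a4, mono, a5, weak, a6, -⟩ := id H
  have w0 := weak 0
  have w1 := weak 1
  interval_cases n <;>
  · norm_num at w0 w1 a6
    have r := H.strong_of_le (j := 2) (by linarith)
    have r2 := r 2
    have r3 := r 3
    have r4 := r 4
    have r5 := r 5
    norm_num at r2 r3 r4 r5
    unfold LogGrowthConclusion
    norm_num
    refine ⟨?_, ?_, ?_, ?_⟩ <;> linarith

theorem LogGrowth.large_bounds {n Z : ℕ} {l g L h y : ℝ} {x : ℕ → ℝ}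
    (H : LogGrowth n Z l g L h y x) (hn : 39 ≤ n) (hZ : 4 ≤ Z) :
    17 * l ≤ x 1 ∧ (n : ℝ) * l ≤ 23 / 10 * x 1 ∧ 49 / 100 * (n * x 1) ≤ x 2 + 101 / 100 * x 1 ∧
      y = 2 * l + 1 / 2 * (n * g) + 1 / 2 * (n * L) ∧ L ≤ h ∧ h ≤ 32 / 5 * l + 2 * x 1 := by
  obtain ⟨a1, a2, a3, a4, mono, a5, weak, a6, -⟩ := id H
  have w0 := weak 0 (by omega)
  have w1 := weak 1 (by omega)
  norm_num at w0 w1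
  have hn' : (39 : ℝ) ≤ n := by exact_mod_cast hn
  have h1 : (n : ℝ) * l ≤ 2 * x 1 + 23 / 5 * l := by nlinarith
  have h2 : 17 * l ≤ x 1 := by nlinarith
  refine ⟨h2, by linarith, by nlinarith, by rw [a6]; ring, a3, by linarith⟩

theorem LogGrowth.conclusion_of_le_two_hundred {n : ℕ} {l g L h y : ℝ} {x : ℕ → ℝ}
    (H : LogGrowth n 5 l g L h y x) (hn : 39 ≤ n) (hg : g ≤ 8 * l) :
    LogGrowthConclusion n 5 40 l g L h y x := by
  obtain ⟨b1, b2, b3, b4, b5, b6⟩ := H.large_bounds hn (by norm_num)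
  have a1 := H.l_pos
  have hn' : (39 : ℝ) ≤ n := by exact_mod_cast hn
  have hn0 : (0 : ℝ) ≤ n := by positivity
  have e1 : (n : ℝ) * g ≤ 8 * (n * l) := by nlinarith
  have e2 : (n : ℝ) * h ≤ 32 / 5 * (n * l) + 2 * (n * x 1) := by nlinarith
  have e3 : (n : ℝ) * L ≤ n * h := by gcongr
  have e4 : 39 * x 1 ≤ n * x 1 := by nlinarith
  have e5 : 17 * (n * l) ≤ n * x 1 := by nlinarith
  have hy : y ≤ 3 / 2 * (n * x 1) := by linarith
  have r := H.strong_of_le (j := 2) (by linarith)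
  obtain ⟨r2, -⟩ := r 2 le_rfl (by norm_num)
  obtain ⟨r3, -⟩ := r 3 (by norm_num) (by norm_num)
  obtain ⟨r4, r4'⟩ := r 4 (by norm_num) (by norm_num)
  norm_num at r2 r3 r4
  have f2 : 46 / 100 * (n * x 1) ≤ x 2 := by linarith
  have f3 : 15 * (n * x 1) ≤ x 3 := by nlinarith
  have f4 : 500 * (n * x 1) ≤ x 4 := by nlinarith
  refine ⟨r4', ?_, ?_, ?_⟩
  · norm_num
    linarith
  · norm_num
    linarith
  · norm_num
    linarith

theorem LogGrowth.conclusion_of_gt_two_hundred {n : ℕ} {l g L h y : ℝ} {x : ℕ → ℝ}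
    (H : LogGrowth n 4 l g L h y x) (hn : 219 ≤ n) (hg : g ≤ 423 / 10000 * (n * l)) :
    LogGrowthConclusion n 4 40 l g L h y x := by
  obtain ⟨b1, -, b3, b4, b5, b6⟩ := H.large_bounds (by omega) le_rfl
  have a1 := H.l_pos
  have a5 := H.le_zero
  have w0 := H.weak 0 (by norm_num)
  have w1 := H.weak 1 (by norm_num)
  norm_num at w0 w1
  have hn' : (219 : ℝ) ≤ n := by exact_mod_cast hn
  have hn0 : (0 : ℝ) ≤ n := by positivity
  have h1 : (n : ℝ) * l ≤ 2 * x 1 + 23 / 5 * l := by nlinarith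
  have h2 : 105 * l ≤ x 1 := by nlinarith
  have hg' : g ≤ 89 / 1000 * x 1 := by linarith
  have e1 : (n : ℝ) * g ≤ 89 / 1000 * (n * x 1) := by nlinarith
  have e2 : (n : ℝ) * h ≤ 32 / 5 * (n * l) + 2 * (n * x 1) := by nlinarith
  have e3 : (n : ℝ) * L ≤ n * h := by gcongr
  have e4 : 219 * x 1 ≤ n * x 1 := by nlinarith
  have e5 : 105 * (n * l) ≤ n * x 1 := by nlinarith
  have hy : y ≤ 108 / 100 * (n * x 1) := by linarith
  have f2 : 495 / 1000 * (n * x 1) ≤ x 2 := by linarith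
  have r := H.strong_of_le (j := 2) (by linarith)
  obtain ⟨r2, -⟩ := r 2 le_rfl (by norm_num)
  obtain ⟨r3, r3'⟩ := r 3 (by norm_num) (by norm_num)
  norm_num at r2 r3
  have f3 : 106 * (n * x 1) ≤ x 3 := by nlinarith
  refine ⟨r3', ?_, ?_, ?_⟩
  · norm_num
    linarith
  · norm_num
    linarith
  · norm_num
    linarith

theorem exists_monotone_sequence {ι : Type*} (S : Finset ι) (P : ι → ℕ) (m : ℕ)
    (hm : m < S.card) : ∃ s : ℕ → ι, (∀ i ≤ m, s i ∈ S) ∧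
      ∀ i j, i < j → j ≤ m → s i ≠ s j ∧ P (s i) ≤ P (s j) := by
  set e := S.equivFin.symm
  set g : Fin S.card → ℕ := fun i => P (e i) with hg
  have hmono := Tuple.monotone_sort g
  refine ⟨fun i => if h : i < S.card then e (Tuple.sort g ⟨i, h⟩)
    else e (Tuple.sort g ⟨m, hm⟩), ?_, ?_⟩
  · intro i _
    dsimp only
    split_ifs <;> exact Subtype.property _
  · intro i j hij hj
    have hi' : i < S.card := by omega
    have hj' : j < S.card := by omega
    simp only [hi', hj', dif_pos]
    constructor
    · intro h
      have h1 := (Tuple.sort g).injective (e.injective (Subtype.ext h))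
      rw [Fin.mk.injEq] at h1
      omega
    · exact hmono (show (⟨i, hi'⟩ : Fin S.card) ≤ ⟨j, hj'⟩ from hij.le)

theorem le_of_pow_le_six_mul_sq {X Y n : ℕ} (hn : 6 ≤ n) (hX : 2 ≤ X) (hY : 2 ≤ Y)
    (h : (X : ℝ) ^ n ≤ 6 * (X * Y) ^ 2) : X ≤ Y ∧ X ^ (n - 2) ≤ 6 * Y ^ 2 := by
  have h1 : X ^ n ≤ 6 * (X * Y) ^ 2 := by exact_mod_cast h
  have h2 : X ^ (n - 2) ≤ 6 * Y ^ 2 := by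
    have e : X ^ n = X ^ 2 * X ^ (n - 2) := by rw [← pow_add]; congr 1; omega
    rw [e, show 6 * (X * Y) ^ 2 = X ^ 2 * (6 * Y ^ 2) by ring] at h1
    exact Nat.le_of_mul_le_mul_left h1 (by positivity)
  refine ⟨?_, h2⟩
  by_contra hlt
  push Not at hlt
  have h3 : X ^ 4 ≤ X ^ (n - 2) := Nat.pow_le_pow_right (by omega) (by omega)
  have h4 : 3 ≤ X := by omega
  have h5 : X ^ 4 ≤ 6 * Y ^ 2 := h3.trans h2
  have h6 : Y ^ 2 < X ^ 2 := Nat.pow_lt_pow_left hlt (by norm_num)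
  have h7 : X ^ 4 = X ^ 2 * X ^ 2 := by ring
  have h8 : 9 ≤ X ^ 2 := by nlinarith
  nlinarith

theorem log_le_mul_log_two {x : ℝ} (hx : 0 < x) (p q : ℕ) (hq : 0 < q) (h : x ^ q ≤ 2 ^ p) :
    Real.log x ≤ p / q * Real.log 2 := by
  have := Real.log_le_log (by positivity) h
  rw [Real.log_pow, Real.log_pow] at this
  rw [div_mul_eq_mul_div, le_div_iff₀ (by positivity)]
  linarith

theorem mul_log_two_le_log {x : ℝ} (p q : ℕ) (hq : 0 < q) (h : 2 ^ p ≤ x ^ q) :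
    p / q * Real.log 2 ≤ Real.log x := by
  have := Real.log_le_log (by positivity) h
  rw [Real.log_pow, Real.log_pow] at this
  rw [div_mul_eq_mul_div, div_le_iff₀ (by positivity)]
  linarith

theorem log_natCast_le_of_large {n : ℕ} (hn : 219 ≤ n) :
    Real.log n ≤ 423 / 10000 * (n * Real.log 2) := by
  have hn' : (219 : ℝ) ≤ n := by exact_mod_cast hn
  have h1 := Real.log_two_gt_d9
  have h2 := Real.log_two_lt_d9
  have h3 : Real.log ((n : ℝ) / 256) ≤ n / 256 - 1 := Real.log_le_sub_one_of_pos (by positivity)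
  rw [Real.log_div (by positivity) (by norm_num), show (256 : ℝ) = 2 ^ 8 by norm_num,
    Real.log_pow] at h3
  norm_num at h3
  nlinarith

theorem LogGrowth.conclusion {n : ℕ} {L h y : ℝ} {x : ℕ → ℝ} (hn : 6 ≤ n)
    (H : LogGrowth n (z n) (Real.log 2) (Real.log n) L h y x)
    (h6 : n = 6 → 2 * Real.log 2 ≤ x 3) (h7 : n = 7 → 14 / 5 * Real.log 2 ≤ x 2) :
    ∃ K : ℕ, (K = 250 ∨ K = 40 ∧ 39 ≤ n) ∧
      LogGrowthConclusion n (z n) K (Real.log 2) (Real.log n) L h y x := by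
  have hn0 : (0 : ℝ) < n := by
    have : 0 < n := by omega
    exact_mod_cast this
  have hlog : ∀ m : ℕ, n ≤ 2 ^ m → Real.log n ≤ m * Real.log 2 := by
    intro m hm
    have := log_le_mul_log_two hn0 m 1 one_pos (by rw [pow_one]; exact_mod_cast hm)
    simpa using this
  rcases le_or_gt n 38 with h38 | h38
  · refine ⟨250, Or.inl rfl, ?_⟩
    have hg := hlog 6 (by norm_num; omega)
    norm_num at hg
    rcases le_or_gt n 16 with h16 | h16
    · rcases le_or_gt n 11 with h11 | h11
      · rcases le_or_gt n 9 with h9 | h9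
        · interval_cases n
          · exact LogGrowth.conclusion_six H hg (h6 rfl)
          · exact LogGrowth.conclusion_seven H hg (h7 rfl)
          · exact LogGrowth.conclusion_eight H hg
          · exact LogGrowth.conclusion_nine H hg
        · have hz : z n = 8 := by unfold z; split_ifs <;> omega
          rw [hz] at H ⊢
          exact H.conclusion_of_le_eleven (by omega) (by omega) hg
      · have hz : z n = 7 := by unfold z; split_ifs <;> omega
        rw [hz] at H ⊢
        exact H.conclusion_of_le_sixteen (by omega) (by omega) hg
    · have hz : z n = 6 := by unfold z; split_ifs <;> omega
      rw [hz] at H ⊢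
      exact H.conclusion_of_le_thirty_eight (by omega) (by omega) hg
  · refine ⟨40, Or.inr ⟨rfl, h38⟩, ?_⟩
    rcases le_or_gt n 218 with h218 | h218
    · have hz : z n = 5 := by unfold z; split_ifs <;> omega
      rw [hz] at H ⊢
      have hg := hlog 8 (by norm_num; omega)
      norm_num at hg
      exact H.conclusion_of_le_two_hundred (by omega) hg
    · have hz : z n = 4 := by unfold z; split_ifs <;> omega
      rw [hz] at H ⊢
      exact H.conclusion_of_gt_two_hundred (by omega) (log_natCast_le_of_large h218)

theorem four_le_z (n : ℕ) : 4 ≤ z n := by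
  unfold z
  split_ifs <;> omega

theorem one_le_gapConst {n : ℕ} {b : ℝ} (hn : 1 ≤ n) (hb : 1 ≤ b) : 1 ≤ gapConst n b := by
  unfold gapConst
  have h1 : (1 : ℝ) ≤ n := by exact_mod_cast hn
  have h2 : 1 ≤ (n * b) ^ n := one_le_pow₀ (one_le_mul_of_one_le_of_one_le h1 hb)
  have h3 := Real.one_le_sqrt.2 h2
  linarith

theorem log_gapConst {n : ℕ} {b : ℝ} (hn : 1 ≤ n) (hb : 1 ≤ b) :
    Real.log (gapConst n b) = 2 * Real.log 2 + n / 2 * (Real.log n + Real.log b) := by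
  have h1 : (1 : ℝ) ≤ n := by exact_mod_cast hn
  have h2 : (0 : ℝ) < n := by linarith
  have h3 : 0 < b := by linarith
  unfold gapConst
  rw [Real.log_mul (by norm_num) (by positivity), Real.log_sqrt (by positivity), Real.log_pow,
    Real.log_mul (by positivity) (by positivity), show (4 : ℝ) = 2 ^ 2 by norm_num, Real.log_pow]
  push_cast
  ring

/-- The gap conditions between two solutions attached to the same root. -/
structure GapPair (n : ℕ) (a b c : ℤ) (s t : ℕ × ℕ) : Prop where
  weak : (pairHeight s : ℝ) ^ n ≤ 6 * (pairHeight s * pairHeight t) ^ 2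
  left_le : |(a : ℝ)| ≤ 81 * (pairHeight t : ℝ) ^ 2
  mid_le : |(b : ℝ)| ≤ 81 * (pairHeight t : ℝ) ^ 2
  right_le : |(c : ℝ)| ≤ 81 * (pairHeight t : ℝ) ^ 2
  strong : 2 * n * |(b : ℝ)| ≤ pairHeight s →
    (pairHeight s : ℝ) ^ n ≤ gapConst n |(b : ℝ)| * (pairHeight s * pairHeight t)

theorem height_lower_bounds {n : ℕ} {s : ℕ → ℕ × ℕ} {Z : ℕ} (hn : 6 ≤ n) (hZ : 4 ≤ Z)
    (h2 : ∀ i ≤ Z, 2 ≤ pairHeight (s i)) (hpos : ∀ i ≤ Z, 0 < (s i).1 ∧ 0 < (s i).2 ∧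
      (s i).1 ≠ (s i).2)
    (hmono : ∀ i < Z, pairHeight (s i) ≤ pairHeight (s (i + 1)))
    (hne : ∀ i j, i < j → j ≤ Z → s i ≠ s j)
    (hweak : ∀ i < Z, pairHeight (s i) ^ (n - 2) ≤ 6 * pairHeight (s (i + 1)) ^ 2) :
    4 ≤ pairHeight (s 3) ∧ (n = 7 → 7 ≤ pairHeight (s 2)) := by
  have hpw : ∀ i < Z, ∀ m x : ℕ, 0 < x → m ≤ n - 2 → x ≤ pairHeight (s i) →
      x ^ m ≤ 6 * pairHeight (s (i + 1)) ^ 2 := by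
    intro i hi m x hx hm hxi
    calc x ^ m ≤ x ^ (n - 2) := Nat.pow_le_pow_right hx hm
      _ ≤ pairHeight (s i) ^ (n - 2) := Nat.pow_le_pow_left hxi _
      _ ≤ _ := hweak i hi
  have h23 : 3 ≤ pairHeight (s 2) := by
    by_contra hlt
    have m0 := hmono 0 (by omega)
    have m1 := hmono 1 (by omega)
    rw [zero_add] at m0
    norm_num at m1
    have p0 := hpos 0 (by omega)
    have p1 := hpos 1 (by omega)
    have p2 := hpos 2 (by omega)
    have e01 := hne 0 1 (by omega) (by omega)
    have e02 := hne 0 2 (by omega) (by omega)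
    have e12 := hne 1 2 (by omega) (by omega)
    rw [Ne, Prod.ext_iff] at e01 e02 e12
    unfold pairHeight at *
    omega
  refine ⟨?_, ?_⟩
  · have h := hpw 2 (by omega) 4 3 (by norm_num) (by omega) h23
    norm_num at h
    nlinarith
  · rintro rfl
    have h := hpw 0 (by omega) 5 2 (by norm_num) (by omega) (h2 0 (by omega))
    norm_num at h
    have h' : 3 ≤ pairHeight (s 1) := by nlinarith
    have h'' := hpw 1 (by omega) 5 3 (by norm_num) (by omega) h'
    norm_num at h''
    nlinarith

/-- A root attracts at most `z n` solutions. -/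
theorem card_le_z_of_gapPair (a b c : ℤ) (n k : ℕ) (hk0 : 0 < k)
    (hkn : k < n) (hn6 : 6 ≤ n) (α : ℝ) (ha0 : a ≠ 0) (hb0 : b ≠ 0) (hc0 : c ≠ 0)
    (hirr : Irreducible (C (a : ℚ) * X ^ n + C (b : ℚ) * X ^ k + C (c : ℚ)))
    (hirr' : Irreducible (C (c : ℚ) * X ^ n + C (b : ℚ) * X ^ (n - k) + C (a : ℚ)))
    (hα : a * α ^ n + b * α ^ k + c = 0) (hα0 : 0 < α) (S : Finset (ℕ × ℕ)) (P : ℕ × ℕ → ℕ)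
    (hpos : ∀ s ∈ S, 0 < s.1 ∧ 0 < s.2 ∧ s.1 ≠ s.2) (hcop : ∀ s ∈ S, Nat.Coprime s.1 s.2)
    (hgap : ∀ s ∈ S, ∀ t ∈ S, s ≠ t → P s ≤ P t → GapPair n a b c s t)
    (hlog : ∀ s ∈ S, 2 * n * |(b : ℝ)| ≤ pairHeight s →
      |logRatio s - Real.log α| ≤ gapConst n |(b : ℝ)| / (pairHeight s : ℝ) ^ n) :
    S.card ≤ z n := by
  by_contra hcard
  push Not at hcard
  obtain ⟨s, hsS, hs⟩ := exists_monotone_sequence S P (z n) hcard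
  set Z := z n with hZ
  have hZ4 : 4 ≤ Z := four_le_z n
  have hX2 : ∀ i ≤ Z, 2 ≤ pairHeight (s i) := by
    intro i hi
    obtain ⟨h1, h2, h3⟩ := hpos _ (hsS i hi)
    unfold pairHeight
    omega
  have hX2' : ∀ i ≤ Z, (2 : ℝ) ≤ pairHeight (s i) := fun i hi => by exact_mod_cast hX2 i hi
  have hg : ∀ i < Z, GapPair n a b c (s i) (s (i + 1)) := fun i hi =>
    hgap _ (hsS i hi.le) _ (hsS (i + 1) hi) (hs i (i + 1) (by omega) hi).1
      (hs i (i + 1) (by omega) hi).2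
  have hXm : ∀ i < Z, pairHeight (s i) ≤ pairHeight (s (i + 1)) ∧
      pairHeight (s i) ^ (n - 2) ≤ 6 * pairHeight (s (i + 1)) ^ 2 := fun i hi =>
    le_of_pow_le_six_mul_sq hn6 (hX2 i hi.le) (hX2 _ hi) (hg i hi).weak
  obtain ⟨hX4, hX7⟩ := height_lower_bounds hn6 hZ4 hX2 (fun i hi => hpos _ (hsS i hi))
    (fun i hi => (hXm i hi).1) (fun i j hij hj => (hs i j hij hj).1) (fun i hi => (hXm i hi).2)
  have hint : ∀ m : ℤ, m ≠ 0 → (1 : ℝ) ≤ |(m : ℝ)| := by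
    intro m hm
    have := Int.one_le_abs hm
    exact_mod_cast this
  have hB := hint b hb0
  set B := |(b : ℝ)| with hBdef
  set H := max |(a : ℝ)| (max B |(c : ℝ)|) with hH
  have haH : |(a : ℝ)| ≤ H := le_max_left _ _
  have hbH : B ≤ H := (le_max_left _ _).trans (le_max_right _ _)
  have hcH : |(c : ℝ)| ≤ H := (le_max_right _ _).trans (le_max_right _ _)
  have hH1 : 1 ≤ H := hB.trans hbH
  have hHX : H ≤ 81 * (pairHeight (s 1) : ℝ) ^ 2 :=
    max_le (hg 0 (by omega)).left_le (max_le (hg 0 (by omega)).mid_le (hg 0 (by omega)).right_le)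
  set κ := gapConst n B with hκ
  have hκ1 : 1 ≤ κ := one_le_gapConst (by omega) hB
  set x : ℕ → ℝ := fun i => Real.log (pairHeight (s i)) with hx
  have hl2 : 0 < Real.log 2 := Real.log_pos (by norm_num)
  have hn0 : (0 : ℝ) < n := by
    have : 0 < n := by omega
    exact_mod_cast this
  have hbig : ∀ i ≤ Z, Real.log 2 + Real.log n + Real.log B ≤ x i →
      2 * n * B ≤ pairHeight (s i) := by
    intro i hi h
    have hp := hX2' i hi
    rw [← Real.log_le_log_iff (by positivity) (by positivity),
      Real.log_mul (by positivity) (by positivity), Real.log_mul (by positivity) (by positivity)]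
    exact h
  have G : LogGrowth n Z (Real.log 2) (Real.log n) (Real.log B) (Real.log H) (Real.log κ) x := by
    refine ⟨hl2, Real.log_nonneg hB, Real.log_le_log (by linarith) hbH, ?_, ?_, ?_, ?_, ?_, ?_⟩
    · have hp := hX2' 1 (by omega)
      have h1 := Real.log_le_log (by linarith) hHX
      rw [Real.log_mul (by norm_num) (by positivity), Real.log_pow] at h1
      have h2 := log_le_mul_log_two (x := 81) (by norm_num) 32 5 (by norm_num) (by norm_num)
      push_cast at h1 h2
      linarith
    · intro i hi
      exact Real.log_le_log (by have := hX2' i hi.le; linarith) (by exact_mod_cast (hXm i hi).1)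
    · exact Real.log_le_log (by norm_num) (hX2' 0 (by omega))
    · intro i hi
      have hp := hX2' i hi.le
      have hp' := hX2' (i + 1) hi
      have h1 := Real.log_le_log (by positivity) (hg i hi).weak
      rw [Real.log_mul (by norm_num) (by positivity), Real.log_pow, Real.log_pow,
        Real.log_mul (by positivity) (by positivity)] at h1
      have h2 := log_le_mul_log_two (x := 6) (by norm_num) 13 5 (by norm_num) (by norm_num)
      push_cast at h1 h2
      linarith
    · exact log_gapConst (by omega) hB
    · intro i hi h
      have hp := hX2' i hi.le
      have hp' := hX2' (i + 1) hi
      have h1 := Real.log_le_log (by positivity) ((hg i hi).strong (hbig i hi.le h))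
      rw [Real.log_mul (by positivity) (by positivity), Real.log_pow,
        Real.log_mul (by positivity) (by positivity)] at h1
      simp only [hx]
      linarith
  obtain ⟨K, hK, c0, c1, c2, c3⟩ := G.conclusion hn6
    (by
      intro _
      have := mul_log_two_le_log (x := pairHeight (s 3)) 2 1 one_pos (by
        have : (4 : ℝ) ≤ pairHeight (s 3) := by exact_mod_cast hX4
        norm_num
        linarith)
      simpa using this)
    (by
      intro h
      have := mul_log_two_le_log (x := pairHeight (s 2)) 14 5 (by norm_num) (by
        have h7 : (7 : ℝ) ≤ pairHeight (s 2) := by exact_mod_cast hX7 h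
        calc (2 : ℝ) ^ 14 ≤ 7 ^ 5 := by norm_num
          _ ≤ _ := by gcongr)
      simpa using this)
  have hp1 := hX2' (Z - 1) (by omega)
  have hp2 := hX2' Z le_rfl
  have hZS := hsS (Z - 1) (by omega)
  have hZS' := hsS Z le_rfl
  have hb1 := hbig (Z - 1) (by omega) c0
  have hmZ : pairHeight (s (Z - 1)) ≤ pairHeight (s Z) := by
    have := (hXm (Z - 1) (by omega)).1
    rwa [Nat.sub_add_cancel (by omega)] at this
  refine not_two_close_log_approximations a b c n k hk0 hkn hn6 H α hH1 ha0 hc0 haH hbH hcH hirr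
    hirr' hα hα0 K hK _ _ _ _ (hpos _ hZS).1 (hpos _ hZS).2.1 (hpos _ hZS').1 (hpos _ hZS').2.1
    (hcop _ hZS) κ hκ1 (hlog _ hZS hb1)
    (hlog _ hZS' (hb1.trans (by exact_mod_cast hmZ))) ?_ ?_ ?_
  · change 2 * (2 * κ) ^ 40 ≤ (pairHeight (s (Z - 1)) : ℝ)
    rw [← Real.log_le_log_iff (by positivity) (by positivity),
      Real.log_mul (by norm_num) (by positivity), Real.log_pow,
      Real.log_mul (by norm_num) (by positivity)]
    push_cast
    exact c1
  · change 2 * (8 * H) ^ (K * n) ≤ (pairHeight (s (Z - 1)) : ℝ)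
    rw [← Real.log_le_log_iff (by positivity) (by positivity),
      Real.log_mul (by norm_num) (by positivity), Real.log_pow,
      Real.log_mul (by norm_num) (by positivity)]
    have h8 : Real.log 8 = 3 * Real.log 2 := by
      rw [show (8 : ℝ) = 2 ^ 3 by norm_num, Real.log_pow]
      norm_num
    rw [h8]
    push_cast
    exact c2
  · change 2 * (pairHeight (s (Z - 1)) : ℝ) ^ (n - 2) ≤ (pairHeight (s Z) : ℝ)
    rw [← Real.log_le_log_iff (by positivity) (by positivity),
      Real.log_mul (by norm_num) (by positivity), Real.log_pow, Nat.cast_sub (by omega)]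
    push_cast
    exact c3

section Counting

variable {a b c : ℤ} {k r : ℕ}

/-- The rational trinomials `a x^(k+r) + b x^k + c` and `c x^(k+r) + b x^r + a` are irreducible. -/
def IrreducibleTrinomials (a b c : ℤ) (k r : ℕ) : Prop :=
  Irreducible (C (a : ℚ) * X ^ (k + r) + C (b : ℚ) * X ^ k + C (c : ℚ)) ∧
    Irreducible (C (c : ℚ) * X ^ (k + r) + C (b : ℚ) * X ^ r + C (a : ℚ))

theorem IrreducibleTrinomials.swap (h : IrreducibleTrinomials a b c k r) :
    IrreducibleTrinomials c b a r k := by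
  unfold IrreducibleTrinomials
  rw [add_comm r k]
  exact ⟨h.2, h.1⟩

theorem four_le_gapConst {n : ℕ} {b : ℝ} (hn : 1 ≤ n) (hb : 1 ≤ b) : 4 ≤ gapConst n b := by
  unfold gapConst
  have h1 : (1 : ℝ) ≤ n := by exact_mod_cast hn
  have h2 : 1 ≤ (n * b) ^ n := one_le_pow₀ (one_le_mul_of_one_le_of_one_le h1 hb)
  have h3 := Real.one_le_sqrt.2 h2
  linarith

theorem one_le_abs_intCast {m : ℤ} (hm : m ≠ 0) : (1 : ℝ) ≤ |(m : ℝ)| := by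
  exact_mod_cast Int.one_le_abs hm

theorem pow_mul_expTrinomial_log {x : ℝ} (hx : 0 < x) (a b c : ℝ) (k r : ℕ) :
    x ^ k * expTrinomial a b c k r (Real.log x) = a * x ^ (k + r) + b * x ^ k + c := by
  unfold expTrinomial
  rw [Real.exp_neg, Real.exp_nat_mul, Real.exp_nat_mul, Real.exp_log hx, pow_add]
  field_simp

theorem expTrinomial_log_eq_zero_iff {x : ℝ} (hx : 0 < x) (a b c : ℝ) (k r : ℕ) :
    expTrinomial a b c k r (Real.log x) = 0 ↔ a * x ^ (k + r) + b * x ^ k + c = 0 := by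
  rw [← pow_mul_expTrinomial_log hx]
  simp [hx.ne']

theorem card_le_z_of_opposite_signs (hk : 0 < k) (hr : 0 < r) (hn : 6 ≤ k + r) (ha : 0 < a)
    (hb : b ≠ 0) (hc : c < 0) (hirr : IrreducibleTrinomials a b c k r) {α : ℝ} (hα0 : 0 < α)
    (hα : a * α ^ (k + r) + b * α ^ k + c = 0) (S : Finset (ℕ × ℕ))
    (hS : ∀ s ∈ S, IsPosSolution a b c k r s) : S.card ≤ z (k + r) := by
  have hκ : 4 ≤ gapConst (k + r) |(b : ℝ)| := four_le_gapConst (by omega) (one_le_abs_intCast hb)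
  refine card_le_z_of_gapPair a b c (k + r) k hk (by omega) hn α ha.ne' hb hc.ne hirr.1 ?_ hα hα0 S
    (midMonomial k r) (fun s hs => ⟨(hS s hs).1, (hS s hs).2.1, (hS s hs).2.2.1⟩)
    (fun s hs => (hS s hs).coprime hk hr) ?_ ?_
  · rw [Nat.add_sub_cancel_left]
    exact hirr.2
  · intro s hs t ht hst hP
    obtain ⟨h1, h2, h3, h4⟩ := (hS s hs).gap_of_opposite_signs hk hr ha hc (hS t ht) hst hP
    have hX := (hS s hs).two_le_height
    have hY := (hS t ht).two_le_height
    have hX' : (2 : ℝ) ≤ pairHeight s := by exact_mod_cast hX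
    have hY' : (2 : ℝ) ≤ pairHeight t := by exact_mod_cast hY
    have hN : (4 : ℝ) ≤ pairHeight s * pairHeight t := by nlinarith
    have hw : (pairHeight s : ℝ) ^ (k + r) ≤ 6 * (pairHeight s * pairHeight t) ^ 2 := by
      nlinarith
    have hle : (pairHeight s : ℝ) ≤ pairHeight t := by
      exact_mod_cast (le_of_pow_le_six_mul_sq hn hX hY hw).1
    have hN' : (2 : ℝ) * (pairHeight s * pairHeight t) ≤ 81 * (pairHeight t : ℝ) ^ 2 := by nlinarith
    refine ⟨hw, h2.trans hN', h3.trans hN', h4.trans hN', fun _ => h1.trans ?_⟩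
    gcongr
    linarith
  · intro s hs _
    refine ((hS s hs).log_close_of_opposite_signs hk hr ha hc
      ((expTrinomial_log_eq_zero_iff hα0 _ _ _ _ _).2 hα)).trans ?_
    gcongr
    linarith

theorem card_le_z_of_right (hk : 0 < k) (hr : 0 < r) (hn : 6 ≤ k + r) (ha : 0 < a)
    (hb : b < 0) (hc : 0 < c) (hirr : IrreducibleTrinomials a b c k r)
    (hdisc : ((k + r : ℕ) : ℤ) ^ (k + r) * (a ^ k * c ^ r)
      < (k : ℤ) ^ k * (r : ℤ) ^ r * (-b) ^ (k + r)) {α : ℝ} (hα0 : 0 < α)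
    (hα : a * α ^ (k + r) + b * α ^ k + c = 0)
    (hαr : k * (c * Real.exp (-(k * Real.log α))) ≤ r * (a * Real.exp (r * Real.log α)))
    (S : Finset (ℕ × ℕ)) (hS : ∀ s ∈ S, IsPosSolution a b c k r s ∧ IsRightPair a c k r s) :
    S.card ≤ z (k + r) := by
  have hb' : |(b : ℝ)| = -b := abs_of_neg (by exact_mod_cast hb)
  refine card_le_z_of_gapPair a b c (k + r) k hk (by omega) hn α ha.ne' hb.ne hc.ne' hirr.1 ?_
    hα hα0 S (midMonomial k r)
    (fun s hs => ⟨(hS s hs).1.1, (hS s hs).1.2.1, (hS s hs).1.2.2.1⟩)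
    (fun s hs => (hS s hs).1.coprime hk hr) ?_ ?_
  · rw [Nat.add_sub_cancel_left]
    exact hirr.2
  · intro s hs t ht hst hP
    obtain ⟨hs1, hs2⟩ := hS s hs
    obtain ⟨ht1, ht2⟩ := hS t ht
    obtain ⟨h1, h2, h3, h4⟩ := hs1.gap_of_same_signs hk hr hn ha hc ht1 hst hs2 ht2 hP
    refine ⟨h1, h2, h3, h4, fun hbig => ?_⟩
    rw [hb', mul_assoc] at hbig
    rw [hb']
    have g1 := hs1.height_pow_mul_abs_le hk hr hn ha hc hb hdisc hs2 (by rw [mul_assoc]; exact hbig)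
      ((isRightPair_iff ht1.1 ht1.2.1).1 ht2) (ht1.abs_expTrinomial_mul_le hP)
    have g2 := hs1.one_le_height_mul_abs hk hr ht1 hst
    have hX : (0 : ℝ) ≤ (pairHeight s : ℝ) ^ (k + r) := by positivity
    calc (pairHeight s : ℝ) ^ (k + r)
        ≤ (pairHeight s : ℝ) ^ (k + r) * ((pairHeight s * pairHeight t)
          * |logRatio t - logRatio s|) := le_mul_of_one_le_right hX g2
      _ = (pairHeight s : ℝ) ^ (k + r) * |logRatio t - logRatio s|
          * (pairHeight s * pairHeight t) := by ring
      _ ≤ _ := by gcongr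
  · intro s hs hbig
    obtain ⟨hs1, hs2⟩ := hS s hs
    rw [hb', mul_assoc] at hbig
    rw [hb']
    have hX : (0 : ℝ) < (pairHeight s : ℝ) ^ (k + r) := by
      have : (2 : ℝ) ≤ pairHeight s := by exact_mod_cast hs1.two_le_height
      positivity
    rw [le_div_iff₀ hX, mul_comm, abs_sub_comm]
    refine hs1.height_pow_mul_abs_le hk hr hn ha hc hb hdisc hs2 (by rw [mul_assoc]; exact hbig)
      hαr ?_
    rw [(expTrinomial_log_eq_zero_iff hα0 _ _ _ _ _).2 hα]
    simp

theorem isPosSolution_swap_iff {s : ℕ × ℕ} :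
    IsPosSolution c b a r k s.swap ↔ IsPosSolution a b c k r s := by
  unfold IsPosSolution
  simp only [Prod.fst_swap, Prod.snd_swap]
  rw [ne_comm (a := s.2), ← and_assoc, and_comm (a := 0 < s.2), and_assoc, add_comm r k]
  have : c * (s.2 : ℤ) ^ (k + r) + b * (s.2 : ℤ) ^ r * (s.1 : ℤ) ^ k + a * (s.1 : ℤ) ^ (k + r)
      = a * (s.1 : ℤ) ^ (k + r) + b * (s.1 : ℤ) ^ k * (s.2 : ℤ) ^ r
        + c * (s.2 : ℤ) ^ (k + r) := by ring
  rw [this]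

end Counting

section CriticalPoint

/-- The positive critical point of a trinomial with a negative middle coefficient. -/
theorem exists_trinomial_critical {a b : ℝ} {k r : ℕ} (hk : 0 < k) (hr : 0 < r) (ha : 0 < a)
    (hb : b < 0) : ∃ τ : ℝ, 0 < τ ∧ ((k + r : ℕ) : ℝ) * a * τ ^ r = k * -b := by
  have hk' : (0 : ℝ) < k := by exact_mod_cast hk
  have hn : (0 : ℝ) < ((k + r : ℕ) : ℝ) := by
    have : 0 < k + r := by omega
    exact_mod_cast this
  have hq : 0 < k * -b / (((k + r : ℕ) : ℝ) * a) := by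
    have : 0 < -b := by linarith
    positivity
  refine ⟨(k * -b / (((k + r : ℕ) : ℝ) * a)) ^ ((r : ℝ)⁻¹), Real.rpow_pos_of_pos hq _, ?_⟩
  rw [Real.rpow_inv_natCast_pow hq.le hr.ne']
  field_simp

theorem mul_trinomial_critical {a b c τ : ℝ} {k r : ℕ}
    (h : ((k + r : ℕ) : ℝ) * a * τ ^ r = k * -b) :
    ((k + r : ℕ) : ℝ) * (a * τ ^ (k + r) + b * τ ^ k + c)
      = ((k + r : ℕ) : ℝ) * c - r * -b * τ ^ k := by
  have e : ((k + r : ℕ) : ℝ) * (a * τ ^ (k + r) + b * τ ^ k + c)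
      = τ ^ k * (((k + r : ℕ) : ℝ) * a * τ ^ r) + ((k + r : ℕ) : ℝ) * (b * τ ^ k + c) := by
    rw [pow_add]
    ring
  rw [e, h]
  push_cast
  ring

theorem discriminant_identities {a b c τ : ℝ} {k r : ℕ}
    (h : ((k + r : ℕ) : ℝ) * a * τ ^ r = k * -b) :
    (r * -b * τ ^ k) ^ r * (((k + r : ℕ) : ℝ) * a) ^ k = (k : ℝ) ^ k * (r : ℝ) ^ r * (-b) ^ (k + r) ∧
    (((k + r : ℕ) : ℝ) * c) ^ r * (((k + r : ℕ) : ℝ) * a) ^ k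
      = ((k + r : ℕ) : ℝ) ^ (k + r) * (a ^ k * c ^ r) := by
  constructor
  · have e : (r * -b * τ ^ k) ^ r * (((k + r : ℕ) : ℝ) * a) ^ k
        = (r * -b) ^ r * (((k + r : ℕ) : ℝ) * a * τ ^ r) ^ k := by
      rw [mul_pow _ (τ ^ k), mul_pow _ (τ ^ r), ← pow_mul, ← pow_mul, mul_comm k r]
      ring
    rw [e, h, mul_pow, mul_pow, pow_add]
    ring
  · rw [mul_pow, mul_pow, pow_add]
    ring

variable {a b c : ℤ} {k r : ℕ} {τ : ℝ}

theorem trinomial_critical_neg_of_lt (hk : 0 < k) (ha : 0 < a)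
    (h : ((k + r : ℕ) : ℝ) * a * τ ^ r = k * -b)
    (hd : ((k + r : ℕ) : ℤ) ^ (k + r) * (a ^ k * c ^ r)
      < (k : ℤ) ^ k * (r : ℤ) ^ r * (-b) ^ (k + r)) (hb : b < 0) (hτ : 0 < τ) :
    a * τ ^ (k + r) + b * τ ^ k + c < 0 := by
  have hn : (0 : ℝ) < ((k + r : ℕ) : ℝ) := by
    have : 0 < k + r := by omega
    exact_mod_cast this
  have ha' : (0 : ℝ) < a := by exact_mod_cast ha
  have hb' : (0 : ℝ) < -b := by
    have : (b : ℝ) < 0 := by exact_mod_cast hb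
    linarith
  obtain ⟨e1, e2⟩ := discriminant_identities (c := (c : ℝ)) h
  have hd' : ((k + r : ℕ) : ℝ) ^ (k + r) * ((a : ℝ) ^ k * (c : ℝ) ^ r)
      < (k : ℝ) ^ k * (r : ℝ) ^ r * (-(b : ℝ)) ^ (k + r) := by exact_mod_cast hd
  rw [← e1, ← e2] at hd'
  have h1 := lt_of_mul_lt_mul_right hd' (by positivity)
  have h2 := lt_of_pow_lt_pow_left₀ r (by positivity) h1
  have h3 := mul_trinomial_critical (c := (c : ℝ)) h
  by_contra hcon
  push Not at hcon
  nlinarith [mul_nonneg hn.le hcon]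

theorem trinomial_critical_pos_of_lt (hk : 0 < k) (ha : 0 < a) (hc : 0 < c)
    (h : ((k + r : ℕ) : ℝ) * a * τ ^ r = k * -b)
    (hd : (k : ℤ) ^ k * (r : ℤ) ^ r * (-b) ^ (k + r)
      < ((k + r : ℕ) : ℤ) ^ (k + r) * (a ^ k * c ^ r)) :
    0 < a * τ ^ (k + r) + b * τ ^ k + c := by
  have hn : (0 : ℝ) < ((k + r : ℕ) : ℝ) := by
    have : 0 < k + r := by omega
    exact_mod_cast this
  have ha' : (0 : ℝ) < a := by exact_mod_cast ha
  have hc' : (0 : ℝ) < c := by exact_mod_cast hc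
  obtain ⟨e1, e2⟩ := discriminant_identities (c := (c : ℝ)) h
  have hd' : (k : ℝ) ^ k * (r : ℝ) ^ r * (-(b : ℝ)) ^ (k + r)
      < ((k + r : ℕ) : ℝ) ^ (k + r) * ((a : ℝ) ^ k * (c : ℝ) ^ r) := by exact_mod_cast hd
  rw [← e1, ← e2] at hd'
  have h1 := lt_of_mul_lt_mul_right hd' (by positivity)
  have h2 := lt_of_pow_lt_pow_left₀ r (by positivity) h1
  have h3 := mul_trinomial_critical (c := (c : ℝ)) h
  exact pos_of_mul_pos_right (h3 ▸ sub_pos.2 h2) hn.le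

theorem trinomial_critical_eq_zero (hk : 0 < k) (hr : 0 < r) (ha : 0 < a) (hc : 0 < c)
    (h : ((k + r : ℕ) : ℝ) * a * τ ^ r = k * -b)
    (hd : (k : ℤ) ^ k * (r : ℤ) ^ r * (-b) ^ (k + r)
      = ((k + r : ℕ) : ℤ) ^ (k + r) * (a ^ k * c ^ r)) (hb : b < 0) (hτ : 0 < τ) :
    a * τ ^ (k + r) + b * τ ^ k + c = 0 := by
  have hn : (0 : ℝ) < ((k + r : ℕ) : ℝ) := by
    have : 0 < k + r := by omega
    exact_mod_cast this
  have ha' : (0 : ℝ) < a := by exact_mod_cast ha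
  have hc' : (0 : ℝ) < c := by exact_mod_cast hc
  have hb' : (0 : ℝ) < -b := by
    have : (b : ℝ) < 0 := by exact_mod_cast hb
    linarith
  obtain ⟨e1, e2⟩ := discriminant_identities (c := (c : ℝ)) h
  have hd' : (k : ℝ) ^ k * (r : ℝ) ^ r * (-(b : ℝ)) ^ (k + r)
      = ((k + r : ℕ) : ℝ) ^ (k + r) * ((a : ℝ) ^ k * (c : ℝ) ^ r) := by exact_mod_cast hd
  rw [← e1, ← e2] at hd'
  have h1 := mul_right_cancel₀ (by positivity) hd'
  have h2 := (pow_left_inj₀ (by positivity) (by positivity) hr.ne').1 h1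
  have h3 := mul_trinomial_critical (c := (c : ℝ)) h
  rw [h2, sub_self] at h3
  exact (mul_eq_zero.1 h3).resolve_left hn.ne'

/-- An irreducible trinomial has nonzero discriminant. -/
theorem IrreducibleTrinomials.discriminant_ne (hirr : IrreducibleTrinomials a b c k r) (hk : 0 < k)
    (hr : 0 < r) (ha : 0 < a) (hb : b < 0) (hc : 0 < c) :
    (k : ℤ) ^ k * (r : ℤ) ^ r * (-b) ^ (k + r)
      ≠ ((k + r : ℕ) : ℤ) ^ (k + r) * (a ^ k * c ^ r) := by
  intro hd
  have ha' : (0 : ℝ) < a := by exact_mod_cast ha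
  have hb' : (b : ℝ) < 0 := by exact_mod_cast hb
  obtain ⟨τ, hτ, h⟩ := exists_trinomial_critical hk hr ha' hb'
  have h0 := trinomial_critical_eq_zero hk hr ha hc h hd hb hτ
  set f : ℚ[X] := C (a : ℚ) * X ^ (k + r) + C (b : ℚ) * X ^ k + C (c : ℚ) with hf
  have hsep : f.Separable := hirr.1.separable
  obtain ⟨u, v, huv⟩ := hsep
  have h1 : aeval τ f = 0 := by
    rw [hf]
    simpa using h0
  have h2 : aeval τ (derivative f) = 0 := by
    rw [hf]
    have e : (a : ℝ) * (((k + r : ℕ) : ℝ) * τ ^ (k + r - 1)) + b * (k * τ ^ (k - 1)) = 0 := by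
      rw [show k + r - 1 = (k - 1) + r by omega, pow_add]
      linear_combination τ ^ (k - 1) * h
    simpa [derivative_X_pow] using e
  have h3 := congrArg (aeval τ) huv
  simp [h1, h2] at h3

end CriticalPoint

section TwoRoots

variable {a b c : ℤ} {k r : ℕ}

theorem exists_pos_root_of_opposite_signs (hk : 0 < k) (hr : 0 < r) (ha : 0 < a) (hc : c < 0) :
    ∃ α : ℝ, 0 < α ∧ a * α ^ (k + r) + b * α ^ k + c = 0 := by
  have ha' : (1 : ℝ) ≤ a := by exact_mod_cast ha
  have hc' : (c : ℝ) < 0 := by exact_mod_cast hc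
  set M : ℝ := 1 + |(b : ℝ)| + -c with hM
  have hb0 := abs_nonneg (b : ℝ)
  have hM1 : 1 ≤ M := by linarith
  have hcont : ContinuousOn (fun x : ℝ => a * x ^ (k + r) + b * x ^ k + c) (Set.Icc 0 M) := by
    fun_prop
  have hMr : M ≤ M ^ r := le_self_pow₀ hM1 hr.ne'
  have hMk : 1 ≤ M ^ k := one_le_pow₀ hM1
  have h0 : (0 : ℝ) ∈ Set.Icc ((fun x : ℝ => a * x ^ (k + r) + b * x ^ k + c) 0)
      ((fun x : ℝ => a * x ^ (k + r) + b * x ^ k + c) M) := by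
    constructor
    · simp [hk.ne']
      exact hc.le
    · have e : a * M ^ (k + r) + b * M ^ k + c = M ^ k * (a * M ^ r + b) + c := by
        rw [pow_add]; ring
      have hb1 := neg_abs_le (b : ℝ)
      have h2 : -(c : ℝ) ≤ a * M ^ r + b := by nlinarith
      simp only [e]
      nlinarith
  obtain ⟨α, hα, hα0⟩ := intermediate_value_Icc (by linarith) hcont h0
  refine ⟨α, lt_of_le_of_ne hα.1 ?_, hα0⟩
  rintro rfl
  simp [hk.ne'] at hα0
  exact hc.ne hα0

theorem exists_two_pos_roots (hk : 0 < k) (hr : 0 < r) (ha : 0 < a) (hc : 0 < c) {τ : ℝ}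
    (hτ0 : 0 < τ) (hτ : a * τ ^ (k + r) + b * τ ^ k + c < 0) :
    ∃ α β : ℝ, 0 < α ∧ α < τ ∧ τ < β ∧ a * α ^ (k + r) + b * α ^ k + c = 0 ∧
      a * β ^ (k + r) + b * β ^ k + c = 0 := by
  have ha' : (1 : ℝ) ≤ a := by exact_mod_cast ha
  have hc' : (0 : ℝ) < c := by exact_mod_cast hc
  set M : ℝ := 1 + |(b : ℝ)| + τ with hM
  have hb0 := abs_nonneg (b : ℝ)
  have hM1 : 1 ≤ M := by linarith
  have hcont : Continuous (fun x : ℝ => a * x ^ (k + r) + b * x ^ k + c) := by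
    fun_prop
  have hMr : M ≤ M ^ r := le_self_pow₀ hM1 hr.ne'
  have hMk : 1 ≤ M ^ k := one_le_pow₀ hM1
  have hM0 : 0 < a * M ^ (k + r) + b * M ^ k + c := by
    have e : a * M ^ (k + r) + b * M ^ k + c = M ^ k * (a * M ^ r + b) + c := by
      rw [pow_add]; ring
    have hb1 := neg_abs_le (b : ℝ)
    have h2 : 0 ≤ a * M ^ r + b := by nlinarith
    rw [e]
    positivity
  obtain ⟨α, hα, hα0⟩ := intermediate_value_Ioo' hτ0.le hcont.continuousOn
    (show (0 : ℝ) ∈ Set.Ioo _ _ from ⟨hτ, by simpa [hk.ne'] using hc⟩)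
  obtain ⟨β, hβ, hβ0⟩ := intermediate_value_Ioo (by linarith : τ ≤ M) hcont.continuousOn
    (show (0 : ℝ) ∈ Set.Ioo _ _ from ⟨hτ, hM0⟩)
  exact ⟨α, β, hα.1, hα.2, hβ.1, hα0, hβ0⟩

/-- The position of a root with respect to the critical point of the trinomial. -/
theorem trinomial_root_slope {a b c x τ : ℝ}
    (h : ((k + r : ℕ) : ℝ) * a * τ ^ r = k * -b)
    (hx : a * x ^ (k + r) + b * x ^ k + c = 0) (hx0 : 0 < x) :
    r * (a * Real.exp (r * Real.log x)) - k * (c * Real.exp (-(k * Real.log x)))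
      = (k + r : ℕ) * a * (x ^ r - τ ^ r) := by
  rw [Real.exp_neg, Real.exp_nat_mul, Real.exp_nat_mul, Real.exp_log hx0]
  have e : k * (c * (x ^ k)⁻¹) = k * (-b - a * x ^ r) := by
    have : c = x ^ k * (-b - a * x ^ r) := by
      rw [pow_add] at hx
      linear_combination hx
    rw [this]
    field_simp
  rw [e]
  push_cast at h ⊢
  linear_combination h

theorem card_le_two_mul_z (hk : 0 < k) (hr : 0 < r) (hn : 6 ≤ k + r) (ha : 0 < a)
    (hb : b < 0) (hc : 0 < c) (hirr : IrreducibleTrinomials a b c k r)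
    (hdisc : ((k + r : ℕ) : ℤ) ^ (k + r) * (a ^ k * c ^ r)
      < (k : ℤ) ^ k * (r : ℤ) ^ r * (-b) ^ (k + r)) :
    ∃ α β : ℝ, 0 < α ∧ α < β ∧ a * α ^ (k + r) + b * α ^ k + c = 0 ∧
      a * β ^ (k + r) + b * β ^ k + c = 0 ∧
      ∀ S : Finset (ℕ × ℕ), (∀ s ∈ S, IsPosSolution a b c k r s) → S.card ≤ 2 * z (k + r) := by
  have ha' : (0 : ℝ) < a := by exact_mod_cast ha
  have hb' : (b : ℝ) < 0 := by exact_mod_cast hb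
  have hn0 : (0 : ℝ) < ((k + r : ℕ) : ℝ) := by
    have : 0 < k + r := by omega
    exact_mod_cast this
  obtain ⟨τ, hτ0, hτ⟩ := exists_trinomial_critical hk hr ha' hb'
  obtain ⟨α, β, hα0, hατ, hβτ, hα, hβ⟩ := exists_two_pos_roots hk hr ha hc hτ0
    (trinomial_critical_neg_of_lt hk ha hτ hdisc hb hτ0)
  have hβ0 := hτ0.trans hβτ
  refine ⟨α, β, hα0, hατ.trans hβτ, hα, hβ, fun S hS => ?_⟩
  have hβr : k * (c * Real.exp (-(k * Real.log β))) ≤ r * (a * Real.exp (r * Real.log β)) := by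
    rw [← sub_nonneg, trinomial_root_slope hτ hβ hβ0]
    have := pow_le_pow_left₀ hτ0.le hβτ.le r
    exact mul_nonneg (by positivity) (by linarith)
  have hαr : r * (a * Real.exp (-(r * Real.log α⁻¹))) ≤ k * (c * Real.exp (k * Real.log α⁻¹)) := by
    have h1 := trinomial_root_slope hτ hα hα0
    have h2 := pow_le_pow_left₀ hα0.le hατ.le r
    have h3 : ((k + r : ℕ) : ℝ) * a * (α ^ r - τ ^ r) ≤ 0 :=
      mul_nonpos_of_nonneg_of_nonpos (by positivity) (by linarith)
    rw [Real.log_inv, mul_neg, neg_neg, mul_neg]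
    linarith
  have hα' : c * α⁻¹ ^ (r + k) + b * α⁻¹ ^ r + a = 0 := by
    have : c * α⁻¹ ^ (r + k) + b * α⁻¹ ^ r + a
        = (a * α ^ (k + r) + b * α ^ k + c) * α⁻¹ ^ (r + k) := by
      rw [inv_pow, inv_pow, pow_add, pow_add]
      field_simp
      ring
    rw [this, hα, zero_mul]
  classical
  have hR := card_le_z_of_right hk hr hn ha hb hc hirr hdisc hβ0 hβ hβr
    (S.filter (IsRightPair a c k r)) (fun s hs => by
      rw [Finset.mem_filter] at hs
      exact ⟨hS s hs.1, hs.2⟩)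
  have hL := card_le_z_of_right hr hk (by omega) hc hb ha hirr.swap
    (by rw [add_comm r k, mul_comm (c ^ r), mul_comm ((r : ℤ) ^ r)]; exact hdisc)
    (inv_pos.2 hα0) hα' hαr
    ((S.filter (fun s => ¬ IsRightPair a c k r s)).image Prod.swap) (fun s hs => by
      rw [Finset.mem_image] at hs
      obtain ⟨t, ht, rfl⟩ := hs
      rw [Finset.mem_filter] at ht
      refine ⟨isPosSolution_swap_iff.2 (hS t ht.1), ?_⟩
      have := ht.2
      unfold IsRightPair at this ⊢
      push Not at this
      rw [add_comm r k]
      exact this.le)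
  rw [Finset.card_image_of_injective _ Prod.swap_injective, add_comm r k] at hL
  have := Finset.card_filter_add_card_filter_not (s := S) (IsRightPair a c k r)
  omega

end TwoRoots

theorem four_div_eleven_mul_sq_le_exp_neg {s : ℝ} (hs : 0 ≤ s)
    (h : Real.exp (-s) - 1 + s ≤ 3 / 32) : 4 / 11 * s ^ 2 ≤ Real.exp (-s) - 1 + s := by
  have hs6 : s ≤ 3 / 5 := by
    by_contra hcon
    push Not at hcon
    have h1 := Real.add_one_le_exp (-(1 / 5) : ℝ)
    have h2 : (4 / 5 : ℝ) ^ 3 ≤ Real.exp (-(1 / 5)) ^ 3 :=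
      pow_le_pow_left₀ (by norm_num) (by linarith) 3
    rw [← Real.exp_nat_mul] at h2
    norm_num at h2
    have h3 := Real.add_one_le_exp (3 / 5 - s)
    have h4 : Real.exp (-s) = Real.exp (-(3 / 5)) * Real.exp (3 / 5 - s) := by
      rw [← Real.exp_add]
      ring_nf
    rcases le_or_gt s (8 / 5) with h5 | h5
    · have h6 : (64 / 125 : ℝ) * (3 / 5 - s + 1) ≤ Real.exp (-s) := by
        rw [h4]
        exact mul_le_mul h2 h3 (by linarith) (Real.exp_pos _).le
      linarith
    · linarith [Real.exp_pos (-s)]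
  have h1 := Real.exp_bound (x := -s) (by rw [abs_neg, abs_of_nonneg hs]; linarith) (n := 3)
    (by norm_num)
  rw [abs_neg, abs_of_nonneg hs, abs_le] at h1
  norm_num [Finset.sum_range_succ, Nat.factorial] at h1
  have h2 : s ^ 3 ≤ 3 / 5 * s ^ 2 := by nlinarith [sq_nonneg s]
  nlinarith [h1.1]

theorem mul_sq_le_exp_add_exp {K R v : ℝ} (hK : 1 ≤ K) (hR : 1 ≤ R) (hv : 0 ≤ v)
    (h : K * (Real.exp (R * v) - 1 - R * v) + R * (Real.exp (-(K * v)) - 1 + K * v) ≤ 3 / 32) :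
    4 / 11 * (K * R * (K + R) * v ^ 2)
      ≤ K * (Real.exp (R * v) - 1 - R * v) + R * (Real.exp (-(K * v)) - 1 + K * v) := by
  have h1 := Real.quadratic_le_exp_of_nonneg (mul_nonneg (by linarith : 0 ≤ R) hv)
  have h2 := Real.add_one_le_exp (-(K * v))
  have h3 : 0 ≤ K * (Real.exp (R * v) - 1 - R * v) :=
    mul_nonneg (by linarith) (by nlinarith [sq_nonneg (R * v)])
  have h4 : Real.exp (-(K * v)) - 1 + K * v ≤ 3 / 32 := by nlinarith
  have h5 := four_div_eleven_mul_sq_le_exp_neg (mul_nonneg (by linarith : 0 ≤ K) hv) h4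
  have h6 : K * (4 / 11 * (R * v) ^ 2) ≤ K * (Real.exp (R * v) - 1 - R * v) :=
    mul_le_mul_of_nonneg_left (by nlinarith [sq_nonneg (R * v)]) (by linarith)
  have h7 := mul_le_mul_of_nonneg_left h5 (by linarith : 0 ≤ R)
  nlinarith

theorem mul_sq_le_of_convexity {K R v : ℝ} (hK : 1 ≤ K) (hR : 1 ≤ R)
    (h : K * (Real.exp (R * v) - 1 - R * v) + R * (Real.exp (-(K * v)) - 1 + K * v) ≤ 3 / 32) :
    4 / 11 * (K * R * (K + R) * v ^ 2)
      ≤ K * (Real.exp (R * v) - 1 - R * v) + R * (Real.exp (-(K * v)) - 1 + K * v) := by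
  rcases le_total 0 v with hv | hv
  · exact mul_sq_le_exp_add_exp hK hR hv h
  · have := mul_sq_le_exp_add_exp (v := -v) hR hK (by linarith)
    simp only [mul_neg, neg_neg, even_two.neg_pow] at this
    have := this (by linarith)
    linarith

/-- The value of a positive trinomial at its minimum on the logarithmic scale. -/
theorem exists_log_critical {a c : ℝ} {k r : ℕ} (hk : 0 < k) (hr : 0 < r) (ha : 0 < a)
    (hc : 0 < c) : ∃ u γ : ℝ, 0 < γ ∧ ((k + r : ℕ) : ℝ) * (a * Real.exp (r * u)) = k * γ ∧
      ((k + r : ℕ) : ℝ) * (c * Real.exp (-(k * u))) = r * γ ∧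
      (k : ℝ) ^ k * (r : ℝ) ^ r * γ ^ (k + r) = ((k + r : ℕ) : ℝ) ^ (k + r) * (a ^ k * c ^ r) := by
  have hk' : (0 : ℝ) < k := by exact_mod_cast hk
  have hr' : (0 : ℝ) < r := by exact_mod_cast hr
  have hn : (0 : ℝ) < ((k + r : ℕ) : ℝ) := by
    have : 0 < k + r := by omega
    exact_mod_cast this
  obtain ⟨u, hu⟩ : ∃ u : ℝ, ((k + r : ℕ) : ℝ) * u = Real.log (k * c / (r * a)) :=
    ⟨Real.log (k * c / (r * a)) / ((k + r : ℕ) : ℝ), by field_simp⟩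
  have hE : Real.exp (r * u) = Real.exp (-(k * u)) * (k * c / (r * a)) := by
    rw [← Real.exp_log (by positivity : 0 < k * c / (r * a)), ← hu, ← Real.exp_add]
    congr 1
    push_cast
    ring
  have hprod : Real.exp (r * u) ^ k * Real.exp (-(k * u)) ^ r = 1 := by
    rw [← Real.exp_nat_mul, ← Real.exp_nat_mul, ← Real.exp_add, ← Real.exp_zero]
    congr 1
    ring
  have e1 : ((k + r : ℕ) : ℝ) * (a * Real.exp (r * u))
      = k * (((k + r : ℕ) : ℝ) * (c * Real.exp (-(k * u))) / r) := by
    rw [hE]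
    field_simp
  have e2 : ((k + r : ℕ) : ℝ) * (c * Real.exp (-(k * u)))
      = r * (((k + r : ℕ) : ℝ) * (c * Real.exp (-(k * u))) / r) := by
    field_simp
  refine ⟨u, ((k + r : ℕ) : ℝ) * (c * Real.exp (-(k * u))) / r, by positivity, e1, e2, ?_⟩
  set γ := ((k + r : ℕ) : ℝ) * (c * Real.exp (-(k * u))) / r
  calc (k : ℝ) ^ k * (r : ℝ) ^ r * γ ^ (k + r) = (k * γ) ^ k * (r * γ) ^ r := by ring
    _ = ((k + r : ℕ) : ℝ) ^ (k + r) * (a ^ k * c ^ r)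
        * (Real.exp (r * u) ^ k * Real.exp (-(k * u)) ^ r) := by
      rw [← e1, ← e2]
      ring
    _ = _ := by rw [hprod, mul_one]

theorem mul_pow_mul_pow_le (k r : ℕ) (hk : 0 < k) (hr : 0 < r) :
    ((k + r : ℕ) : ℝ) * ((k : ℝ) ^ k * (r : ℝ) ^ r) ≤ ((k + r : ℕ) : ℝ) ^ (k + r) := by
  have key : ∀ m l : ℕ, 0 < m → (1 + (l : ℝ)) * (m : ℝ) ^ m ≤ ((m : ℝ) + l) ^ m := by
    intro m l hm
    have hm' : (0 : ℝ) < m := by exact_mod_cast hm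
    have h0 : (0 : ℝ) ≤ (l : ℝ) / m := by positivity
    have h := one_add_mul_le_pow (a := (l : ℝ) / m) (by linarith) m
    rw [mul_div_cancel₀ _ hm'.ne'] at h
    calc _ ≤ (1 + (l : ℝ) / m) ^ m * (m : ℝ) ^ m := by gcongr
      _ = _ := by
        rw [← mul_pow]
        congr 1
        field_simp
  have h1 := key k r hk
  have h2 := key r k hr
  have hk0 : (0 : ℝ) ≤ k := by positivity
  have hr0 : (0 : ℝ) ≤ r := by positivity
  rw [pow_add]
  push_cast
  calc ((k : ℝ) + r) * ((k : ℝ) ^ k * (r : ℝ) ^ r)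
      ≤ ((1 + (r : ℝ)) * (1 + k)) * ((k : ℝ) ^ k * (r : ℝ) ^ r) := by
        gcongr
        nlinarith [mul_nonneg hk0 hr0]
    _ = ((1 + (r : ℝ)) * (k : ℝ) ^ k) * ((1 + k) * (r : ℝ) ^ r) := by ring
    _ ≤ ((k : ℝ) + r) ^ k * ((r : ℝ) + k) ^ r := by gcongr
    _ = _ := by rw [add_comm (r : ℝ) k]

theorem pow_sub_pow_le_mul {x y : ℝ} (hy : 0 ≤ y) (hxy : y ≤ x) (n : ℕ) :
    x ^ n - y ^ n ≤ n * x ^ (n - 1) * (x - y) := by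
  rw [← geom_sum₂_mul]
  refine mul_le_mul_of_nonneg_right ?_ (by linarith)
  calc ∑ i ∈ Finset.range n, x ^ i * y ^ (n - 1 - i)
      ≤ ∑ i ∈ Finset.range n, x ^ (n - 1) := by
        refine Finset.sum_le_sum fun i hi => ?_
        have h1 := Finset.mem_range.1 hi
        calc x ^ i * y ^ (n - 1 - i) ≤ x ^ i * x ^ (n - 1 - i) := by
              have : 0 ≤ x := hy.trans hxy
              gcongr
          _ = x ^ (n - 1) := by
              rw [← pow_add]
              congr 1
              omega
    _ = _ := by simp

section PositiveMinimum

variable {a b c : ℤ} {k r : ℕ} {s t : ℕ × ℕ} {u γ : ℝ}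

theorem IsPosSolution.log_close_critical (hk : 0 < k) (hr : 0 < r) (hn : 6 ≤ k + r) (ha : 0 < a)
    (hc : 0 < c) (hs : IsPosSolution a b c k r s)
    (e1 : ((k + r : ℕ) : ℝ) * (a * Real.exp (r * u)) = k * γ)
    (e2 : ((k + r : ℕ) : ℝ) * (c * Real.exp (-(k * u))) = r * γ) (hγ0 : 0 < γ) (hγ : -b < γ) :
    (k * r * (γ * midMonomial k r s)) * (logRatio s - u) ^ 2 ≤ 11 / 4 ∧
      (γ - -b) * midMonomial k r s ≤ 1 := by
  set v := logRatio s - u with hv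
  set D := k * (Real.exp (r * v) - 1 - r * v) + r * (Real.exp (-(k * v)) - 1 + k * v) with hD
  have hk1 : (1 : ℝ) ≤ k := by exact_mod_cast hk
  have hr1 : (1 : ℝ) ≤ r := by exact_mod_cast hr
  have hn6 : (6 : ℝ) ≤ ((k + r : ℕ) : ℝ) := by exact_mod_cast hn
  have hP : (0 : ℝ) < midMonomial k r s := by exact_mod_cast hs.midMonomial_pos
  have hD0 : 0 ≤ D := by
    have h1 := Real.add_one_le_exp (r * v)
    have h2 := Real.add_one_le_exp (-(k * v))
    exact add_nonneg (mul_nonneg (by linarith) (by linarith))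
      (mul_nonneg (by linarith) (by linarith))
  have hφ : ((k + r : ℕ) : ℝ) * expTrinomial a b c k r (logRatio s)
      = γ * D + ((k + r : ℕ) : ℝ) * (γ - -b) := by
    have h1 : Real.exp (r * logRatio s) = Real.exp (r * u) * Real.exp (r * v) := by
      rw [← Real.exp_add, hv]
      ring_nf
    have h2 : Real.exp (-(k * logRatio s)) = Real.exp (-(k * u)) * Real.exp (-(k * v)) := by
      rw [← Real.exp_add, hv]
      ring_nf
    rw [expTrinomial, h1, h2, hD]
    push_cast at e1 e2 ⊢
    linear_combination Real.exp (r * v) * e1 + Real.exp (-(k * v)) * e2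
  have hφ0 : 0 < expTrinomial a b c k r (logRatio s) := by
    refine pos_of_mul_pos_right (a := ((k + r : ℕ) : ℝ)) ?_ (by linarith)
    rw [hφ]
    have : 0 < γ - -(b : ℝ) := by linarith
    positivity
  have h1 := hs.abs_expTrinomial_mul
  rw [abs_of_pos hφ0] at h1
  have h2 : γ * midMonomial k r s * D + ((k + r : ℕ) : ℝ) * ((γ - -b) * midMonomial k r s)
      = ((k + r : ℕ) : ℝ) := by
    linear_combination ((k + r : ℕ) : ℝ) * h1 - midMonomial k r s * hφ
  have hw : 0 ≤ (γ - -b) * midMonomial k r s := mul_nonneg (by linarith) hP.le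
  have hF0 : 0 < γ * midMonomial k r s := by positivity
  have h3 : (γ - -b) * midMonomial k r s ≤ 1 := by nlinarith [mul_nonneg hF0.le hD0]
  refine ⟨?_, h3⟩
  have h4 : γ * midMonomial k r s * D ≤ ((k + r : ℕ) : ℝ) := by
    nlinarith [mul_nonneg (by linarith : (0 : ℝ) ≤ ((k + r : ℕ) : ℝ)) hw]
  have h5 : 32 * ((k + r : ℕ) : ℝ) ≤ 3 * (γ * midMonomial k r s) := by
    have g1 := hs.height_pow_le_mul_midMonomial ha hc
    have g2 : (2 : ℝ) ≤ pairHeight s := by exact_mod_cast hs.two_le_height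
    have g3 : (2 : ℝ) ^ (k + r) ≤ (pairHeight s : ℝ) ^ (k + r) := by gcongr
    have g4 : ∀ m : ℕ, 6 ≤ m → 32 * m ≤ 3 * 2 ^ m := by
      intro m hm
      induction m, hm using Nat.le_induction with
      | base => norm_num
      | succ m hm ih => rw [pow_succ]; omega
    have g5 : 32 * ((k + r : ℕ) : ℝ) ≤ 3 * 2 ^ (k + r) := by exact_mod_cast g4 _ hn
    have g6 : -b * (midMonomial k r s : ℝ) ≤ γ * midMonomial k r s := by gcongr
    linarith
  have h6 : D ≤ 3 / 32 := by nlinarith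
  have h7 := mul_sq_le_of_convexity hk1 hr1 h6
  have h8 : γ * midMonomial k r s * (4 / 11 * (k * r * (k + r) * v ^ 2)) ≤ ((k + r : ℕ) : ℝ) :=
    (mul_le_mul_of_nonneg_left h7 hF0.le).trans h4
  refine le_of_mul_le_mul_left (a := ((k + r : ℕ) : ℝ)) ?_ (by linarith)
  push_cast at h8 ⊢
  linarith

theorem IsPosSolution.mul_log_sub_sq_le (hk : 0 < k) (hr : 0 < r) (hn : 6 ≤ k + r) (ha : 0 < a)
    (hb : b < 0) (hc : 0 < c) (hs : IsPosSolution a b c k r s) (ht : IsPosSolution a b c k r t)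
    (e1 : ((k + r : ℕ) : ℝ) * (a * Real.exp (r * u)) = k * γ)
    (e2 : ((k + r : ℕ) : ℝ) * (c * Real.exp (-(k * u))) = r * γ) (hγ0 : 0 < γ) (hγ : -b < γ)
    (hm : midMonomial k r s ≤ midMonomial k r t) :
    (((k + r : ℕ) : ℝ) - 1) * (-b * midMonomial k r s) * |logRatio t - logRatio s| ^ 2 ≤ 11 := by
  obtain ⟨h1, -⟩ := hs.log_close_critical hk hr hn ha hc e1 e2 hγ0 hγ
  obtain ⟨h2, -⟩ := ht.log_close_critical hk hr hn ha hc e1 e2 hγ0 hγ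
  have hk1 : (1 : ℝ) ≤ k := by exact_mod_cast hk
  have hr1 : (1 : ℝ) ≤ r := by exact_mod_cast hr
  have hP : (0 : ℝ) < midMonomial k r s := by exact_mod_cast hs.midMonomial_pos
  have hm' : (midMonomial k r s : ℝ) ≤ midMonomial k r t := by exact_mod_cast hm
  have h3 : (k * r * (γ * midMonomial k r s)) * (logRatio t - u) ^ 2 ≤ 11 / 4 := by
    refine le_trans ?_ h2
    gcongr
  have h4 : (((k + r : ℕ) : ℝ) - 1) * (-b * midMonomial k r s)
      ≤ k * r * (γ * midMonomial k r s) := by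
    have hb' : (0 : ℝ) < -b := by
      have : (b : ℝ) < 0 := by exact_mod_cast hb
      linarith
    have : (((k + r : ℕ) : ℝ) - 1) ≤ k * r := by
      push_cast
      nlinarith
    gcongr
  set A := (k : ℝ) * r * (γ * midMonomial k r s) with hA
  have hA0 : 0 ≤ A := by positivity
  rw [sq_abs]
  calc _ ≤ A * (logRatio t - logRatio s) ^ 2 := by gcongr
    _ ≤ 11 := by
      have h5 : (logRatio t - logRatio s) ^ 2
          ≤ 2 * (logRatio t - u) ^ 2 + 2 * (logRatio s - u) ^ 2 := by
        nlinarith [sq_nonneg (logRatio t - u + (logRatio s - u))]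
      nlinarith [mul_le_mul_of_nonneg_left h5 hA0]

/-- The gap principle for a trinomial with positive minimum. -/
theorem IsPosSolution.gap_of_pos_minimum (hk : 0 < k) (hr : 0 < r) (hn : 6 ≤ k + r) (ha : 0 < a)
    (hb : b < 0) (hc : 0 < c) (hs : IsPosSolution a b c k r s) (ht : IsPosSolution a b c k r t)
    (hst : s ≠ t) (e1 : ((k + r : ℕ) : ℝ) * (a * Real.exp (r * u)) = k * γ)
    (e2 : ((k + r : ℕ) : ℝ) * (c * Real.exp (-(k * u))) = r * γ) (hγ0 : 0 < γ) (hγ : -b < γ)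
    (hm : midMonomial k r s ≤ midMonomial k r t) :
    (((k + r : ℕ) : ℝ) - 1) * (pairHeight s : ℝ) ^ (k + r - 2) ≤ 11 * (pairHeight t : ℝ) ^ 2 ∧
      (((k + r : ℕ) : ℝ) - 1) * -b ≤ 11 * ((pairHeight t : ℝ) + 1) ^ 2 := by
  have h1 := hs.mul_log_sub_sq_le hk hr hn ha hb hc ht e1 e2 hγ0 hγ hm
  have h2 := hs.one_le_height_mul_abs hk hr ht hst
  obtain ⟨h3, h4⟩ := hs.one_le_cross_mul_abs hk hr ht hst
  have h5 := hs.height_pow_le_mul_midMonomial ha hc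
  have hn6 : (6 : ℝ) ≤ ((k + r : ℕ) : ℝ) := by exact_mod_cast hn
  have hb' : (0 : ℝ) < -b := by
    have : (b : ℝ) < 0 := by exact_mod_cast hb
    linarith
  have hn0 : (0 : ℝ) ≤ ((k + r : ℕ) : ℝ) - 1 := by linarith
  have hY : 0 ≤ (((k + r : ℕ) : ℝ) - 1) * (-b * midMonomial k r s) := by positivity
  have hX : (2 : ℝ) ≤ pairHeight s := by exact_mod_cast hs.two_le_height
  constructor
  · have h6 := le_mul_sq_of_mul_sq_le hY h2 h1
    have h7 := (mul_le_mul_of_nonneg_left h5 hn0).trans h6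
    have h8 : (pairHeight s : ℝ) ^ (k + r) = (pairHeight s : ℝ) ^ (k + r - 2) * pairHeight s ^ 2 := by
      rw [← pow_add]
      congr 1
      omega
    rw [h8, mul_pow, ← mul_assoc, ← mul_assoc, mul_right_comm 11] at h7
    exact le_of_mul_le_mul_right h7 (by positivity)
  · have p1 : (1 : ℝ) ≤ s.1 := by exact_mod_cast hs.1
    have p2 : (1 : ℝ) ≤ s.2 := by exact_mod_cast hs.2.1
    have q1 : (0 : ℝ) ≤ t.1 := by positivity
    have q2 : (0 : ℝ) ≤ t.2 := by positivity
    have t1 : (t.1 : ℝ) ≤ pairHeight t := by exact_mod_cast le_max_left _ _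
    have t2 : (t.2 : ℝ) ≤ pairHeight t := by exact_mod_cast le_max_right _ _
    have hB : |(((k + r : ℕ) : ℝ) - 1) * -b| = (((k + r : ℕ) : ℝ) - 1) * -b :=
      abs_of_nonneg (by positivity)
    have hMid : |(((k + r : ℕ) : ℝ) - 1) * -b| * ((s.1 : ℝ) ^ k * (s.2 : ℝ) ^ r)
        = (((k + r : ℕ) : ℝ) - 1) * (-b * midMonomial k r s) := by
      rw [hB, midMonomial]
      push_cast
      ring
    refine (le_abs_self _).trans (abs_mid_coeff_le (k := k) (r := r) (by omega) p1 p2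
      (y₁ := t.1 + 1) (y₂ := t.2 + 1) (by positivity) (by positivity) (by linarith) (by linarith)
      (by norm_num) ?_ ?_)
    · rw [hMid]
      refine (le_mul_sq_of_mul_sq_le hY h3 h1).trans ?_
      gcongr
      linarith
    · rw [hMid]
      refine (le_mul_sq_of_mul_sq_le hY h4 h1).trans ?_
      gcongr
      linarith

/-- An upper bound for the solutions of a trinomial with positive minimum. -/
theorem IsPosSolution.height_le_of_pos_minimum (hk : 0 < k) (hr : 0 < r) (hn : 6 ≤ k + r)
    (ha : 0 < a) (hb : b < 0) (hc : 0 < c) (hs : IsPosSolution a b c k r s)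
    (e1 : ((k + r : ℕ) : ℝ) * (a * Real.exp (r * u)) = k * γ)
    (e2 : ((k + r : ℕ) : ℝ) * (c * Real.exp (-(k * u))) = r * γ) (hγ0 : 0 < γ)
    (e3 : (k : ℝ) ^ k * (r : ℝ) ^ r * γ ^ (k + r)
      = ((k + r : ℕ) : ℝ) ^ (k + r) * ((a : ℝ) ^ k * (c : ℝ) ^ r))
    (hd : (k : ℤ) ^ k * (r : ℤ) ^ r * (-b) ^ (k + r)
      < ((k + r : ℕ) : ℤ) ^ (k + r) * (a ^ k * c ^ r)) (hγ : -b < γ) :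
    (pairHeight s : ℝ) ≤ (k + r : ℕ) * (-b + 1) := by
  obtain ⟨-, h1⟩ := hs.log_close_critical hk hr hn ha hc e1 e2 hγ0 hγ
  have h5 := hs.height_pow_le_mul_midMonomial ha hc
  have hb' : (0 : ℝ) < -b := by
    have : (b : ℝ) < 0 := by exact_mod_cast hb
    linarith
  have hP : (1 : ℝ) ≤ midMonomial k r s := by exact_mod_cast hs.midMonomial_pos
  have hγ1 : γ ≤ -b + 1 := by nlinarith
  have hk0 : (0 : ℝ) < k := by exact_mod_cast hk
  have hr0 : (0 : ℝ) < r := by exact_mod_cast hr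
  have hd' : (k : ℝ) ^ k * (r : ℝ) ^ r * (-(b : ℝ)) ^ (k + r) + 1
      ≤ ((k + r : ℕ) : ℝ) ^ (k + r) * ((a : ℝ) ^ k * (c : ℝ) ^ r) := by
    exact_mod_cast Int.add_one_le_iff.2 hd
  rw [← e3] at hd'
  have h2 := pow_sub_pow_le_mul hb'.le hγ.le (k + r)
  set E := (k : ℝ) ^ k * (r : ℝ) ^ r with hE
  have hE0 : 0 < E := by positivity
  set P : ℝ := ((midMonomial k r s : ℕ) : ℝ)
  set n := k + r with hndef
  have h3 : 1 ≤ E * (n * γ ^ (n - 1) * (γ - -b)) := by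
    have := mul_le_mul_of_nonneg_left h2 hE0.le
    linarith
  have h4 : P ≤ E * (n * γ ^ (n - 1)) := by
    calc P ≤ P * (E * (n * γ ^ (n - 1) * (γ - -b))) := le_mul_of_one_le_right (by linarith) h3
      _ = E * (n * γ ^ (n - 1)) * ((γ - -b) * P) := by ring
      _ ≤ E * (n * γ ^ (n - 1)) * 1 := by gcongr
      _ = _ := mul_one _
  have h6 : (pairHeight s : ℝ) ^ n ≤ (n * γ) ^ n := by
    calc (pairHeight s : ℝ) ^ n ≤ -b * P := h5
      _ ≤ γ * (E * (n * γ ^ (n - 1))) := by gcongr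
      _ = (n * E) * γ ^ n := by
        rw [← Nat.sub_add_cancel (show 1 ≤ n by omega), pow_succ]
        push_cast
        ring
      _ ≤ (n : ℝ) ^ n * γ ^ n := by
        gcongr
        exact mul_pow_mul_pow_le k r hk hr
      _ = _ := (mul_pow _ _ _).symm
  have h7 := le_of_pow_le_pow_left₀ (by omega) (by positivity) h6
  exact h7.trans (by gcongr)

end PositiveMinimum

theorem eleven_mul_sq_le_two_pow (n : ℕ) (hn : 9 ≤ n) :
    11 * (n : ℝ) ^ 2 ≤ ((n : ℝ) - 1) * 2 ^ (n - 2) := by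
  induction n, hn using Nat.le_induction with
  | base => norm_num
  | succ m hm ih =>
    have h1 : (9 : ℝ) ≤ m := by exact_mod_cast hm
    rw [show m + 1 - 2 = (m - 2) + 1 by omega, pow_succ (2 : ℝ)]
    push_cast
    have h2 : (0 : ℝ) ≤ 2 ^ (m - 2) := by positivity
    nlinarith

theorem no_growth_small {n : ℕ} {B : ℝ} {x : ℕ → ℝ} (hn : 6 ≤ n) (hn' : n ≤ 7)
    (h2 : 2 ≤ x 0) (hx : ∀ i ≤ 4, 1 ≤ x i)
    (hg : ∀ i < 4, ((n : ℝ) - 1) * x i ^ (n - 2) ≤ 11 * x (i + 1) ^ 2)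
    (hB : ((n : ℝ) - 1) * B ≤ 11 * (x 1 + 1) ^ 2) (hu : x 4 ≤ n * (B + 1))
    (h3 : 8 / 3 < x 1 → 3 ≤ x 1) : False := by
  have hg' : ∀ i < 4, 5 / 11 * x i ^ 4 ≤ x (i + 1) ^ 2 := by
    intro i hi
    have h4 : x i ^ 4 ≤ x i ^ (n - 2) := pow_le_pow_right₀ (hx i hi.le) (by omega)
    have h5 : (5 : ℝ) ≤ (n : ℝ) - 1 := by
      have : (6 : ℝ) ≤ n := by exact_mod_cast hn
      linarith
    have h6 := hg i hi
    have h7 : 5 * x i ^ 4 ≤ ((n : ℝ) - 1) * x i ^ (n - 2) := by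
      have : 0 ≤ x i ^ 4 := by positivity
      gcongr
    linarith
  have x1 : 3 ≤ x 1 := by
    apply h3
    have h8 := hg' 0 (by norm_num)
    have h9 : (2 : ℝ) ^ 4 ≤ x 0 ^ 4 := by gcongr
    have h10 := hx 1 (by norm_num)
    norm_num at h8 h9
    nlinarith
  have a1 := hg' 1 (by norm_num)
  have a2 := hg' 2 (by norm_num)
  have a3 := hg' 3 (by norm_num)
  norm_num at a1 a2 a3
  have b2 : (5 / 11 : ℝ) ^ 3 * x 1 ^ 8 ≤ x 3 ^ 2 := by
    have : (5 / 11 * x 1 ^ 4) ^ 2 ≤ (x 2 ^ 2) ^ 2 := by gcongr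
    nlinarith
  have b3 : (5 / 11 : ℝ) ^ 7 * x 1 ^ 16 ≤ x 4 ^ 2 := by
    have : ((5 / 11 : ℝ) ^ 3 * x 1 ^ 8) ^ 2 ≤ (x 3 ^ 2) ^ 2 := by gcongr
    nlinarith
  have hu' : x 4 ≤ 29 * x 1 ^ 2 := by
    have h6 : (6 : ℝ) ≤ n := by exact_mod_cast hn
    have h7 : (n : ℝ) ≤ 7 := by exact_mod_cast hn'
    rcases le_total B 0 with h0 | h0
    · nlinarith
    · have hB5 : 5 * B ≤ 11 * (x 1 + 1) ^ 2 := by nlinarith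
      have hu7 : x 4 ≤ 7 * (B + 1) := by nlinarith
      nlinarith
  have c1 : x 4 ^ 2 ≤ (29 * x 1 ^ 2) ^ 2 := by
    have := hx 4 le_rfl
    gcongr
  have c2 : (3 : ℝ) ^ 12 ≤ x 1 ^ 12 := by gcongr
  have c3 : 0 < x 1 ^ 4 := by positivity
  have c4 : x 1 ^ 16 = x 1 ^ 12 * x 1 ^ 4 := by ring
  have c5 : (3 : ℝ) ^ 12 * x 1 ^ 4 ≤ x 1 ^ 16 := by rw [c4]; gcongr
  norm_num at b3 c5
  nlinarith

theorem no_growth_eight {B : ℝ} {x : ℕ → ℝ}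
    (h2 : 2 ≤ x 0) (hx : ∀ i ≤ 3, 1 ≤ x i)
    (hg : ∀ i < 3, 7 * x i ^ 6 ≤ 11 * x (i + 1) ^ 2)
    (hB : 7 * B ≤ 11 * (x 1 + 1) ^ 2) (hu : x 3 ≤ 8 * (B + 1)) : False := by
  have a0 := hg 0 (by norm_num)
  have a1 := hg 1 (by norm_num)
  have a2 := hg 2 (by norm_num)
  norm_num at a0 a1 a2
  have x1 : 6 ≤ x 1 := by
    have h9 : (2 : ℝ) ^ 6 ≤ x 0 ^ 6 := by gcongr
    have h10 := hx 1 (by norm_num)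
    nlinarith
  have b2 : (7 / 11 : ℝ) ^ 4 * x 1 ^ 18 ≤ x 3 ^ 2 := by
    have : (7 / 11 * x 1 ^ 6) ^ 3 ≤ (x 2 ^ 2) ^ 3 := by
      gcongr
      linarith
    nlinarith
  have hu' : x 3 ≤ 18 * x 1 ^ 2 := by nlinarith
  have c1 : x 3 ^ 2 ≤ (18 * x 1 ^ 2) ^ 2 := by
    have := hx 3 le_rfl
    gcongr
  have c2 : (6 : ℝ) ^ 14 ≤ x 1 ^ 14 := by gcongr
  have c3 : 0 < x 1 ^ 4 := by positivity
  have c5 : (6 : ℝ) ^ 14 * x 1 ^ 4 ≤ x 1 ^ 18 := by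
    rw [show x 1 ^ 18 = x 1 ^ 14 * x 1 ^ 4 by ring]
    gcongr
  norm_num at b2 c5
  nlinarith

theorem no_growth_large {n : ℕ} {B : ℝ} {x : ℕ → ℝ} (hn : 9 ≤ n)
    (h2 : 2 ≤ x 0) (hx : ∀ i ≤ 2, 1 ≤ x i)
    (hg : ∀ i < 2, ((n : ℝ) - 1) * x i ^ (n - 2) ≤ 11 * x (i + 1) ^ 2)
    (hB : ((n : ℝ) - 1) * B ≤ 11 * (x 1 + 1) ^ 2) (hu : x 2 ≤ n * (B + 1))
    (h10 : 9 < x 1 → 10 ≤ x 1) : False := by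
  have a0 := hg 0 (by norm_num)
  have a1 := hg 1 (by norm_num)
  norm_num at a0 a1
  have hn9 : (9 : ℝ) ≤ n := by exact_mod_cast hn
  have hx1 := hx 1 (by norm_num)
  have hxn : (n : ℝ) ≤ x 1 := by
    have h3 := eleven_mul_sq_le_two_pow n hn
    have h4 : ((n : ℝ) - 1) * 2 ^ (n - 2) ≤ ((n : ℝ) - 1) * x 0 ^ (n - 2) := by
      have : (0 : ℝ) ≤ (n : ℝ) - 1 := by linarith
      gcongr
    exact le_of_sq_le_sq (by linarith) (by linarith)
  have hx9 : 9 < x 1 := by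
    rcases hn.lt_or_eq with h | h
    · have : (10 : ℝ) ≤ n := by exact_mod_cast h
      linarith
    · subst h
      norm_num at a0
      have h9 : (2 : ℝ) ^ 7 ≤ x 0 ^ 7 := by gcongr
      nlinarith
  have x1 := h10 hx9
  have hnB : n * B ≤ 99 / 8 * (x 1 + 1) ^ 2 := by
    have : 0 ≤ (x 1 + 1) ^ 2 := by positivity
    rcases le_total B 0 with h0 | h0
    · nlinarith
    · nlinarith
  have hu' : x 2 ≤ 16 * x 1 ^ 2 := by nlinarith
  have c1 : x 2 ^ 2 ≤ (16 * x 1 ^ 2) ^ 2 := by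
    have := hx 2 le_rfl
    gcongr
  have c2 : x 1 ^ 7 ≤ x 1 ^ (n - 2) := pow_le_pow_right₀ hx1 (by omega)
  have c3 : 8 * x 1 ^ 7 ≤ ((n : ℝ) - 1) * x 1 ^ (n - 2) := by
    exact mul_le_mul (by linarith) c2 (by positivity) (by linarith)
  have c4 : (10 : ℝ) ^ 3 * x 1 ^ 4 ≤ x 1 ^ 7 := by
    rw [show x 1 ^ 7 = x 1 ^ 3 * x 1 ^ 4 by ring]
    gcongr
  have c5 : 0 < x 1 ^ 4 := by positivity
  norm_num at c4
  nlinarith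

theorem card_le_ell {a b c : ℤ} {k r : ℕ} (hk : 0 < k) (hr : 0 < r) (hn : 6 ≤ k + r) (ha : 0 < a)
    (hb : b < 0) (hc : 0 < c) (hd : (k : ℤ) ^ k * (r : ℤ) ^ r * (-b) ^ (k + r)
      < ((k + r : ℕ) : ℤ) ^ (k + r) * (a ^ k * c ^ r)) (S : Finset (ℕ × ℕ))
    (hS : ∀ s ∈ S, IsPosSolution a b c k r s) : S.card ≤ ell (k + r) := by
  by_contra hcard
  push Not at hcard
  have ha' : (0 : ℝ) < a := by exact_mod_cast ha
  have hc' : (0 : ℝ) < c := by exact_mod_cast hc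
  have hb' : (0 : ℝ) < -b := by
    have : (b : ℝ) < 0 := by exact_mod_cast hb
    linarith
  have hk0 : (0 : ℝ) < k := by exact_mod_cast hk
  have hr0 : (0 : ℝ) < r := by exact_mod_cast hr
  obtain ⟨u, γ, hγ0, e1, e2, e3⟩ := exists_log_critical hk hr ha' hc'
  have hγ : -b < γ := by
    have hd' : (k : ℝ) ^ k * (r : ℝ) ^ r * (-(b : ℝ)) ^ (k + r)
        < ((k + r : ℕ) : ℝ) ^ (k + r) * ((a : ℝ) ^ k * (c : ℝ) ^ r) := by exact_mod_cast hd
    rw [← e3] at hd'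
    exact lt_of_pow_lt_pow_left₀ _ hγ0.le (lt_of_mul_lt_mul_left hd' (by positivity))
  obtain ⟨s, hsS, hs⟩ := exists_monotone_sequence S (midMonomial k r) (ell (k + r)) hcard
  have hsol : ∀ i ≤ ell (k + r), IsPosSolution a b c k r (s i) := fun i hi => hS _ (hsS i hi)
  have hgap : ∀ i < ell (k + r), (((k + r : ℕ) : ℝ) - 1) * (pairHeight (s i) : ℝ) ^ (k + r - 2)
      ≤ 11 * (pairHeight (s (i + 1)) : ℝ) ^ 2 ∧
      (((k + r : ℕ) : ℝ) - 1) * -b ≤ 11 * ((pairHeight (s (i + 1)) : ℝ) + 1) ^ 2 := by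
    intro i hi
    obtain ⟨h1, h2⟩ := hs i (i + 1) (by omega) hi
    exact (hsol i hi.le).gap_of_pos_minimum hk hr hn ha hb hc (hsol (i + 1) hi) h1 e1 e2 hγ0 hγ h2
  have hup := (hsol _ le_rfl).height_le_of_pos_minimum hk hr hn ha hb hc e1 e2 hγ0 e3 hd hγ
  have hX : ∀ i ≤ ell (k + r), (2 : ℝ) ≤ pairHeight (s i) := fun i hi => by
    exact_mod_cast (hsol i hi).two_le_height
  generalize k + r = n at *
  have hl : 0 < ell n := by
    unfold ell
    split_ifs <;> norm_num
  have hX1 : ∀ i ≤ ell n, (1 : ℝ) ≤ pairHeight (s i) := fun i hi => by linarith [hX i hi]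
  have hB := (hgap 0 hl).2
  rcases le_or_gt n 7 with h7 | h7
  · have hl4 : ell n = 4 := if_pos h7
    rw [hl4] at hX hX1 hgap hup
    refine no_growth_small (x := fun i => (pairHeight (s i) : ℝ)) hn h7 (hX 0 (by norm_num)) hX1
      (fun i hi => (hgap i hi).1) hB hup fun h => ?_
    have : (2 : ℝ) < pairHeight (s 1) := lt_trans (by norm_num) h
    have : 2 < pairHeight (s 1) := by exact_mod_cast this
    exact_mod_cast this
  rcases eq_or_ne n 8 with rfl | h8
  · have hl3 : ell 8 = 3 := rfl
    rw [hl3] at hX hX1 hgap hup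
    norm_num at hgap hB hup
    exact no_growth_eight (x := fun i => (pairHeight (s i) : ℝ)) (B := -b) (hX 0 (by norm_num)) hX1
      (fun i hi => (hgap i hi).1) (by linarith) (by linarith)
  · have hl2 : ell n = 2 := by
      unfold ell
      rw [if_neg (by omega), if_neg h8]
    rw [hl2] at hX hX1 hgap hup
    refine no_growth_large (x := fun i => (pairHeight (s i) : ℝ)) (by omega) (hX 0 (by norm_num)) hX1
      (fun i hi => (hgap i hi).1) hB hup fun h => ?_
    have : 9 < pairHeight (s 1) := by exact_mod_cast h
    exact_mod_cast this

theorem IsProperCriticalPoint.neg {g : ℝ[X]} {τ : ℝ} (h : IsProperCriticalPoint g τ) :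
    IsProperCriticalPoint (-g) τ := by
  obtain ⟨h1, U, hU, h2⟩ := h
  refine ⟨by simp [h1], U, hU, fun x hx hne => ?_⟩
  simpa using h2 x hx hne

theorem IsProperCriticalPoint.of_comp_neg {g : ℝ[X]} {τ : ℝ}
    (h : IsProperCriticalPoint (g.comp (-X)) τ) : IsProperCriticalPoint g (-τ) := by
  obtain ⟨h1, U, hU, h2⟩ := h
  simp [derivative_comp] at h1 h2
  refine ⟨h1, Neg.neg ⁻¹' U, continuous_neg.continuousAt.preimage_mem_nhds (by simpa using hU),
    fun x hx hne => ?_⟩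
  simpa using h2 (-x) hx (by rintro rfl; simp at hne)

theorem isProperCriticalPoint_of_pos {g : ℝ[X]} {τ : ℝ} (h : g.derivative.eval τ = 0)
    (h' : 0 < g.derivative.derivative.eval τ * g.eval τ) : IsProperCriticalPoint g τ := by
  refine ⟨h, {x | 0 < g.derivative.derivative.eval x * g.eval x}, ?_, fun x hx _ => hx⟩
  have hcont : Continuous fun x => g.derivative.derivative.eval x * g.eval x := by fun_prop
  exact hcont.continuousAt.eventually (lt_mem_nhds h')

/-- The real trinomial `a x^(k+r) + b x^k + c`. -/
noncomputable def realTrinomial (a b c : ℤ) (k r : ℕ) : ℝ[X] :=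
  C (a : ℝ) * X ^ (k + r) + C (b : ℝ) * X ^ k + C (c : ℝ)

section HalfLine

variable {a b c : ℤ} {k r : ℕ}

theorem isProperCriticalPoint_of_trinomial_pos (hk : 0 < k) (hr : 0 < r) (hb : b < 0) {τ : ℝ}
    (hτ0 : 0 < τ) (hτ : ((k + r : ℕ) : ℝ) * a * τ ^ r = k * -b)
    (hpos : 0 < a * τ ^ (k + r) + b * τ ^ k + c) :
    IsProperCriticalPoint (realTrinomial a b c k r) τ := by
  have hb' : (0 : ℝ) < -b := by
    have : (b : ℝ) < 0 := by exact_mod_cast hb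
    linarith
  have hk0 : (0 : ℝ) < k := by exact_mod_cast hk
  have hr0 : (0 : ℝ) < r := by exact_mod_cast hr
  have key : ∀ m : ℕ, 0 < m → τ ^ 2 * (m * (((m - 1 : ℕ) : ℝ) * τ ^ (m - 1 - 1)))
      = m * (m - 1) * τ ^ m := by
    intro m hm
    obtain ⟨m, rfl⟩ : ∃ j, m = j + 1 := ⟨m - 1, by omega⟩
    rcases m with _ | m
    · simp
    · rw [show m + 1 + 1 - 1 = m + 1 from rfl, show m + 1 - 1 = m from rfl]
      push_cast
      ring
  refine isProperCriticalPoint_of_pos ?_ (mul_pos ?_ ?_)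
  · have e : (a : ℝ) * (((k + r : ℕ) : ℝ) * τ ^ (k + r - 1)) + b * (k * τ ^ (k - 1)) = 0 := by
      rw [show k + r - 1 = (k - 1) + r by omega, pow_add]
      linear_combination τ ^ (k - 1) * hτ
    simpa [realTrinomial, derivative_X_pow] using e
  · have e : τ ^ 2 * ((realTrinomial a b c k r).derivative.derivative.eval τ)
        = k * -b * r * τ ^ k := by
      have e1 := key (k + r) (by omega)
      have e2 := key k hk
      have e3 : (realTrinomial a b c k r).derivative.derivative.eval τ
          = a * (((k + r : ℕ) : ℝ) * (((k + r - 1 : ℕ) : ℝ) * τ ^ (k + r - 1 - 1)))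
            + b * (k * (((k - 1 : ℕ) : ℝ) * τ ^ (k - 1 - 1))) := by
        simp [realTrinomial, derivative_X_pow]
      rw [e3, mul_add, mul_left_comm, e1, mul_left_comm (τ ^ 2), e2, pow_add]
      push_cast at hτ ⊢
      linear_combination ((k : ℝ) + r - 1) * τ ^ k * hτ
    refine pos_of_mul_pos_right (a := τ ^ 2) ?_ (by positivity)
    rw [e]
    positivity
  · simpa [realTrinomial] using hpos

theorem not_isPosSolution_of_pos (ha : 0 < a) (hb : 0 < b) (hc : 0 < c) (s : ℕ × ℕ) :
    ¬ IsPosSolution a b c k r s := by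
  rintro ⟨h1, h2, -, h4⟩
  have h1' : (0 : ℤ) < s.1 := by exact_mod_cast h1
  have h2' : (0 : ℤ) < s.2 := by exact_mod_cast h2
  have e1 : 0 < a * (s.1 : ℤ) ^ (k + r) := by positivity
  have e2 : 0 < b * (s.1 : ℤ) ^ k * (s.2 : ℤ) ^ r := by positivity
  have e3 : 0 < c * (s.2 : ℤ) ^ (k + r) := by positivity
  have := h4 ▸ le_abs_self (a * (s.1 : ℤ) ^ (k + r) + b * (s.1 : ℤ) ^ k * (s.2 : ℤ) ^ r
      + c * (s.2 : ℤ) ^ (k + r))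
  omega

/-- The number of positive solutions is bounded in terms of the positive roots and the positive
proper critical points. -/
def HasPositiveBound (a b c : ℤ) (k r : ℕ) : Prop :=
  ∃ R T : Finset ℝ, (∀ x ∈ R, 0 < x ∧ (realTrinomial a b c k r).eval x = 0) ∧
    (∀ x ∈ T, 0 < x ∧ IsProperCriticalPoint (realTrinomial a b c k r) x) ∧
    ∀ S : Finset (ℕ × ℕ), (∀ s ∈ S, IsPosSolution a b c k r s) →
      S.card ≤ z (k + r) * R.card + ell (k + r) * T.card

theorem hasPositiveBound_of_pos (hk : 0 < k) (hr : 0 < r) (hn : 6 ≤ k + r) (ha : 0 < a)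
    (hb : b ≠ 0) (hc : c ≠ 0) (hirr : IrreducibleTrinomials a b c k r) :
    HasPositiveBound a b c k r := by
  rcases hc.lt_or_gt with hc | hc
  · obtain ⟨α, hα0, hα⟩ := exists_pos_root_of_opposite_signs (b := b) hk hr ha hc
    refine ⟨{α}, ∅, ?_, by simp, fun S hS => ?_⟩
    · simpa [realTrinomial] using ⟨hα0, hα⟩
    · simpa using card_le_z_of_opposite_signs hk hr hn ha hb hc hirr hα0 hα S hS
  rcases hb.lt_or_gt with hb | hb
  · rcases lt_or_gt_of_ne (hirr.discriminant_ne hk hr ha hb hc) with hd | hd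
    · have ha' : (0 : ℝ) < a := by exact_mod_cast ha
      have hb' : (b : ℝ) < 0 := by exact_mod_cast hb
      obtain ⟨τ, hτ0, hτ⟩ := exists_trinomial_critical hk hr ha' hb'
      refine ⟨∅, {τ}, by simp, ?_, fun S hS => ?_⟩
      · simpa using ⟨hτ0, isProperCriticalPoint_of_trinomial_pos hk hr hb hτ0 hτ
          (trinomial_critical_pos_of_lt hk ha hc hτ hd)⟩
      · simpa using card_le_ell hk hr hn ha hb hc hd S hS
    · obtain ⟨α, β, hα0, hαβ, hα, hβ, h⟩ := card_le_two_mul_z hk hr hn ha hb hc hirr hd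
      refine ⟨{α, β}, ∅, ?_, by simp, fun S hS => ?_⟩
      · simpa [realTrinomial] using ⟨⟨hα0, hα⟩, hα0.trans hαβ, hβ⟩
      · rw [Finset.card_pair hαβ.ne, mul_comm]
        simpa using h S hS
  · refine ⟨∅, ∅, by simp, by simp, fun S hS => ?_⟩
    rw [Finset.eq_empty_of_forall_notMem fun s hs => not_isPosSolution_of_pos ha hb hc s (hS s hs)]
    simp

theorem realTrinomial_neg : realTrinomial (-a) (-b) (-c) k r = -realTrinomial a b c k r := by
  simp only [realTrinomial, Int.cast_neg, C_neg]
  ring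

theorem IrreducibleTrinomials.neg (h : IrreducibleTrinomials a b c k r) :
    IrreducibleTrinomials (-a) (-b) (-c) k r := by
  unfold IrreducibleTrinomials
  simp only [Int.cast_neg, C_neg, neg_mul, ← neg_add]
  exact ⟨(Associated.refl _).neg_right.irreducible h.1, (Associated.refl _).neg_right.irreducible h.2⟩

theorem isPosSolution_neg_iff {s : ℕ × ℕ} :
    IsPosSolution (-a) (-b) (-c) k r s ↔ IsPosSolution a b c k r s := by
  unfold IsPosSolution
  simp only [neg_mul, ← neg_add, abs_neg]

theorem hasPositiveBound (hk : 0 < k) (hr : 0 < r) (hn : 6 ≤ k + r) (ha : a ≠ 0)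
    (hb : b ≠ 0) (hc : c ≠ 0) (hirr : IrreducibleTrinomials a b c k r) :
    HasPositiveBound a b c k r := by
  rcases ha.lt_or_gt with ha | ha
  · obtain ⟨R, T, hR, hT, h⟩ := hasPositiveBound_of_pos hk hr hn (neg_pos.2 ha) (neg_ne_zero.2 hb)
      (neg_ne_zero.2 hc) hirr.neg
    rw [realTrinomial_neg] at hR hT
    refine ⟨R, T, fun x hx => ?_, fun x hx => ?_, fun S hS => ?_⟩
    · simpa using hR x hx
    · obtain ⟨h1, h2⟩ := hT x hx
      exact ⟨h1, by simpa using h2.neg⟩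
    · exact h S fun s hs => isPosSolution_neg_iff.2 (hS s hs)
  · exact hasPositiveBound_of_pos hk hr hn ha hb hc hirr

end HalfLine

theorem Irreducible.of_homogenize {f : ℤ[X]} (hf : f.natDegree ≠ 0)
    (h : Irreducible (f.homogenize f.natDegree)) : Irreducible f := by
  have hf0 : f ≠ 0 := by rintro rfl; simp at hf
  have key : ∀ g : ℤ[X], IsUnit (g.homogenize g.natDegree) → IsUnit g := fun g hg => by
    have := hg.map (MvPolynomial.aeval ![(X : ℤ[X]), 1])
    rwa [aeval_homogenize_X_one g le_rfl] at this
  refine ⟨not_isUnit_of_natDegree_pos f (Nat.pos_of_ne_zero hf), fun g q hgq => ?_⟩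
  have hg : g ≠ 0 := by rintro rfl; simp at hgq; exact hf0 hgq
  have hq : q ≠ 0 := by rintro rfl; simp at hgq; exact hf0 hgq
  have e : f.homogenize f.natDegree
      = g.homogenize g.natDegree * q.homogenize q.natDegree := by
    rw [← homogenize_mul g q le_rfl le_rfl, ← natDegree_mul hg hq, ← hgq]
  exact (h.isUnit_or_isUnit e).imp (key g) (key q)

section Trinomial

variable {a b c : ℤ} {k r : ℕ}

theorem irreducible_trinomial_of_binary_form (hk : 0 < k) (hr : 0 < r) (ha : a ≠ 0)
    (h : Irreducible (MvPolynomial.C a * MvPolynomial.X 0 ^ (k + r)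
      + MvPolynomial.C b * MvPolynomial.X 0 ^ k * MvPolynomial.X 1 ^ r
      + MvPolynomial.C c * MvPolynomial.X 1 ^ (k + r) : MvPolynomial (Fin 2) ℤ)) :
    Irreducible (C (a : ℚ) * X ^ (k + r) + C (b : ℚ) * X ^ k + C (c : ℚ)) := by
  set f : ℤ[X] := C a * X ^ (k + r) + C b * X ^ k + C c with hf
  have hdeg : f.natDegree = k + r := by
    rw [hf, add_assoc, natDegree_add_eq_left_of_natDegree_lt]
    · exact natDegree_C_mul_X_pow _ _ ha
    · rw [natDegree_C_mul_X_pow _ _ ha]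
      have : (C b * X ^ k + C c : ℤ[X]).natDegree ≤ k := by compute_degree
      omega
  have hirr : Irreducible f := by
    refine Irreducible.of_homogenize (by omega) ?_
    rw [hdeg, hf]
    simp only [homogenize_add, homogenize_C_mul, homogenize_X_pow le_rfl,
      homogenize_X_pow (Nat.le_add_right k r), homogenize_C, Nat.sub_self, pow_zero, mul_one,
      Nat.add_sub_cancel_left, ← mul_assoc]
    exact h
  have := (IsPrimitive.Int.irreducible_iff_irreducible_map_cast
    (hirr.isPrimitive (by omega))).1 hirr
  simpa [hf] using this

theorem irreducibleTrinomials_of_binary_form (hk : 0 < k) (hr : 0 < r) (ha : a ≠ 0) (hc : c ≠ 0)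
    (h : Irreducible (MvPolynomial.C a * MvPolynomial.X 0 ^ (k + r)
      + MvPolynomial.C b * MvPolynomial.X 0 ^ k * MvPolynomial.X 1 ^ r
      + MvPolynomial.C c * MvPolynomial.X 1 ^ (k + r) : MvPolynomial (Fin 2) ℤ)) :
    IrreducibleTrinomials a b c k r := by
  refine ⟨irreducible_trinomial_of_binary_form hk hr ha h, ?_⟩
  have h' := (MulEquiv.irreducible_iff
    (MvPolynomial.renameEquiv ℤ (Equiv.swap (0 : Fin 2) 1))).2 h
  rw [add_comm k r]
  refine irreducible_trinomial_of_binary_form hr hk hc ?_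
  convert h' using 1
  simp
  rw [add_comm r k]
  ring

theorem IrreducibleTrinomials.comp_neg (h : IrreducibleTrinomials a b c k r) :
    IrreducibleTrinomials ((-1) ^ (k + r) * a) ((-1) ^ k * b) c k r := by
  obtain ⟨h1, h2⟩ := h
  have e1 := (MulEquiv.irreducible_iff (algEquivAevalNegX (R := ℚ))).2 h1
  have e2 := (MulEquiv.irreducible_iff (algEquivAevalNegX (R := ℚ))).2 h2
  refine ⟨?_, ?_⟩
  · convert e1 using 1
    simp [algEquivAevalNegX, neg_pow (X : ℚ[X])]
    ring
  · have hu : IsUnit ((-1 : ℚ[X]) ^ (k + r)) := isUnit_one.neg.pow _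
    refine (irreducible_isUnit_mul hu).2 e2 |> fun h3 => ?_
    convert h3 using 1
    have hs : ∀ m : ℕ, (-1 : ℚ[X]) ^ m * (-1) ^ m = 1 := fun m => by
      rw [← mul_pow]; simp
    simp [algEquivAevalNegX, neg_pow (X : ℚ[X]), mul_add]
    rw [pow_add (-1 : ℚ[X])]
    linear_combination -((c : ℚ[X]) * X ^ (k + r)) * (hs k)
      - (c : ℚ[X]) * X ^ (k + r) * ((-1) ^ k * (-1) ^ k) * hs r - (b : ℚ[X]) * X ^ r * (-1) ^ k * hs r

end Trinomial

theorem realTrinomial_comp_neg (a b c : ℤ) (k r : ℕ) :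
    realTrinomial ((-1) ^ (k + r) * a) ((-1) ^ k * b) c k r = (realTrinomial a b c k r).comp (-X) := by
  simp [realTrinomial, neg_pow (X : ℝ[X])]
  ring

theorem Finset.card_add_card_neg_le_ncard {P N : Finset ℝ} {A : Set ℝ} (hA : A.Finite)
    (hP : ∀ x ∈ P, 0 < x ∧ x ∈ A) (hN : ∀ x ∈ N, 0 < x ∧ -x ∈ A) :
    P.card + N.card ≤ A.ncard := by
  have hd : Disjoint P (N.map (Equiv.neg ℝ).toEmbedding) := by
    rw [Finset.disjoint_left]
    intro x hx hx'
    obtain ⟨y, hy, rfl⟩ := Finset.mem_map.1 hx'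
    have h1 := (hP _ hx).1
    have h2 := (hN _ hy).1
    simp at h1
    linarith
  rw [← Finset.card_map (Equiv.neg ℝ).toEmbedding (s := N), ← Finset.card_union_of_disjoint hd,
    ← Set.ncard_coe_finset]
  refine Set.ncard_le_ncard ?_ hA
  intro x hx
  rcases Finset.mem_union.1 (Finset.mem_coe.1 hx) with hx | hx
  · exact (hP x hx).2
  · obtain ⟨y, hy, rfl⟩ := Finset.mem_map.1 hx
    exact (hN y hy).2

theorem isPosSolution_natAbs {a b c : ℤ} {k r : ℕ} {p : ℤ × ℤ} (h1 : p.1 ≠ 0) (h2 : 0 < p.2)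
    (h3 : |p.1| ≠ p.2)
    (h : |a * |p.1| ^ (k + r) + b * |p.1| ^ k * p.2 ^ r + c * p.2 ^ (k + r)| = 1) :
    IsPosSolution a b c k r (p.1.natAbs, p.2.natAbs) := by
  refine ⟨Int.natAbs_pos.2 h1, Int.natAbs_pos.2 h2.ne', fun e => h3 ?_, ?_⟩
  · have : |p.1| = |p.2| := by rw [Int.abs_eq_natAbs, Int.abs_eq_natAbs]; exact congrArg Nat.cast e
    rwa [abs_of_pos h2] at this
  · simpa only [Int.natCast_natAbs, abs_of_pos h2] using h

theorem stmt2 (hn hk h0 : ℤ) (n k : ℕ) (hk0 : 0 < k) (hkn : k < n) (hn6 : 6 ≤ n)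
    (hhn : hn ≠ 0) (hhk : hk ≠ 0) (hh0 : h0 ≠ 0)
    (hirr : Irreducible
      (MvPolynomial.C hn * MvPolynomial.X 0 ^ n
        + MvPolynomial.C hk * MvPolynomial.X 0 ^ k * MvPolynomial.X 1 ^ (n - k)
        + MvPolynomial.C h0 * MvPolynomial.X 1 ^ n : MvPolynomial (Fin 2) ℤ))
    (f : Polynomial ℝ)
    (hf : f = C (hn : ℝ) * X ^ n + C (hk : ℝ) * X ^ k + C (h0 : ℝ)) :
    {p : ℤ × ℤ | |hn * p.1 ^ n + hk * p.1 ^ k * p.2 ^ (n - k) + h0 * p.2 ^ n| = 1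
        ∧ p.1 ≠ 0 ∧ 0 < p.2 ∧ |p.1| ≠ p.2}.encard
      ≤ ((z n * {x : ℝ | f.eval x = 0}.ncard
          + ell n * {τ : ℝ | IsProperCriticalPoint f τ}.ncard : ℕ) : ℕ∞) := by
  obtain ⟨r, rfl⟩ := Nat.exists_eq_add_of_lt hkn
  rw [show k + r + 1 = k + (r + 1) from rfl, Nat.add_sub_cancel_left] at *
  generalize hs : r + 1 = s at *
  have hs0 : 0 < s := by omega
  replace hf : f = realTrinomial hn hk h0 k s := hf
  have hI := irreducibleTrinomials_of_binary_form hk0 hs0 hhn hh0 hirr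
  obtain ⟨R, T, hR, hT, hS⟩ := hasPositiveBound hk0 hs0 hn6 hhn hhk hh0 hI
  obtain ⟨R', T', hR', hT', hS'⟩ := hasPositiveBound hk0 hs0 hn6
    (mul_ne_zero (pow_ne_zero _ (by norm_num)) hhn)
    (mul_ne_zero (pow_ne_zero _ (by norm_num)) hhk) hh0 hI.comp_neg
  rw [realTrinomial_comp_neg, ← hf] at hR' hT'
  rw [← hf] at hR hT
  have hdeg : f.natDegree = k + s := by
    rw [hf, realTrinomial, add_assoc, natDegree_add_eq_left_of_natDegree_lt]
    · exact natDegree_C_mul_X_pow _ _ (by exact_mod_cast hhn)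
    · rw [natDegree_C_mul_X_pow _ _ (by exact_mod_cast hhn)]
      have : (C (hk : ℝ) * X ^ k + C (h0 : ℝ)).natDegree ≤ k := by compute_degree
      omega
  have hf0 : f ≠ 0 := by rintro rfl; simp at hdeg; omega
  have hf1 : derivative f ≠ 0 := fun h => by
    have := derivative_eq_zero.1 h
    omega
  have hroots : R.card + R'.card ≤ {x : ℝ | f.eval x = 0}.ncard :=
    Finset.card_add_card_neg_le_ncard (f.finite_setOfPred_isRoot hf0) hR
      (fun x hx => by simpa using hR' x hx)
  have hcrit : T.card + T'.card ≤ {τ : ℝ | IsProperCriticalPoint f τ}.ncard :=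
    Finset.card_add_card_neg_le_ncard
      ((finite_setOfPred_isRoot hf1).subset fun x hx => hx.1) hT
      (fun x hx => ⟨(hT' x hx).1, (hT' x hx).2.of_comp_neg⟩)
  by_contra! hlt
  obtain ⟨U, hU, hUcard⟩ := Set.exists_subset_encard_eq (Order.add_one_le_of_lt hlt)
  have hUfin : U.Finite := Set.finite_of_encard_eq_coe (k := z (k + s) * _ + ell (k + s) * _ + 1)
    (by rw [hUcard]; norm_cast)
  lift U to Finset (ℤ × ℤ) using hUfin
  rw [Set.encard_coe_eq_coe_finsetCard] at hUcard
  norm_cast at hUcard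
  have hsplit := Finset.card_filter_add_card_filter_not (s := U) (fun p => 0 < p.1)
  set φ : ℤ × ℤ → ℕ × ℕ := fun p => (p.1.natAbs, p.2.natAbs) with hφ
  have hpos : (U.filter fun p => 0 < p.1).card ≤ z (k + s) * R.card + ell (k + s) * T.card := by
    rw [← Finset.card_image_of_injOn (f := φ)]
    · refine hS _ fun t ht => ?_
      obtain ⟨p, hp, rfl⟩ := Finset.mem_image.1 ht
      obtain ⟨hpU, hp0⟩ := Finset.mem_filter.1 hp
      obtain ⟨e1, e2, e3, e4⟩ := hU hpU
      exact isPosSolution_natAbs e2 e3 e4 (by rwa [abs_of_pos hp0])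
    · intro p hp q hq hpq
      obtain ⟨hpU, hp0⟩ := Finset.mem_filter.1 hp
      obtain ⟨hqU, hq0⟩ := Finset.mem_filter.1 hq
      have e1 := (hU hpU).2.2.1
      have e2 := (hU hqU).2.2.1
      simp only [hφ, Prod.mk.injEq] at hpq
      ext <;> omega
  have hneg : (U.filter fun p => ¬ 0 < p.1).card
      ≤ z (k + s) * R'.card + ell (k + s) * T'.card := by
    rw [← Finset.card_image_of_injOn (f := φ)]
    · refine hS' _ fun t ht => ?_
      obtain ⟨p, hp, rfl⟩ := Finset.mem_image.1 ht
      obtain ⟨hpU, hp0⟩ := Finset.mem_filter.1 hp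
      obtain ⟨e1, e2, e3, e4⟩ := hU hpU
      refine isPosSolution_natAbs e2 e3 e4 ?_
      rw [abs_of_nonpos (not_lt.1 hp0)]
      convert e1 using 4
      · rw [mul_right_comm, ← mul_pow, mul_comm]; simp
      · rw [mul_right_comm ((-1) ^ k), ← mul_pow]; simp [mul_comm]
    · intro p hp q hq hpq
      obtain ⟨hpU, hp0⟩ := Finset.mem_filter.1 hp
      obtain ⟨hqU, hq0⟩ := Finset.mem_filter.1 hq
      have e1 := (hU hpU).2.2.1
      have e2 := (hU hqU).2.2.1
      simp only [hφ, Prod.mk.injEq] at hpq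
      ext <;> omega
  have h1 := Nat.mul_le_mul_left (z (k + s)) hroots
  have h2 := Nat.mul_le_mul_left (ell (k + s)) hcrit
  rw [mul_add] at h1 h2
  omega
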